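/- Let 1 ≤ N ≤ 9 and let Ω ⊂ ℝ^N be a smoothly bounded domain. Let (λ*, μ*) with λ*, μ* > 0, and suppose (u_n, v_n) is a sequence of stable classical solutions of the Gelfand system with parameters (λ_n, μ_n) = (1 − 1/n)(λ*, μ*), such that u_n and v_n increase pointwise to functions u* and v*. Then u* and v* are bounded on Ω, and (u*, v*) is a smooth (classical) solution of the Gelfand system with parameters (λ*, μ*). In particular, extremal solutions of the Gelfand system are smooth for 1 ≤ N ≤ 9. -/

import Mathlib

open MeasureTheory Real
open scoped RealInnerProductSpace

/-- The Laplacian of `u : ℝ^N → ℝ`, computed as the sum of second derivatives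
along the standard basis directions. -/
noncomputable def lap {N : ℕ} (u : EuclideanSpace ℝ (Fin N) → ℝ)
    (x : EuclideanSpace ℝ (Fin N)) : ℝ :=
  ∑ i : Fin N,
    fderiv ℝ (fun y => fderiv ℝ u y (EuclideanSpace.single i 1)) x (EuclideanSpace.single i 1)

/-- A (smoothly bounded) domain: a nonempty bounded open connected subset of `ℝ^N`. -/
def IsBoundedDomain {N : ℕ} (Ω : Set (EuclideanSpace ℝ (Fin N))) : Prop :=
  IsOpen Ω ∧ IsConnected Ω ∧ Bornology.IsBounded Ω

/-- `(u, v)` is a classical solution of the Gelfand system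
`-Δu = μ e^v`, `-Δv = λ e^u` in `Ω`, `u = v = 0` on `∂Ω`. -/
def IsGelfandSolution {N : ℕ} (Ω : Set (EuclideanSpace ℝ (Fin N))) (lam mu : ℝ)
    (u v : EuclideanSpace ℝ (Fin N) → ℝ) : Prop :=
  ContDiffOn ℝ 2 u (closure Ω) ∧ ContDiffOn ℝ 2 v (closure Ω) ∧
  (∀ x ∈ Ω, -lap u x = mu * exp (v x)) ∧
  (∀ x ∈ Ω, -lap v x = lam * exp (u x)) ∧
  (∀ x ∈ frontier Ω, u x = 0) ∧ (∀ x ∈ frontier Ω, v x = 0)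

/-- `(u, v)` is a stable classical solution of the Gelfand system: there exist `λ₁ ≥ 0` and
positive eigenfunctions `φ₁, ψ₁ ∈ C²(Ω̄)` of the linearized system, vanishing on `∂Ω`. -/
def IsStableGelfandSolution {N : ℕ} (Ω : Set (EuclideanSpace ℝ (Fin N))) (lam mu : ℝ)
    (u v : EuclideanSpace ℝ (Fin N) → ℝ) : Prop :=
  IsGelfandSolution Ω lam mu u v ∧
  ∃ (lam1 : ℝ) (φ₁ ψ₁ : EuclideanSpace ℝ (Fin N) → ℝ),
    0 ≤ lam1 ∧
    ContDiffOn ℝ 2 φ₁ (closure Ω) ∧ ContDiffOn ℝ 2 ψ₁ (closure Ω) ∧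
    (∀ x ∈ Ω, 0 < φ₁ x) ∧ (∀ x ∈ Ω, 0 < ψ₁ x) ∧
    (∀ x ∈ Ω, -lap φ₁ x - mu * exp (v x) * ψ₁ x = lam1 * φ₁ x) ∧
    (∀ x ∈ Ω, -lap ψ₁ x - lam * exp (u x) * φ₁ x = lam1 * ψ₁ x) ∧
    (∀ x ∈ frontier Ω, φ₁ x = 0) ∧ (∀ x ∈ frontier Ω, ψ₁ x = 0)

section mainProof
open MeasureTheory Real Set Filter Topology
open scoped ContDiff

abbrev Eu (N : ℕ) := EuclideanSpace ℝ (Fin N)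

/-- directional derivative -/
noncomputable def dd {N : ℕ} (u : Eu N → ℝ) (e x : Eu N) : ℝ := fderiv ℝ u x e

noncomputable def bs {N : ℕ} (i : Fin N) : Eu N := EuclideanSpace.single i 1

/-- gradient pairing -/
noncomputable def gg {N : ℕ} (u w : Eu N → ℝ) (x : Eu N) : ℝ := ∑ i, dd u (bs i) x * dd w (bs i) x

section basics
variable {N : ℕ} {u w f g : Eu N → ℝ} {e e' x p : Eu N}

lemma lap_def : lap u x = ∑ i, dd (dd u (bs i)) (bs i) x := rfl

lemma dd_congr (h : f =ᶠ[𝓝 x] g) : dd f e x = dd g e x := by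
  unfold dd; rw [h.fderiv_eq]

lemma dd_congr_ev (h : f =ᶠ[𝓝 x] g) : dd f e =ᶠ[𝓝 x] dd g e := by
  filter_upwards [h.eventuallyEq_nhds] with y hy using dd_congr hy

lemma lap_congr (h : f =ᶠ[𝓝 x] g) : lap f x = lap g x := by
  simp only [lap_def]
  exact Finset.sum_congr rfl fun i _ => dd_congr (dd_congr_ev h)

lemma ContDiffAt.dd {n m : WithTop ℕ∞} (h : ContDiffAt ℝ n u x) (hm : m + 1 ≤ n) (e : Eu N) :
    ContDiffAt ℝ m (dd u e) x := by
  exact (h.fderiv_right hm).clm_apply contDiffAt_const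

lemma ContDiffOn.dd {n m : WithTop ℕ∞} {Ω : Set (Eu N)} (hΩ : IsOpen Ω) (h : ContDiffOn ℝ n u Ω)
    (hm : m + 1 ≤ n) (e : Eu N) :
    ContDiffOn ℝ m (dd u e) Ω := fun _ hx =>
  ((h.contDiffAt (hΩ.mem_nhds hx)).dd hm e).contDiffWithinAt

lemma cd_ev {n : ℕ} (h : ContDiffAt ℝ n u x) : ∀ᶠ y in 𝓝 x, ContDiffAt ℝ n u y :=
  h.eventually (by simp)

lemma da_of {n : WithTop ℕ∞} (h : ContDiffAt ℝ n u x) (hn : n ≠ 0) : DifferentiableAt ℝ u x :=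
  h.differentiableAt hn

lemma dd_add (hf : DifferentiableAt ℝ f x) (hg : DifferentiableAt ℝ g x) :
    dd (fun y => f y + g y) e x = dd f e x + dd g e x := by
  unfold dd; rw [fderiv_fun_add hf hg]; rfl

lemma dd_sub (hf : DifferentiableAt ℝ f x) (hg : DifferentiableAt ℝ g x) :
    dd (fun y => f y - g y) e x = dd f e x - dd g e x := by
  unfold dd; rw [fderiv_fun_sub hf hg]; rfl

lemma dd_const (c : ℝ) : dd (fun _ => c) e x = 0 := by
  unfold dd; simp

lemma dd_mul (hf : DifferentiableAt ℝ f x) (hg : DifferentiableAt ℝ g x) :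
    dd (fun y => f y * g y) e x = f x * dd g e x + g x * dd f e x := by
  unfold dd; rw [fderiv_fun_mul hf hg]; simp

lemma dd_cmul (c : ℝ) (hf : DifferentiableAt ℝ f x) :
    dd (fun y => c * f y) e x = c * dd f e x := by
  unfold dd; rw [fderiv_const_mul hf]; simp

lemma dd_comp {φ : ℝ → ℝ} (hφ : DifferentiableAt ℝ φ (f x)) (hf : DifferentiableAt ℝ f x) :
    dd (fun y => φ (f y)) e x = deriv φ (f x) * dd f e x := by
  unfold dd
  have := (hφ.hasDerivAt.comp_hasFDerivAt x hf.hasFDerivAt).fderiv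
  have h2 : fderiv ℝ (fun y => φ (f y)) x = deriv φ (f x) • fderiv ℝ f x := this
  rw [h2]; simp

lemma dd_smul_arg (c : ℝ) : dd f (c • e) x = c * dd f e x := by simp [dd]
lemma dd_add_arg : dd f (e + e') x = dd f e x + dd f e' x := by simp [dd]
lemma dd_neg_arg : dd f (-e) x = - dd f e x := by simp [dd]
lemma dd_sub_arg : dd f (e - e') x = dd f e x - dd f e' x := by simp [dd]

lemma dd_add_ev (hf : ContDiffAt ℝ 1 f x) (hg : ContDiffAt ℝ 1 g x) :
    dd (fun y => f y + g y) e =ᶠ[𝓝 x] fun y => dd f e y + dd g e y := by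
  filter_upwards [cd_ev (n := 1) hf, cd_ev (n := 1) hg] with y h1 h2
  exact dd_add (da_of h1 (by simp)) (da_of h2 (by simp))

lemma dd_sub_ev (hf : ContDiffAt ℝ 1 f x) (hg : ContDiffAt ℝ 1 g x) :
    dd (fun y => f y - g y) e =ᶠ[𝓝 x] fun y => dd f e y - dd g e y := by
  filter_upwards [cd_ev (n := 1) hf, cd_ev (n := 1) hg] with y h1 h2
  exact dd_sub (da_of h1 (by simp)) (da_of h2 (by simp))

lemma dd_mul_ev (hf : ContDiffAt ℝ 1 f x) (hg : ContDiffAt ℝ 1 g x) :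
    dd (fun y => f y * g y) e =ᶠ[𝓝 x] fun y => f y * dd g e y + g y * dd f e y := by
  filter_upwards [cd_ev (n := 1) hf, cd_ev (n := 1) hg] with y h1 h2
  exact dd_mul (da_of h1 (by simp)) (da_of h2 (by simp))

lemma dd_cmul_ev (c : ℝ) (hf : ContDiffAt ℝ 1 f x) :
    dd (fun y => c * f y) e =ᶠ[𝓝 x] fun y => c * dd f e y := by
  filter_upwards [cd_ev (n := 1) hf] with y h1
  exact dd_cmul c (da_of h1 (by simp))

lemma c21 (hf : ContDiffAt ℝ 2 f x) : ContDiffAt ℝ 1 f x := hf.of_le (by norm_num)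
lemma c2d (hf : ContDiffAt ℝ 2 f x) : DifferentiableAt ℝ f x := da_of hf (by simp)
lemma c2dd (hf : ContDiffAt ℝ 2 f x) (e : Eu N) : DifferentiableAt ℝ (dd f e) x :=
  da_of (hf.dd (m := 1) (by norm_num) e) (by simp)

lemma lap_add (hf : ContDiffAt ℝ 2 f x) (hg : ContDiffAt ℝ 2 g x) :
    lap (fun y => f y + g y) x = lap f x + lap g x := by
  simp only [lap_def, ← Finset.sum_add_distrib]
  refine Finset.sum_congr rfl fun i _ => ?_
  rw [dd_congr (dd_add_ev (c21 hf) (c21 hg)), dd_add (c2dd hf _) (c2dd hg _)]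

lemma lap_sub (hf : ContDiffAt ℝ 2 f x) (hg : ContDiffAt ℝ 2 g x) :
    lap (fun y => f y - g y) x = lap f x - lap g x := by
  simp only [lap_def, ← Finset.sum_sub_distrib]
  refine Finset.sum_congr rfl fun i _ => ?_
  rw [dd_congr (dd_sub_ev (c21 hf) (c21 hg)), dd_sub (c2dd hf _) (c2dd hg _)]

lemma lap_cmul (c : ℝ) (hf : ContDiffAt ℝ 2 f x) :
    lap (fun y => c * f y) x = c * lap f x := by
  simp only [lap_def, Finset.mul_sum]
  refine Finset.sum_congr rfl fun i _ => ?_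
  rw [dd_congr (dd_cmul_ev c (c21 hf)), dd_cmul _ (c2dd hf _)]

lemma lap_const (c : ℝ) : lap (fun _ : Eu N => c) x = 0 := by
  simp only [lap_def]
  refine Finset.sum_eq_zero fun i _ => ?_
  have : dd (fun _ : Eu N => c) (bs i) = fun _ => 0 := by ext y; exact dd_const c
  rw [this, dd_const]

lemma lap_mul (hf : ContDiffAt ℝ 2 f x) (hg : ContDiffAt ℝ 2 g x) :
    lap (fun y => f y * g y) x = f x * lap g x + g x * lap f x + 2 * gg f g x := by
  simp only [lap_def, gg, Finset.mul_sum, ← Finset.sum_add_distrib]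
  refine Finset.sum_congr rfl fun i _ => ?_
  rw [dd_congr (dd_mul_ev (c21 hf) (c21 hg)),
    dd_add (f := fun y => f y * dd g (bs i) y) (g := fun y => g y * dd f (bs i) y)
      ((c2d hf).mul (c2dd hg _)) ((c2d hg).mul (c2dd hf _)),
    dd_mul (c2d hf) (c2dd hg _), dd_mul (c2d hg) (c2dd hf _)]
  ring

lemma lap_comp {φ : ℝ → ℝ} (hφ : ContDiff ℝ 2 φ) (hf : ContDiffAt ℝ 2 f x) :
    lap (fun y => φ (f y)) x = deriv φ (f x) * lap f x + deriv (deriv φ) (f x) * gg f f x := by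
  simp only [lap_def, gg, Finset.mul_sum, ← Finset.sum_add_distrib]
  refine Finset.sum_congr rfl fun i _ => ?_
  have hd : Differentiable ℝ φ := hφ.differentiable (by simp)
  have hd2 : Differentiable ℝ (deriv φ) := by
    have : ContDiff ℝ 1 (deriv φ) := by
      have h := (contDiff_succ_iff_deriv (n := 1) (f := φ) (𝕜 := ℝ)).1 (by rw [one_add_one_eq_two]; exact hφ)
      exact h.2.2
    exact this.differentiable (by simp)
  have h1 : dd (fun y => φ (f y)) (bs i) =ᶠ[𝓝 x] fun y => deriv φ (f y) * dd f (bs i) y := by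
    filter_upwards [cd_ev (n := 2) hf] with y h1
    exact dd_comp (hd _) (c2d h1)
  rw [dd_congr h1, dd_mul (f := fun y => deriv φ (f y)) ((hd2 _).comp x (c2d hf)) (c2dd hf _), dd_comp (hd2 _) (c2d hf)]
  ring

lemma dd_fderiv2 (hf : ContDiffAt ℝ 2 f x) : dd (dd f e) e' x = fderiv ℝ (fderiv ℝ f) x e' e := by
  have h1 : DifferentiableAt ℝ (fderiv ℝ f) x := (hf.fderiv_right (m := 1) (by norm_num)).differentiableAt (by simp)
  have : fderiv ℝ (dd f e) x = (fderiv ℝ (fderiv ℝ f) x).flip e := by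
    have h := h1.hasFDerivAt.clm_apply (hasFDerivAt_const e x)
    have h3 := h.fderiv
    unfold dd
    rw [h3]; ext y; simp
  unfold dd at *
  rw [this]; rfl

lemma dd_comm (hf : ContDiffAt ℝ 2 f x) : dd (dd f e) e' x = dd (dd f e') e x := by
  rw [dd_fderiv2 hf, dd_fderiv2 hf]
  have := hf.isSymmSndFDerivAt (by simp)
  exact this _ _

lemma dd_comm_ev (hf : ContDiffAt ℝ 2 f x) : dd (dd f e) e' =ᶠ[𝓝 x] dd (dd f e') e := by
  filter_upwards [cd_ev (n := 2) hf] with y h1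
  exact dd_comm h1

lemma dd_sum {ι : Type*} (s : Finset ι) (F : ι → Eu N → ℝ) (h : ∀ i ∈ s, DifferentiableAt ℝ (F i) x) :
    dd (fun y => ∑ i ∈ s, F i y) e x = ∑ i ∈ s, dd (F i) e x := by
  unfold dd; rw [fderiv_fun_sum h]; simp

lemma lap_dd (hf : ContDiffAt ℝ 3 f x) : lap (dd f e) x = dd (lap f) e x := by
  have h2 : ∀ e, ContDiffAt ℝ 2 (dd f e) x := fun e => hf.dd (by norm_num) e
  have hl : lap f = fun y => ∑ i, dd (dd f (bs i)) (bs i) y := rfl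
  rw [hl, dd_sum _ _ (fun i _ => c2dd (h2 _) _), lap_def]
  refine Finset.sum_congr rfl fun i _ => ?_
  rw [dd_congr (dd_comm_ev (e := e) (e' := bs i) (hf.of_le (by norm_num))), dd_comm (h2 _)]

lemma ContDiffAt.lap {n m : WithTop ℕ∞} (hf : ContDiffAt ℝ n f x) (hm : m + 1 + 1 ≤ n) :
    ContDiffAt ℝ m (lap f) x := by
  have hl : _root_.lap f = fun y => ∑ i, _root_.dd (_root_.dd f (bs i)) (bs i) y := rfl
  rw [hl]
  exact ContDiffAt.sum fun i _ => (hf.dd (m := m + 1) hm _).dd le_rfl _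

/-- second derivative along a line -/
lemma line_deriv (t : ℝ) (hf : DifferentiableAt ℝ f (x + t • e)) :
    HasDerivAt (fun s : ℝ => f (x + s • e)) (dd f e (x + t • e)) t := by
  have h1 : HasDerivAt (fun s : ℝ => x + s • e) e t := by
    simpa using ((hasDerivAt_id t).smul_const e).const_add x
  exact hf.hasFDerivAt.comp_hasDerivAt t h1

lemma snd_test (hf : ContDiffAt ℝ 2 f x) (hm : IsLocalMax f x) : dd (dd f e) e x ≤ 0 := by
  by_contra! hpos
  set φ : ℝ → ℝ := fun s => f (x + s • e) with hφ
  have hc : Tendsto (fun s : ℝ => x + s • e) (𝓝 0) (𝓝 x) := by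
    have : Continuous (fun s : ℝ => x + s • e) := by fun_prop
    simpa using this.tendsto 0
  have hev : ∀ᶠ s in 𝓝 (0:ℝ), HasDerivAt φ (dd f e (x + s • e)) s := by
    filter_upwards [hc.eventually (cd_ev (n := 2) hf)] with s hs
    exact line_deriv s (c2d hs)
  have hd : deriv φ =ᶠ[𝓝 0] fun s => dd f e (x + s • e) := by
    filter_upwards [hev] with s hs using hs.deriv
  have hdd : deriv (deriv φ) 0 = dd (dd f e) e x := by
    rw [hd.deriv_eq]
    have := line_deriv (f := dd f e) (x := x) (e := e) 0 (by simpa using c2dd hf e)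
    simpa using this.deriv
  have hmax : IsLocalMax φ 0 := by
    have := hc.eventually hm
    filter_upwards [this] with s hs
    simpa [hφ] using hs
  have hmin : IsLocalMin φ 0 := by
    apply isLocalMin_of_deriv_deriv_pos
    · rw [hdd]; exact hpos
    · exact hmax.deriv_eq_zero
    · exact hev.self_of_nhds.continuousAt
  have hconst : φ =ᶠ[𝓝 0] fun _ => φ 0 := by
    filter_upwards [hmax, hmin] with s h1 h2 using le_antisymm h1 h2
  have h3 : deriv φ =ᶠ[𝓝 0] fun _ => 0 := by
    filter_upwards [hconst.eventuallyEq_nhds] with s hs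
    rw [hs.deriv_eq]; simp
  rw [← hdd, h3.deriv_eq] at hpos
  simp at hpos

lemma lap_nonpos_of_max (hf : ContDiffAt ℝ 2 f x) (hm : IsLocalMax f x) : lap f x ≤ 0 := by
  rw [lap_def]; exact Finset.sum_nonpos fun i _ => snd_test hf hm

/-- base maximum principle -/
theorem maxP {Ω : Set (Eu N)} (hΩ : IsOpen Ω) (hb : Bornology.IsBounded Ω)
    (hf : ∀ x ∈ Ω, ContDiffAt ℝ 2 f x)
    (hbd : ∀ p ∈ frontier Ω, ∀ κ > 0, ∀ᶠ x in 𝓝[Ω] p, f x ≤ κ)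
    (hl : ∀ x ∈ Ω, 0 < f x → 0 < lap f x) : ∀ x ∈ Ω, f x ≤ 0 := by
  intro x0 hx0
  by_contra! hpos
  set K : Set (Eu N) := {x | x ∈ Ω ∧ f x0 ≤ f x} with hK
  have hKcl : IsClosed K := by
    rw [← isSeqClosed_iff_isClosed]
    intro y p hy hp
    have hpcl : p ∈ closure Ω := mem_closure_of_tendsto hp (Eventually.of_forall fun n => (hy n).1)
    have hpΩ : p ∈ Ω := by
      by_contra hn
      have hpf : p ∈ frontier Ω := by rw [hΩ.frontier_eq]; exact ⟨hpcl, hn⟩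
      have h1 := hbd p hpf (f x0 / 2) (by linarith)
      have h2 : Tendsto y atTop (𝓝[Ω] p) :=
        tendsto_nhdsWithin_iff.2 ⟨hp, Eventually.of_forall fun n => (hy n).1⟩
      obtain ⟨n, hn⟩ := (h2.eventually h1).exists
      have := (hy n).2
      linarith
    refine ⟨hpΩ, ?_⟩
    have hcont := (hf p hpΩ).continuousAt
    exact ge_of_tendsto (hcont.tendsto.comp hp) (Eventually.of_forall fun n => (hy n).2)
  have hKc : IsCompact K := Metric.isCompact_of_isClosed_isBounded hKcl (hb.subset fun x hx => hx.1)
  obtain ⟨m, hm, hmax⟩ := hKc.exists_isMaxOn ⟨x0, hx0, le_rfl⟩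
    (fun x hx => (hf x hx.1).continuousAt.continuousWithinAt)
  have hloc : IsLocalMax f m := by
    filter_upwards [hΩ.mem_nhds hm.1] with y hy
    by_cases h : f x0 ≤ f y
    · exact hmax ⟨hy, h⟩
    · have := hm.2; linarith
  have h1 := lap_nonpos_of_max (hf m hm.1) hloc
  have h2 := hl m hm.1 (lt_of_lt_of_le hpos hm.2)
  linarith

lemma inner_cd {n : WithTop ℕ∞} (e p : Eu N) : ContDiff ℝ n (fun y : Eu N => inner ℝ (y - p) e) :=
  (contDiff_id.sub contDiff_const).inner ℝ contDiff_const

lemma dd_inner : dd (fun y : Eu N => inner ℝ (y - p) e') e x = inner ℝ e e' := by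
  unfold dd
  have h : HasFDerivAt (fun y : Eu N => inner ℝ (y - p) e') ((innerSL ℝ).flip e') x := by
    have := ((innerSL ℝ).flip e').hasFDerivAt (x := x - p)
    have h2 := this.comp x ((hasFDerivAt_id x).sub_const p)
    exact h2
  rw [h.fderiv]; rfl

lemma lap_inner : lap (fun y : Eu N => inner ℝ (y - p) e) x = 0 := by
  rw [lap_def]; refine Finset.sum_eq_zero fun i _ => ?_
  have : dd (fun y : Eu N => inner ℝ (y - p) e) (bs i) = fun _ => inner ℝ (bs i) e := by
    ext y; exact dd_inner
  rw [this, dd_const]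

lemma dd_nsq : dd (fun y : Eu N => ‖y - p‖ ^ 2) e x = 2 * inner ℝ (x - p) e := by
  unfold dd
  have h := ((hasStrictFDerivAt_norm_sq (x - p)).hasFDerivAt).comp x ((hasFDerivAt_id x).sub_const p)
  have h2 : HasFDerivAt (fun y : Eu N => ‖y - p‖ ^ 2) _ x := h
  rw [h2.fderiv]; simp [inner_sub_left]

lemma nsq_cd {n : WithTop ℕ∞} (p : Eu N) : ContDiff ℝ n (fun y : Eu N => ‖y - p‖ ^ 2) :=
  (contDiff_norm_sq ℝ).comp (contDiff_id.sub contDiff_const)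

lemma bs_norm (i : Fin N) : ‖bs i‖ = 1 := by simp [bs]

lemma lap_nsq : lap (fun y : Eu N => ‖y - p‖ ^ 2) x = 2 * N := by
  rw [lap_def]
  have h : ∀ i, dd (dd (fun y : Eu N => ‖y - p‖ ^ 2) (bs i)) (bs i) x = 2 := by
    intro i
    have : dd (fun y : Eu N => ‖y - p‖ ^ 2) (bs i) = fun y => 2 * inner ℝ (y - p) (bs i) := by
      ext y; exact dd_nsq
    rw [this, dd_cmul _ ((inner_cd (n := 1) _ _).contDiffAt.differentiableAt (by simp)), dd_inner]
    rw [real_inner_self_eq_norm_sq, bs_norm]; norm_num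
  simp [h, mul_comm]

lemma sum_inner_sq : ∑ i, (inner ℝ (bs i : Eu N) e) ^ 2 = ‖e‖ ^ 2 := by
  simp [bs, EuclideanSpace.norm_sq_eq, EuclideanSpace.inner_single_left]

lemma lap_innersq : lap (fun y : Eu N => (inner ℝ (y - p) e) ^ 2) x = 2 * ‖e‖ ^ 2 := by
  have := lap_comp (φ := fun s => s ^ 2) (x := x) (f := fun y : Eu N => inner ℝ (y - p) e)
    (by fun_prop) (inner_cd _ _).contDiffAt
  rw [this, lap_inner]
  have h2 : deriv (deriv fun s : ℝ => s ^ 2) = fun _ => 2 := by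
    have : (deriv fun s : ℝ => s ^ 2) = fun s => 2 * s := by ext s; simp
    rw [this]; ext s; simp
  rw [h2]
  simp only [gg, dd_inner, ← pow_two, sum_inner_sq]; ring

/-- gradient size -/
lemma abs_dd_le {A : ℝ} (h : ‖fderiv ℝ f x‖ ≤ A) : |dd f e x| ≤ A * ‖e‖ := by
  have := (fderiv ℝ f x).le_opNorm e
  exact this.trans (by gcongr)

end basics

section interior
variable {N : ℕ} {u w f g : Eu N → ℝ} {e e' x p : Eu N}

lemma deriv_le_of_le {a b : ℝ → ℝ} {a' b' d : ℝ} (hd : 0 < d) (ha : HasDerivAt a a' 0)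
    (hb : HasDerivAt b b' 0) (h0 : a 0 = b 0) (h : ∀ t ∈ Ioo 0 d, a t ≤ b t) : a' ≤ b' := by
  have h1 := (hb.sub ha).tendsto_slope_zero_right
  have h2 : 0 ≤ b' - a' := by
    refine ge_of_tendsto h1 ?_
    filter_upwards [Ioo_mem_nhdsGT hd] with t ht
    have := h t ht
    have ht0 := ht.1
    simp only [zero_add, Pi.sub_apply, smul_eq_mul, h0]
    apply mul_nonneg (by positivity)
    linarith
  linarith

/-- pairing with an orthonormal expansion -/
lemma sum_inner_clm (L : Eu N →L[ℝ] ℝ) (v : Eu N) : ∑ i, inner ℝ (bs i) v * L (bs i) = L v := by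
  have hv : v = ∑ i, (inner ℝ (bs i) v) • bs i := by
    have := (EuclideanSpace.basisFun (Fin N) ℝ).sum_repr' v
    simpa [bs] using this.symm
  conv_rhs => rw [hv]
  simp

lemma sum_inner_dd (v : Eu N) : ∑ i, inner ℝ (bs i) v * dd f (bs i) x = dd f v x :=
  sum_inner_clm _ _

noncomputable def refl0 (e v : Eu N) : Eu N := v - (2 * inner ℝ v e) • e

lemma dd_refl (hw : DifferentiableAt ℝ w (x + refl0 e (p - x))) :
    dd (fun y => w (x + refl0 e (y - x))) e' p = dd w (refl0 e e') (x + refl0 e (p - x)) := by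
  unfold dd
  set L : Eu N →L[ℝ] Eu N := ContinuousLinearMap.id ℝ _ - ((2:ℝ) • (innerSL ℝ e)).smulRight e with hL
  have hLv : ∀ v, L v = refl0 e v := by
    intro v; simp [hL, refl0, real_inner_comm]
  have h1 : HasFDerivAt (fun y => x + refl0 e (y - x)) L p := by
    have := (L.hasFDerivAt.comp p ((hasFDerivAt_id p).sub_const x)).const_add x
    simp only [← hLv]
    exact this
  have h2 := hw.hasFDerivAt.comp p h1
  have h3 : fderiv ℝ (fun y => w (x + refl0 e (y - x))) p = _ := h2.fderiv
  rw [h3]; simp [hLv]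

lemma refl_cont : Continuous fun y : Eu N => x + refl0 e (y - x) := by
  unfold refl0; fun_prop

lemma refl_cd {n : WithTop ℕ∞} : ContDiff ℝ n fun y : Eu N => x + refl0 e (y - x) := by
  unfold refl0
  refine contDiff_const.add ((contDiff_id.sub contDiff_const).sub ?_)
  exact (contDiff_const.mul (inner_cd e x)).smul contDiff_const

lemma lap_refl (he : ‖e‖ = 1) (hw : ContDiffAt ℝ 2 w (x + refl0 e (p - x))) :
    lap (fun y => w (x + refl0 e (y - x))) p = lap w (x + refl0 e (p - x)) := by
  set q := x + refl0 e (p - x) with hq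
  have h2 : ∀ i, dd (dd (fun y => w (x + refl0 e (y - x))) (bs i)) (bs i) p
      = dd (dd w (refl0 e (bs i))) (refl0 e (bs i)) q := by
    intro i
    have : dd (fun y => w (x + refl0 e (y - x))) (bs i) =ᶠ[𝓝 p]
        fun y => dd w (refl0 e (bs i)) (x + refl0 e (y - x)) := by
      have := (refl_cont (x := x) (e := e)).tendsto p |>.eventually (cd_ev (n := 2) hw)
      filter_upwards [this] with y hy
      exact dd_refl (c2d hy)
    rw [dd_congr this]
    exact dd_refl (c2dd hw _)
  rw [lap_def, lap_def]
  simp only [h2]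
  set B := fderiv ℝ (fderiv ℝ w) q with hB
  have h3 : ∀ a b, dd (dd w a) b q = B b a := fun a b => dd_fderiv2 hw
  simp only [h3]
  have hs : ∀ a b, B a b = B b a := by
    intro a b
    rw [← h3, ← h3]; exact dd_comm hw
  have h4 : ∀ i : Fin N, B (refl0 e (bs i)) (refl0 e (bs i)) = B (bs i) (bs i)
      - 4 * (inner ℝ (bs i) e * B e (bs i)) + 4 * B e e * (inner ℝ (bs i) e) ^ 2 := by
    intro i
    simp only [refl0, map_sub, map_smul, sub_apply, smul_apply,
      smul_eq_mul]
    rw [hs (bs i) e]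
    ring
  simp only [h4, Finset.sum_add_distrib, Finset.sum_sub_distrib, ← Finset.mul_sum, sum_inner_sq,
    sum_inner_clm, he]
  ring

lemma refl_norm (he : ‖e‖ = 1) (v : Eu N) : ‖refl0 e v‖ = ‖v‖ := by
  have : ‖refl0 e v‖ ^ 2 = ‖v‖ ^ 2 := by
    unfold refl0
    rw [norm_sub_sq_real, inner_smul_right, norm_smul, mul_pow, he]
    simp only [Real.norm_eq_abs, sq_abs]; ring
  exact (pow_left_inj₀ (norm_nonneg _) (norm_nonneg _) two_ne_zero).1 this

theorem grad_est_aux {d M F : ℝ} (hd : 0 < d) (he : ‖e‖ = 1)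
    (hw : ∀ y ∈ Metric.ball x d, ContDiffAt ℝ 2 w y)
    (hM : ∀ y ∈ Metric.ball x d, |w y| ≤ M) (hF : ∀ y ∈ Metric.ball x d, |lap w y| < F) :
    dd w e x ≤ N * M / d + F * d / 2 := by
  set R : Eu N → Eu N := fun y => x + refl0 e (y - x) with hR
  have hRb : ∀ y ∈ Metric.ball x d, R y ∈ Metric.ball x d := by
    intro y hy
    rw [mem_ball_iff_norm] at *
    simp only [hR, add_sub_cancel_left, refl_norm he]; exact hy
  set Y : Eu N → ℝ := fun y => inner ℝ (y - x) e with hY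
  have hYc : Continuous Y := (inner_cd (n := 0) e x).continuous
  set H : Set (Eu N) := {y | y ∈ Metric.ball x d ∧ 0 < Y y} with hH
  have hHo : IsOpen H := Metric.isOpen_ball.inter (isOpen_lt continuous_const hYc)
  set ψ : Eu N → ℝ := fun y => (M / d ^ 2) * (‖y - x‖ ^ 2 - N * (Y y) ^ 2 + (N * d) * Y y)
    + F / 2 * (d * Y y - (Y y) ^ 2) with hψ
  have hM0 : 0 ≤ M := (abs_nonneg _).trans (hM x (Metric.mem_ball_self hd))
  have hF0 : 0 < F := (abs_nonneg _).trans_lt (hF x (Metric.mem_ball_self hd))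
  have hYle : ∀ y, Y y ≤ ‖y - x‖ := by
    intro y
    have := real_inner_le_norm (y - x) e
    rw [he, mul_one] at this; exact this
  have cY : ∀ y, ContDiffAt ℝ 2 Y y := fun y => (inner_cd e x).contDiffAt
  have cY2 : ∀ y, ContDiffAt ℝ 2 (fun y => (Y y) ^ 2) y := fun y => (cY y).pow 2
  have cn : ∀ y, ContDiffAt ℝ 2 (fun y : Eu N => ‖y - x‖ ^ 2) y := fun y => (nsq_cd x).contDiffAt
  have c1 : ∀ y, ContDiffAt ℝ 2 (fun y => ‖y - x‖ ^ 2 - N * (Y y) ^ 2) y :=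
    fun y => (cn y).sub (contDiffAt_const.mul (cY2 y))
  have c2 : ∀ y, ContDiffAt ℝ 2 (fun y => ‖y - x‖ ^ 2 - N * (Y y) ^ 2 + (N * d) * Y y) y :=
    fun y => (c1 y).add (contDiffAt_const.mul (cY y))
  have c3 : ∀ y, ContDiffAt ℝ 2 (fun y => d * Y y - (Y y) ^ 2) y :=
    fun y => (contDiffAt_const.mul (cY y)).sub (cY2 y)
  have cψ : ∀ y, ContDiffAt ℝ 2 ψ y := fun y =>
    (contDiffAt_const.mul (c2 y)).add (contDiffAt_const.mul (c3 y))
  have lψ : ∀ y, lap ψ y = - F := by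
    intro y
    have l1 : lap Y y = 0 := lap_inner
    have l2 : lap (fun y => (Y y) ^ 2) y = 2 := by rw [lap_innersq, he]; norm_num
    rw [hψ, lap_add (contDiffAt_const.mul (c2 y)) (contDiffAt_const.mul (c3 y)), lap_cmul _ (c2 y),
      lap_cmul _ (c3 y), lap_sub (contDiffAt_const.mul (cY y)) (cY2 y), lap_cmul _ (cY y),
      lap_add (c1 y) (contDiffAt_const.mul (cY y)), lap_cmul _ (cY y),
      lap_sub (cn y) (contDiffAt_const.mul (cY2 y)), lap_cmul _ (cY2 y), l1, l2, lap_nsq]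
    ring
  set φ : Eu N → ℝ := fun y => (1/2) * (w y - w (R y)) with hφ
  have cwR : ∀ y ∈ Metric.ball x d, ContDiffAt ℝ 2 (fun y => w (R y)) y := fun y hy =>
    (hw _ (hRb y hy)).comp y refl_cd.contDiffAt
  have cφ : ∀ y ∈ Metric.ball x d, ContDiffAt ℝ 2 φ y := fun y hy =>
    contDiffAt_const.mul ((hw y hy).sub (cwR y hy))
  have lφ : ∀ y ∈ Metric.ball x d, -F < lap φ y := by
    intro y hy
    rw [hφ, lap_cmul _ ((hw y hy).sub (cwR y hy)), lap_sub (hw y hy) (cwR y hy),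
      lap_refl he (hw _ (hRb y hy))]
    have h1 := abs_lt.1 (hF y hy)
    have h2 := abs_lt.1 (hF _ (hRb y hy))
    simp only [hR] at h2
    linarith [h1.1, h2.2]
  have key : ∀ y ∈ H, φ y - ψ y ≤ 0 := by
    apply maxP hHo (Metric.isBounded_ball.subset fun y hy => hy.1)
    · intro y hy; exact (cφ y hy.1).sub (cψ y)
    · intro q hq κ hκ
      have hqcl : q ∈ closure H := frontier_subset_closure hq
      have hqn : q ∉ H := by rw [hHo.frontier_eq] at hq; exact hq.2
      have hq1 : ‖q - x‖ ≤ d := by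
        have : closure H ⊆ Metric.closedBall x d :=
          closure_minimal (fun y hy => Metric.ball_subset_closedBall hy.1) Metric.isClosed_closedBall
        simpa [dist_eq_norm] using this hqcl
      have hq2 : 0 ≤ Y q := by
        have : closure H ⊆ {y | 0 ≤ Y y} :=
          closure_minimal (fun y hy => le_of_lt hy.2) (isClosed_le continuous_const hYc)
        exact this hqcl
      have hYd : Y q ≤ d := (hYle q).trans hq1
      have hterm : 0 ≤ F / 2 * (d * Y q - (Y q) ^ 2) := by
        have : 0 ≤ Y q * (d - Y q) := mul_nonneg hq2 (by linarith)
        have : 0 ≤ F * (Y q * (d - Y q)) := mul_nonneg hF0.le this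
        nlinarith
      have hN : 0 ≤ (N:ℝ) * (Y q * (d - Y q)) :=
        mul_nonneg (Nat.cast_nonneg _) (mul_nonneg hq2 (by linarith))
      have hψc : ContinuousAt ψ q := (cψ q).continuousAt
      by_cases hqd : ‖q - x‖ < d
      · have hqb : q ∈ Metric.ball x d := mem_ball_iff_norm.2 hqd
        have hY0 : Y q = 0 := by
          by_contra hne
          exact hqn ⟨hqb, lt_of_le_of_ne hq2 (Ne.symm hne)⟩
        have hφq : φ q = 0 := by
          have : R q = q := by
            have h0 : inner ℝ (q - x) e = 0 := hY0
            simp [hR, refl0, h0]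
          simp [hφ, this]
        have hψq : 0 ≤ ψ q := by
          simp only [hψ, hY0]
          have : 0 ≤ M / d ^ 2 * ‖q - x‖ ^ 2 := by positivity
          simpa using this
        have hc : ContinuousAt (fun y => φ y - ψ y) q := (cφ q hqb).continuousAt.sub hψc
        have hlt : φ q - ψ q < κ := by rw [hφq]; linarith
        have := hc.eventually (gt_mem_nhds hlt)
        exact (this.filter_mono nhdsWithin_le_nhds).mono fun y hy => le_of_lt hy
      · have hqd' : ‖q - x‖ = d := le_antisymm hq1 (not_lt.1 hqd)
        have hψq : M ≤ ψ q := by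
          simp only [hψ, hqd']
          have : M / d ^ 2 * (d ^ 2 - N * (Y q) ^ 2 + N * d * Y q)
              = M + M / d ^ 2 * (N * (Y q * (d - Y q))) := by
            field_simp
            ring
          rw [this]
          have : 0 ≤ M / d ^ 2 * (N * (Y q * (d - Y q))) := by positivity
          linarith
        have := hψc.eventually (lt_mem_nhds (a := M - κ) (by linarith))
        filter_upwards [this.filter_mono nhdsWithin_le_nhds, self_mem_nhdsWithin] with y h1 h2
        have h3 := abs_le.1 (hM y h2.1)
        have h4 := abs_le.1 (hM _ (hRb y h2.1))
        simp only [hφ]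
        linarith [h3.2, h4.1]
    · intro y hy _
      rw [lap_sub (cφ y hy.1) (cψ y), lψ]
      linarith [lφ y hy.1]
  -- derivative comparison
  have hee : inner ℝ e e = (1:ℝ) := by rw [real_inner_self_eq_norm_sq, he]; norm_num
  have hYt : ∀ t : ℝ, Y (x + t • e) = t := by
    intro t; simp only [hY, add_sub_cancel_left, inner_smul_left, hee]; simp
  have hRt : ∀ t : ℝ, R (x + t • e) = x + t • (-e) := by
    intro t
    simp only [hR, add_sub_cancel_left, refl0, inner_smul_left, hee]
    simp [two_mul, add_smul]
  have hx := hw x (Metric.mem_ball_self hd)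
  have d1 := line_deriv (f := w) (x := x) (e := e) 0 (by simpa using c2d hx)
  have d2 := line_deriv (f := w) (x := x) (e := -e) 0 (by simpa using c2d hx)
  have d3 := ((d1.sub d2).const_mul (1/2 : ℝ))
  simp only [zero_smul, add_zero, dd_neg_arg] at d3
  have d4 : HasDerivAt (fun t : ℝ => (M / d ^ 2) * (t ^ 2 - N * t ^ 2 + (N * d) * t)
    + F / 2 * (d * t - t ^ 2)) (N * M / d + F * d / 2) 0 := by
    have hsq : HasDerivAt (fun t : ℝ => t ^ 2) 0 0 := by simpa using hasDerivAt_pow 2 (0:ℝ)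
    have hid := hasDerivAt_id (0:ℝ)
    have := (((hsq.sub (hsq.const_mul (N:ℝ))).add (hid.const_mul (N * d : ℝ))).const_mul (M / d ^ 2)).add
      (((hid.const_mul d).sub hsq).const_mul (F / 2))
    refine HasDerivAt.congr_deriv (f := fun t : ℝ => (M / d ^ 2) * (t ^ 2 - N * t ^ 2 + (N * d) * t)
      + F / 2 * (d * t - t ^ 2)) this ?_
    field_simp
    ring
  have := deriv_le_of_le hd d3 d4 (by simp) (by
    intro t ht
    have htH : x + t • e ∈ H := by
      refine ⟨?_, ?_⟩
      · rw [mem_ball_iff_norm, add_sub_cancel_left, norm_smul, he, mul_one, Real.norm_eq_abs,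
          abs_of_pos ht.1]; exact ht.2
      · rw [hYt]; exact ht.1
    have h1 := key _ htH
    simp only [hφ, hψ, hRt, hYt, add_sub_cancel_left, norm_smul, he, mul_one, Real.norm_eq_abs,
      sq_abs] at h1
    simp only [Pi.sub_apply]
    linarith)
  linarith

/-- Interior gradient estimate. -/
theorem grad_est {d M F : ℝ} (hd : 0 < d) (he : ‖e‖ = 1)
    (hw : ∀ y ∈ Metric.ball x d, ContDiffAt ℝ 2 w y)
    (hM : ∀ y ∈ Metric.ball x d, |w y| ≤ M) (hF : ∀ y ∈ Metric.ball x d, |lap w y| ≤ F) :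
    |dd w e x| ≤ N * M / d + F * d / 2 := by
  have main : ∀ e : Eu N, ‖e‖ = 1 → dd w e x ≤ N * M / d + F * d / 2 := by
    intro e he
    apply le_of_forall_pos_le_add
    intro κ hκ
    have := grad_est_aux (F := F + 2 * κ / d) hd he hw hM
      (fun y hy => by have := hF y hy; have : 0 < 2 * κ / d := by positivity
                      linarith)
    have h2 : (F + 2 * κ / d) * d / 2 = F * d / 2 + κ := by field_simp
    linarith
  rw [abs_le]
  have h1 := main e he
  have h2 := main (-e) (by rwa [norm_neg])
  rw [dd_neg_arg] at h2
  constructor <;> linarith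

end interior

section regularity
variable {N : ℕ} {u w f g : Eu N → ℝ} {e e' x p : Eu N} {Ω : Set (Eu N)}

lemma dd_tr (a : Eu N) : dd (fun y => u (y + a)) e x = dd u e (x + a) := by
  unfold dd; rw [fderiv_comp_add_right]

lemma lap_tr (a : Eu N) : lap (fun y => u (y + a)) x = lap u (x + a) := by
  simp only [lap_def]
  refine Finset.sum_congr rfl fun i _ => ?_
  have : dd (fun y => u (y + a)) (bs i) = fun y => dd u (bs i) (y + a) := by ext y; exact dd_tr a
  rw [this, dd_tr]

lemma cd_of_dd {n : ℕ} (hΩ : IsOpen Ω) (h1 : ∀ x ∈ Ω, DifferentiableAt ℝ u x)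
    (h : ∀ e, ContDiffOn ℝ n (dd u e) Ω) : ContDiffOn ℝ (n + 1 : ℕ) u Ω := by
  push_cast
  rw [contDiffOn_succ_iff_fderiv_of_isOpen hΩ]
  refine ⟨fun x hx => (h1 x hx).differentiableWithinAt, by simp, ?_⟩
  rw [contDiffOn_clm_apply]
  exact h

lemma dd_bs_expand (e : Eu N) : dd u e x = ∑ i, inner ℝ (bs i) e * dd u (bs i) x := (sum_inner_dd e).symm

lemma norm_fderiv_le {B : ℝ} (h : ∀ i, |dd u (bs i) x| ≤ B) : ‖fderiv ℝ u x‖ ≤ N * B := by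
  rcases isEmpty_or_nonempty (Fin N) with hN | ⟨⟨i0⟩⟩
  · have hN0 : N = 0 := by
      by_contra hne
      exact hN.elim ⟨0, Nat.pos_of_ne_zero hne⟩
    subst hN0
    have : fderiv ℝ u x = 0 := by ext v; rw [Subsingleton.elim v 0]; simp
    rw [this]; simp
  have hB : 0 ≤ B := (abs_nonneg _).trans (h i0)
  apply ContinuousLinearMap.opNorm_le_bound _ (by positivity)
  intro v
  have : fderiv ℝ u x v = ∑ i, inner ℝ (bs i) v * dd u (bs i) x := (sum_inner_dd v).symm
  rw [this, Real.norm_eq_abs]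
  refine (Finset.abs_sum_le_sum_abs _ _).trans ?_
  have : ∀ i ∈ Finset.univ, |inner ℝ (bs i) v * dd u (bs i) x| ≤ B * ‖v‖ := by
    intro i _
    rw [abs_mul, mul_comm]
    have := abs_real_inner_le_norm (bs i) v
    rw [bs_norm, one_mul] at this
    exact mul_le_mul (h i) this (abs_nonneg _) hB
  refine (Finset.sum_le_sum this).trans ?_
  simp [mul_assoc]

lemma lim_c1 {F : Type*} [NormedAddCommGroup F] [NormedSpace ℝ F] [CompleteSpace F]
    {U : Set (Eu N)} (hU : IsOpen U) {fn : ℕ → Eu N → F} {g : Eu N → F}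
    (hc : ∀ n, ContDiffOn ℝ 1 (fn n) U)
    (hl : ∀ x ∈ U, Tendsto (fun n => fn n x) atTop (𝓝 (g x)))
    (hu : UniformCauchySeqOn (fun n => fderiv ℝ (fn n)) atTop U) :
    ContDiffOn ℝ 1 g U ∧ TendstoUniformlyOn (fun n => fderiv ℝ (fn n)) (fderiv ℝ g) atTop U := by
  have h1 : ∀ x ∈ U, ∃ L, Tendsto (fun n => fderiv ℝ (fn n) x) atTop (𝓝 L) := by
    intro x hx
    exact cauchySeq_tendsto_of_complete (hu.cauchySeq hx)
  choose! G hG using h1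
  have h2 : TendstoUniformlyOn (fun n => fderiv ℝ (fn n)) G atTop U :=
    hu.tendstoUniformlyOn_of_tendsto hG
  have h3 : ∀ x ∈ U, HasFDerivAt g (G x) x := by
    intro x hx
    refine hasFDerivAt_of_tendstoUniformlyOn hU h2 ?_ hl hx
    intro n y hy
    exact (((hc n).contDiffAt (hU.mem_nhds hy)).differentiableAt (by simp)).hasFDerivAt
  have h4 : ContinuousOn G U := by
    refine h2.continuousOn (Frequently.of_forall fun n => ?_)
    exact (hc n).continuousOn_fderiv_of_isOpen hU (by simp)
  have h5 : ∀ x ∈ U, fderiv ℝ g x = G x := fun x hx => (h3 x hx).fderiv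
  refine ⟨?_, h2.congr_right fun x hx => (h5 x hx).symm⟩
  have : (1 : WithTop ℕ∞) = 0 + 1 := by simp
  rw [this, contDiffOn_succ_iff_fderiv_of_isOpen hU]
  refine ⟨fun x hx => (h3 x hx).differentiableAt.differentiableWithinAt, by simp, ?_⟩
  rw [contDiffOn_zero]
  exact h4.congr h5

noncomputable def dq (u : Eu N → ℝ) (e e' : Eu N) (t : ℝ) (x : Eu N) : ℝ :=
  (t ^ 2)⁻¹ * ((u (x + (t • e + t • e')) - u (x + t • e)) - (u (x + t • e') - u x))

lemma dq_mvt {r t : ℝ} (ht : 0 < t) (htr : 2 * t < r) (he : ‖e‖ ≤ 1) (he' : ‖e'‖ ≤ 1)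
    (hu : ∀ y ∈ Metric.ball x r, ContDiffAt ℝ 2 u y) :
    ∃ y, ‖y - x‖ ≤ 2 * t ∧ dq u e e' t x = dd (dd u e) e' y := by
  have hin : ∀ s s' : ℝ, s ∈ Icc 0 t → s' ∈ Icc 0 t → ‖(x + s • e + s' • e') - x‖ ≤ 2 * t := by
    intro s s' hs hs'
    have h1 : (x + s • e + s' • e') - x = s • e + s' • e' := by abel
    rw [h1]
    refine (norm_add_le _ _).trans ?_
    rw [norm_smul, norm_smul, Real.norm_eq_abs, Real.norm_eq_abs, abs_of_nonneg hs.1, abs_of_nonneg hs'.1]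
    have := mul_le_mul hs.2 he (norm_nonneg _) ht.le
    have := mul_le_mul hs'.2 he' (norm_nonneg _) ht.le
    linarith
  have hinb : ∀ s s' : ℝ, s ∈ Icc 0 t → s' ∈ Icc 0 t → ContDiffAt ℝ 2 u (x + s • e + s' • e') := by
    intro s s' hs hs'
    exact hu _ (mem_ball_iff_norm.2 ((hin s s' hs hs').trans_lt htr))
  have t0 : t ∈ Icc 0 t := ⟨ht.le, le_rfl⟩
  have z0 : (0:ℝ) ∈ Icc 0 t := ⟨le_rfl, ht.le⟩
  have hd : ∀ s' ∈ Icc 0 t, ∀ s ∈ Icc 0 t, HasDerivAt (fun s : ℝ => u (x + s • e + s' • e'))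
      (dd u e (x + s • e + s' • e')) s := by
    intro s' hs' s hs
    have h1 : ∀ s : ℝ, x + s • e + s' • e' = (x + s' • e') + s • e := fun s => by abel
    simp only [h1]
    apply line_deriv
    rw [← h1]; exact c2d (hinb s s' hs hs')
  obtain ⟨ξ, hξ, h1⟩ := exists_hasDerivAt_eq_slope
    (fun s : ℝ => u (x + s • e + t • e') - u (x + s • e + (0:ℝ) • e')) 
    (fun s => dd u e (x + s • e + t • e') - dd u e (x + s • e + (0:ℝ) • e')) ht
    (fun s hs => ((hd t t0 s hs).sub (hd 0 z0 s hs)).continuousAt.continuousWithinAt)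
    (fun s hs => ((hd t t0 s (Ioo_subset_Icc_self hs)).sub (hd 0 z0 s (Ioo_subset_Icc_self hs))))
  have hξ' := Ioo_subset_Icc_self hξ
  have hd2 : ∀ s' ∈ Icc 0 t, HasDerivAt (fun s' : ℝ => dd u e (x + ξ • e + s' • e'))
      (dd (dd u e) e' (x + ξ • e + s' • e')) s' := by
    intro s' hs'
    apply line_deriv
    exact c2dd (hinb ξ s' hξ' hs') _
  obtain ⟨η, hη, h2⟩ := exists_hasDerivAt_eq_slope
    (fun s' : ℝ => dd u e (x + ξ • e + s' • e')) 
    (fun s' => dd (dd u e) e' (x + ξ • e + s' • e')) ht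
    (fun s hs => (hd2 s hs).continuousAt.continuousWithinAt)
    (fun s hs => (hd2 s (Ioo_subset_Icc_self hs)))
  refine ⟨x + ξ • e + η • e', hin ξ η hξ' (Ioo_subset_Icc_self hη), ?_⟩
  rw [h2, h1, dq]
  simp only [zero_smul, add_zero, sub_zero, ← add_assoc]
  field_simp

lemma dq_cd (t : ℝ) {n : WithTop ℕ∞} (h1 : ContDiffAt ℝ n u (x + (t • e + t • e')))
    (h2 : ContDiffAt ℝ n u (x + t • e)) (h3 : ContDiffAt ℝ n u (x + t • e'))
    (h4 : ContDiffAt ℝ n u x) : ContDiffAt ℝ n (dq u e e' t) x := by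
  have tr : ∀ a : Eu N, ContDiffAt ℝ n u (x + a) → ContDiffAt ℝ n (fun y => u (y + a)) x := fun a ha =>
    ContDiffAt.comp x ha (contDiffAt_id.add contDiffAt_const)
  exact contDiffAt_const.mul (((tr _ h1).sub (tr _ h2)).sub ((tr _ h3).sub h4))

lemma dq_lap (t : ℝ) (h1 : ContDiffAt ℝ 2 u (x + (t • e + t • e')))
    (h2 : ContDiffAt ℝ 2 u (x + t • e)) (h3 : ContDiffAt ℝ 2 u (x + t • e'))
    (h4 : ContDiffAt ℝ 2 u x) : lap (dq u e e' t) x = dq (lap u) e e' t x := by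
  have tr : ∀ a : Eu N, ContDiffAt ℝ 2 u (x + a) → ContDiffAt ℝ 2 (fun y => u (y + a)) x := fun a ha =>
    ContDiffAt.comp x ha (contDiffAt_id.add contDiffAt_const)
  unfold dq
  rw [lap_cmul _ (((tr _ h1).sub (tr _ h2)).sub ((tr _ h3).sub h4)),
    lap_sub ((tr _ h1).sub (tr _ h2)) ((tr _ h3).sub h4), lap_sub (tr _ h1) (tr _ h2),
    lap_sub (tr _ h3) h4, lap_tr, lap_tr, lap_tr]

/-- locally uniform convergence of the second difference quotient -/
lemma dq_unif {r : ℝ} (hr : 0 < r) (he : ‖e‖ ≤ 1) (he' : ‖e'‖ ≤ 1)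
    (hu : ∀ y ∈ Metric.closedBall p (4 * r), ContDiffAt ℝ 2 u y) {κ : ℝ} (hκ : 0 < κ) :
    ∃ τ > 0, τ ≤ r / 2 ∧ ∀ t, 0 < t → t < τ → ∀ x ∈ Metric.ball p (2 * r),
      |dq u e e' t x - dd (dd u e) e' x| ≤ κ := by
  have hc : ContinuousOn (dd (dd u e) e') (Metric.closedBall p (4 * r)) := fun y hy =>
    (((hu y hy).dd (m := 1) (by norm_num) e).dd (m := 0) (by norm_num) e').continuousAt.continuousWithinAt
  have huc := (isCompact_closedBall p (4 * r)).uniformContinuousOn_of_continuous hc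
  rw [Metric.uniformContinuousOn_iff] at huc
  obtain ⟨δ, hδ, h⟩ := huc κ hκ
  refine ⟨min (δ / 4) (r / 2), by positivity, min_le_right _ _, ?_⟩
  intro t ht htt x hx
  have ht1 := htt.trans_le (min_le_left _ _)
  have ht2 := htt.trans_le (min_le_right _ _)
  have hsub : ∀ y ∈ Metric.ball x (2 * r), y ∈ Metric.closedBall p (4 * r) := by
    intro y hy
    rw [Metric.mem_ball] at *
    rw [Metric.mem_closedBall]
    linarith [dist_triangle y x p]
  obtain ⟨y, hy, hyv⟩ := dq_mvt (r := 2 * r) ht (by linarith) he he' (fun y hy => hu y (hsub y hy))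
  rw [hyv]
  have := h y (hsub y (by rw [mem_ball_iff_norm]; linarith)) x
    (hsub x (by rw [Metric.mem_ball, dist_self]; linarith)) (by rw [dist_eq_norm]; linarith)
  rw [Real.dist_eq] at this
  exact this.le

/-- base regularity step -/
theorem reg_base (hΩ : IsOpen Ω) (hu : ContDiffOn ℝ 2 u Ω) (hf : ContDiffOn ℝ 2 (lap u) Ω) :
    ContDiffOn ℝ 3 u Ω := by
  have hua : ∀ y ∈ Ω, ContDiffAt ℝ 2 u y := fun y hy => hu.contDiffAt (hΩ.mem_nhds hy)
  have hfa : ∀ y ∈ Ω, ContDiffAt ℝ 2 (lap u) y := fun y hy => hf.contDiffAt (hΩ.mem_nhds hy)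
  have key : ∀ i j, ContDiffOn ℝ 1 (dd (dd u (bs i)) (bs j)) Ω := by
    intro i j p hp
    obtain ⟨r', hr', hball⟩ := Metric.isOpen_iff.1 hΩ p hp
    set r := r' / 5 with hr
    have hr0 : 0 < r := by positivity
    have hcb : Metric.closedBall p (4 * r) ⊆ Ω := by
      refine Subset.trans (Metric.closedBall_subset_ball ?_) hball
      rw [hr]; linarith
    have h1 : ∀ i : Fin N, ‖(bs i : Eu N)‖ ≤ 1 := fun i => (bs_norm i).le
    set t : ℕ → ℝ := fun n => 1 / ((n:ℝ) + 1) * (r / 2) with ht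
    have ht0 : ∀ n, 0 < t n := fun n => by simp only [ht]; positivity
    have htr : ∀ n, t n ≤ r / 2 := fun n => by
      have : 1 / ((n:ℝ) + 1) ≤ 1 := by
        rw [div_le_one (by positivity)]; linarith [Nat.cast_nonneg (α := ℝ) n]
      have := mul_le_mul_of_nonneg_right this (by positivity : 0 ≤ r / 2)
      simp only [ht]; linarith
    have htl : Tendsto t atTop (𝓝 0) := by
      have := (tendsto_one_div_add_atTop_nhds_zero_nat (𝕜 := ℝ)).mul_const (r / 2)
      simpa [ht] using this
    have hin : ∀ n, ∀ x ∈ Metric.ball p (2 * r), ∀ a : Eu N, ‖a‖ ≤ 2 → x + t n • a ∈ Ω := by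
      intro n x hx a ha
      apply hcb
      rw [Metric.mem_closedBall, dist_eq_norm]
      rw [mem_ball_iff_norm] at hx
      have : x + t n • a - p = (x - p) + t n • a := by abel
      rw [this]
      refine (norm_add_le _ _).trans ?_
      rw [norm_smul, Real.norm_eq_abs, abs_of_pos (ht0 n)]
      have := mul_le_mul (htr n) ha (norm_nonneg _) (by positivity)
      linarith
    have hpts : ∀ n, ∀ x ∈ Metric.ball p (2 * r), (x + (t n • bs i + t n • bs j) ∈ Ω) ∧
        x + t n • bs i ∈ Ω ∧ x + t n • bs j ∈ Ω ∧ x ∈ Ω := by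
      intro n x hx
      refine ⟨?_, hin n x hx _ ((h1 i).trans (by norm_num)), hin n x hx _ ((h1 j).trans (by norm_num)), ?_⟩
      · rw [← smul_add]
        exact hin n x hx _ ((norm_add_le _ _).trans (by linarith [h1 i, h1 j]))
      · have := hin n x hx 0 (by simp); simpa using this
    set D : ℕ → Eu N → ℝ := fun n => dq u (bs i) (bs j) (t n) with hD
    have hDc : ∀ n, ∀ x ∈ Metric.ball p (2 * r), ContDiffAt ℝ 2 (D n) x := by
      intro n x hx
      obtain ⟨a, b, c, d⟩ := hpts n x hx
      exact dq_cd _ (hua _ a) (hua _ b) (hua _ c) (hua _ d)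
    have hDl : ∀ n, ∀ x ∈ Metric.ball p (2 * r), lap (D n) x = dq (lap u) (bs i) (bs j) (t n) x := by
      intro n x hx
      obtain ⟨a, b, c, d⟩ := hpts n x hx
      exact dq_lap _ (hua _ a) (hua _ b) (hua _ c) (hua _ d)
    have hDu : ∀ κ > 0, ∃ n0, ∀ n ≥ n0, ∀ x ∈ Metric.ball p (2 * r),
        |D n x - dd (dd u (bs i)) (bs j) x| ≤ κ ∧
        |lap (D n) x - dd (dd (lap u) (bs i)) (bs j) x| ≤ κ := by
      intro κ hκ
      obtain ⟨τ, hτ, _, h2⟩ := dq_unif (p := p) hr0 (h1 i) (h1 j) (fun y hy => hua y (hcb hy)) hκ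
      obtain ⟨τ', hτ', _, h2'⟩ := dq_unif (p := p) hr0 (h1 i) (h1 j) (fun y hy => hfa y (hcb hy)) hκ
      have := htl.eventually (gt_mem_nhds (lt_min hτ hτ'))
      obtain ⟨n0, hn0⟩ := eventually_atTop.1 this
      refine ⟨n0, fun n hn x hx => ⟨h2 _ (ht0 n) ((hn0 n hn).trans_le (min_le_left _ _)) x hx, ?_⟩⟩
      rw [hDl n x hx]
      exact h2' _ (ht0 n) ((hn0 n hn).trans_le (min_le_right _ _)) x hx
    have hlim := lim_c1 (U := Metric.ball p r) Metric.isOpen_ball (fn := D)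
      (g := dd (dd u (bs i)) (bs j))
      (fun n x hx => (c21 (hDc n x (Metric.ball_subset_ball (by linarith) hx))).contDiffWithinAt)
      (by
        intro x hx
        rw [Metric.tendsto_atTop]
        intro κ hκ
        obtain ⟨n0, h⟩ := hDu (κ / 2) (by positivity)
        refine ⟨n0, fun n hn => ?_⟩
        rw [Real.dist_eq]
        linarith [(h n hn x (Metric.ball_subset_ball (by linarith) hx)).1])
      (by
        rw [Metric.uniformCauchySeqOn_iff]
        intro κ hκ
        set η := κ / (2 * (N * (N * 2 / r + r) + 1)) with hη
        have hη0 : 0 < η := by positivity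
        obtain ⟨n0, h⟩ := hDu η hη0
        refine ⟨n0, fun m hm n hn x hx => ?_⟩
        rw [dist_eq_norm]
        have hb2 : ∀ y ∈ Metric.ball x r, y ∈ Metric.ball p (2 * r) := by
          intro y hy
          rw [Metric.mem_ball] at *
          linarith [dist_triangle y x p]
        have hx2 := hb2 x (Metric.mem_ball_self hr0)
        have hfd : fderiv ℝ (D m) x - fderiv ℝ (D n) x = fderiv ℝ (fun y => D m y - D n y) x :=
          (fderiv_fun_sub (c2d (hDc m x hx2)) (c2d (hDc n x hx2))).symm
        rw [hfd]
        have hk : ∀ k, |dd (fun y => D m y - D n y) (bs k) x| ≤ N * (2 * η) / r + 2 * η * r / 2 := by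
          intro k
          refine grad_est hr0 (bs_norm k) (fun y hy => (hDc m y (hb2 y hy)).sub (hDc n y (hb2 y hy))) ?_ ?_
          · intro y hy
            have a1 := abs_le.1 (h m hm y (hb2 y hy)).1
            have a2 := abs_le.1 (h n hn y (hb2 y hy)).1
            rw [abs_le]; constructor <;> linarith [a1.1, a1.2, a2.1, a2.2]
          · intro y hy
            rw [lap_sub (hDc m y (hb2 y hy)) (hDc n y (hb2 y hy))]
            have a1 := abs_le.1 (h m hm y (hb2 y hy)).2
            have a2 := abs_le.1 (h n hn y (hb2 y hy)).2
            rw [abs_le]; constructor <;> linarith [a1.1, a1.2, a2.1, a2.2]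
        have := norm_fderiv_le hk
        refine this.trans_lt ?_
        have e1 : (N:ℝ) * (N * (2 * η) / r + 2 * η * r / 2) = η * (N * (N * 2 / r + r)) := by ring
        have e2 : η * (2 * (N * (N * 2 / r + r) + 1)) = κ := by
          rw [hη]; field_simp
        rw [e1]
        nlinarith)
    exact (hlim.1.contDiffAt (Metric.ball_mem_nhds p hr0)).contDiffWithinAt
  have key2 : ∀ e e', ContDiffOn ℝ (1:ℕ) (dd (dd u e) e') Ω := by
    intro e e'
    have : ∀ x ∈ Ω, dd (dd u e) e' x = ∑ j, ∑ i, inner ℝ (bs j) e' * (inner ℝ (bs i) e * dd (dd u (bs i)) (bs j) x) := by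
      intro x hx
      rw [dd_bs_expand e']
      refine Finset.sum_congr rfl fun j _ => ?_
      rw [← Finset.mul_sum]; congr 1
      rw [dd_comm (hua x hx), dd_bs_expand e]
      refine Finset.sum_congr rfl fun i _ => ?_
      rw [dd_comm (hua x hx)]
    refine ContDiffOn.congr ?_ this
    exact ContDiffOn.sum fun j _ => ContDiffOn.sum fun i _ =>
      contDiffOn_const.mul (contDiffOn_const.mul (key i j))
  have h2 : ∀ e, ContDiffOn ℝ (2:ℕ) (dd u e) Ω := fun e =>
    cd_of_dd hΩ (fun x hx => c2dd (hua x hx) e) (key2 e)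
  exact cd_of_dd hΩ (fun x hx => c2d (hua x hx)) h2

theorem reg_k (hΩ : IsOpen Ω) (k : ℕ) : ∀ {u : Eu N → ℝ}, ContDiffOn ℝ 2 u Ω →
    ContDiffOn ℝ (k + 1 : ℕ) (lap u) Ω → ContDiffOn ℝ (k + 2 : ℕ) u Ω := by
  induction k with
  | zero => intro u h _; exact h
  | succ k ih =>
    intro u hu hf
    have h3 : ContDiffOn ℝ 3 u Ω := reg_base hΩ hu (hf.of_le (by norm_cast; omega))
    refine cd_of_dd hΩ (fun x hx => c2d (hu.contDiffAt (hΩ.mem_nhds hx))) fun e => ?_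
    refine ih (ContDiffOn.dd hΩ h3 (by norm_num) e) ?_
    refine ContDiffOn.congr (ContDiffOn.dd hΩ hf (m := (k + 1 : ℕ)) (by norm_cast) e) fun x hx => ?_
    exact lap_dd (h3.contDiffAt (hΩ.mem_nhds hx))

theorem sys_smooth (hΩ : IsOpen Ω) {u v : Eu N → ℝ} {a b : ℝ} (hu : ContDiffOn ℝ 2 u Ω)
    (hv : ContDiffOn ℝ 2 v Ω) (h1 : ∀ x ∈ Ω, -lap u x = a * exp (v x))
    (h2 : ∀ x ∈ Ω, -lap v x = b * exp (u x)) :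
    ContDiffOn ℝ ∞ u Ω ∧ ContDiffOn ℝ ∞ v Ω := by
  have main : ∀ k : ℕ, ContDiffOn ℝ (k + 2 : ℕ) u Ω ∧ ContDiffOn ℝ (k + 2 : ℕ) v Ω := by
    intro k
    induction k with
    | zero => exact ⟨hu, hv⟩
    | succ k ih =>
      obtain ⟨i1, i2⟩ := ih
      constructor
      · refine reg_k hΩ (k + 1) hu ?_
        refine ContDiffOn.congr ((contDiffOn_const (c := -a)).mul i2.exp) fun x hx => ?_
        linarith [h1 x hx]
      · refine reg_k hΩ (k + 1) hv ?_
        refine ContDiffOn.congr ((contDiffOn_const (c := -b)).mul i1.exp) fun x hx => ?_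
        linarith [h2 x hx]
  constructor
  · rw [contDiffOn_infty]; exact fun n => (main n).1.of_le (by norm_cast; omega)
  · rw [contDiffOn_infty]; exact fun n => (main n).2.of_le (by norm_cast; omega)

end regularity

section thmD
variable {N : ℕ} {u w f g : Eu N → ℝ} {e e' x p : Eu N} {Ω : Set (Eu N)}

/-- barrier function data -/
structure US (Ω : Set (Eu N)) (u : Eu N → ℝ) (A c : ℝ) : Prop where
  op : IsOpen Ω
  bd : Bornology.IsBounded Ω
  cd : ∀ x ∈ Ω, ContDiffAt ℝ 3 u x
  pos : ∀ x ∈ Ω, 0 < u x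
  c0 : 0 < c
  lapc : ∀ x ∈ Ω, lap u x ≤ -c
  A1 : 1 ≤ A
  b0 : ∀ x ∈ Ω, u x ≤ A
  b1 : ∀ x ∈ Ω, ∀ e, |dd u e x| ≤ A * ‖e‖
  b2 : ∀ x ∈ Ω, ∀ e e', |dd (dd u e) e' x| ≤ A * ‖e‖ * ‖e'‖
  b3 : ∀ x ∈ Ω, ∀ e, |dd (lap u) e x| ≤ A * ‖e‖
  lim : ∀ p ∈ frontier Ω, Tendsto u (𝓝[Ω] p) (𝓝 0)

/-- data of the estimated function -/
structure WS (Ω : Set (Eu N)) (u w : Eu N → ℝ) (ε : ℝ) : Prop where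
  cd : ∀ x ∈ Ω, ContDiffAt ℝ 3 w x
  b0 : ∀ x ∈ Ω, |w x| ≤ ε * u x
  l0 : ∀ x ∈ Ω, |lap w x| ≤ ε
  l1 : ∀ x ∈ Ω, ∀ e, ‖e‖ ≤ 1 → |dd (lap w) e x| ≤ ε

lemma c32 (h : ContDiffAt ℝ 3 f x) : ContDiffAt ℝ 2 f x := h.of_le (by norm_num)
lemma c3dd (h : ContDiffAt ℝ 3 f x) (e : Eu N) : ContDiffAt ℝ 2 (dd f e) x := h.dd (by norm_num) e

lemma incr_le {h h' : ℝ → ℝ} {τ K : ℝ} (hτ : 0 ≤ τ) (hd : ∀ s ∈ Icc 0 τ, HasDerivAt h (h' s) s)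
    (hb : ∀ s ∈ Icc 0 τ, h' s ≤ K * s) : h τ ≤ h 0 + K * τ ^ 2 / 2 := by
  have hd2 : ∀ s ∈ Icc 0 τ, HasDerivAt (fun s => h s - K * s ^ 2 / 2) (h' s - K * s) s := by
    intro s hs
    have := (hd s hs).sub ((((hasDerivAt_id s).pow 2).const_mul K).div_const 2)
    refine this.congr_deriv ?_
    simp
    ring
  have : AntitoneOn (fun s => h s - K * s ^ 2 / 2) (Icc 0 τ) := by
    apply antitoneOn_of_deriv_nonpos (convex_Icc 0 τ)
    · exact fun s hs => (hd2 s hs).continuousAt.continuousWithinAt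
    · intro s hs
      rw [interior_Icc] at hs
      exact (hd2 s (Ioo_subset_Icc_self hs)).differentiableAt.differentiableWithinAt
    · intro s hs
      rw [interior_Icc] at hs
      have hs' := Ioo_subset_Icc_self hs
      rw [(hd2 s hs').deriv]; linarith [hb s hs']
  have := this (left_mem_Icc.2 hτ) (right_mem_Icc.2 hτ) hτ
  simp at this
  linarith

lemma incr1_le {h h' : ℝ → ℝ} {τ K : ℝ} (hτ : 0 ≤ τ) (hd : ∀ s ∈ Icc 0 τ, HasDerivAt h (h' s) s)
    (hb : ∀ s ∈ Icc 0 τ, h' s ≤ K) : h τ ≤ h 0 + K * τ := by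
  have hd2 : ∀ s ∈ Icc 0 τ, HasDerivAt (fun s => h s - K * s) (h' s - K) s := by
    intro s hs
    have := (hd s hs).sub ((hasDerivAt_id s).const_mul K)
    refine this.congr_deriv ?_
    simp
  have : AntitoneOn (fun s => h s - K * s) (Icc 0 τ) := by
    apply antitoneOn_of_deriv_nonpos (convex_Icc 0 τ)
    · exact fun s hs => (hd2 s hs).continuousAt.continuousWithinAt
    · intro s hs
      rw [interior_Icc] at hs
      exact (hd2 s (Ioo_subset_Icc_self hs)).differentiableAt.differentiableWithinAt
    · intro s hs
      rw [interior_Icc] at hs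
      have hs' := Ioo_subset_Icc_self hs
      rw [(hd2 s hs').deriv]; linarith [hb s hs']
  have := this (left_mem_Icc.2 hτ) (right_mem_Icc.2 hτ) hτ
  simp at this
  linarith

lemma taylor_up {v : Eu N} {τ K : ℝ} (hτ : 0 ≤ τ) (hf : ∀ s ∈ Icc 0 τ, ContDiffAt ℝ 2 f (x + s • v))
    (hK : ∀ s ∈ Icc 0 τ, dd (dd f v) v (x + s • v) ≤ K) :
    f (x + τ • v) ≤ f x + τ * dd f v x + K * τ ^ 2 / 2 := by
  have h1 : ∀ s ∈ Icc 0 τ, dd f v (x + s • v) ≤ dd f v x + K * s := by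
    intro s hs
    have := incr1_le (h := fun s => dd f v (x + s • v)) hs.1
      (fun r hr => line_deriv r (c2dd (hf r ⟨hr.1, hr.2.trans hs.2⟩) v))
      (fun r hr => hK r ⟨hr.1, hr.2.trans hs.2⟩)
    simpa using this
  have := incr_le (h := fun s => f (x + s • v) - s * dd f v x) (K := K) hτ
    (fun r hr => (line_deriv r (c2d (hf r hr))).sub ((hasDerivAt_id r).mul_const _))
    (fun r hr => by have := h1 r hr; simp only [one_mul]; linarith)
  simp at this
  linarith

lemma taylor_abs {v : Eu N} {τ K : ℝ} (hτ : 0 ≤ τ) (hf : ∀ s ∈ Icc 0 τ, ContDiffAt ℝ 2 f (x + s • v))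
    (hK : ∀ s ∈ Icc 0 τ, |dd (dd f v) v (x + s • v)| ≤ K) :
    |f (x + τ • v) - f x - τ * dd f v x| ≤ K * τ ^ 2 / 2 := by
  have h1 := taylor_up hτ hf (fun s hs => (abs_le.1 (hK s hs)).2)
  have hn : ∀ y, ContDiffAt ℝ 2 f y → dd (fun y => -1 * f y) v y = -1 * dd f v y := fun y hy =>
    dd_cmul _ (c2d hy)
  have h2 := taylor_up (f := fun y => -1 * f y) (x := x) (v := v) (K := K) hτ
    (fun s hs => contDiffAt_const.mul (hf s hs)) (fun s hs => by
      rw [dd_congr (dd_cmul_ev _ (c21 (hf s hs))), dd_cmul _ (c2dd (hf s hs) v)]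
      linarith [(abs_le.1 (hK s hs)).1])
  rw [hn x (by simpa using hf 0 ⟨le_rfl, hτ⟩)] at h2
  rw [abs_le]; constructor <;> linarith

/-- segments along which the quadratic minorant stays positive remain in Ω -/
lemma seg_in {A c : ℝ} (h : US Ω u A c) (hx : x ∈ Ω) {v : Eu N}
    (hv : ∀ τ ∈ Icc (0:ℝ) 1, 0 < u x + τ * dd u v x - A * ‖v‖ ^ 2 * τ ^ 2 / 2) :
    ∀ τ ∈ Icc (0:ℝ) 1, x + τ • v ∈ Ω := by
  by_contra hcon
  push Not at hcon
  obtain ⟨τ1, hτ1, hout⟩ := hcon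
  set S := {τ : ℝ | τ ∈ Icc (0:ℝ) 1 ∧ x + τ • v ∉ Ω} with hS
  have hcont : Continuous fun τ : ℝ => x + τ • v := by fun_prop
  have hSc : IsClosed S := isClosed_Icc.inter (h.op.isClosed_compl.preimage hcont)
  have hSne : S.Nonempty := ⟨τ1, hτ1, hout⟩
  have hSb : BddBelow S := ⟨0, fun t ht => ht.1.1⟩
  have h0S := hSc.csInf_mem hSne hSb
  set τ0 := sInf S with hτ0
  have hlow : ∀ τ, 0 ≤ τ → τ < τ0 → x + τ • v ∈ Ω := by
    intro τ h0 hlt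
    by_contra hn
    have : τ ∈ S := ⟨⟨h0, hlt.le.trans h0S.1.2⟩, hn⟩
    exact absurd (csInf_le hSb this) (not_le.2 hlt)
  have hpos : 0 < τ0 := by
    rcases h0S.1.1.lt_or_eq with h1 | h1
    · exact h1
    · exfalso; apply h0S.2; rw [← h1]; simpa using hx
  set ℓ : ℝ → ℝ := fun τ => u x + τ * dd u v x - A * ‖v‖ ^ 2 * τ ^ 2 / 2 with hℓ
  have hT : ∀ τ, 0 ≤ τ → τ < τ0 → ℓ τ ≤ u (x + τ • v) := by
    intro τ h0 hlt
    have := taylor_abs (f := u) (x := x) (v := v) (K := A * ‖v‖ ^ 2) h0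
      (fun s hs => c32 (h.cd _ (hlow s hs.1 (hs.2.trans_lt hlt))))
      (fun s hs => by
        have := h.b2 _ (hlow s hs.1 (hs.2.trans_lt hlt)) v v
        linarith)
    have := (abs_le.1 this).1
    simp only [hℓ]; linarith
  set q := x + τ0 • v with hq
  have htl : Tendsto (fun τ : ℝ => x + τ • v) (𝓝[<] τ0) (𝓝[Ω] q) := by
    apply tendsto_nhdsWithin_of_tendsto_nhds_of_eventually_within
    · exact (hcont.tendsto τ0).mono_left nhdsWithin_le_nhds
    · filter_upwards [Ioo_mem_nhdsLT hpos] with τ hτ using hlow τ hτ.1.le hτ.2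
  have hqf : q ∈ frontier Ω := by
    rw [h.op.frontier_eq]
    refine ⟨mem_closure_of_tendsto (htl.mono_right nhdsWithin_le_nhds) ?_, h0S.2⟩
    filter_upwards [Ioo_mem_nhdsLT hpos] with τ hτ using hlow τ hτ.1.le hτ.2
  have l1 := (h.lim q hqf).comp htl
  have hlc : Continuous ℓ := by simp only [hℓ]; fun_prop
  have l2 : Tendsto ℓ (𝓝[<] τ0) (𝓝 (ℓ τ0)) := (hlc.tendsto τ0).mono_left nhdsWithin_le_nhds
  have := le_of_tendsto_of_tendsto l2 l1 (by
    filter_upwards [Ioo_mem_nhdsLT hpos] with τ hτ using hT τ hτ.1.le hτ.2)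
  exact absurd this (not_le.2 (hv τ0 h0S.1))

lemma ball_in {A c ρ d : ℝ} (h : US Ω u A c) (hx : x ∈ Ω) (hρ : ∀ e, |dd u e x| ≤ ρ * ‖e‖)
    (hρ0 : 0 ≤ ρ)
    (hd : ρ * d + A * d ^ 2 / 2 ≤ u x / 2) (y : Eu N) (hy : y ∈ Metric.ball x d) :
    y ∈ Ω ∧ u y ≤ 2 * u x := by
  have hu := h.pos x hx
  have hA := h.A1
  set v := y - x with hv
  have hvd : ‖v‖ < d := by rw [hv]; exact mem_ball_iff_norm.1 hy
  have hb : ∀ τ ∈ Icc (0:ℝ) 1, |τ * dd u v x| + A * ‖v‖ ^ 2 * τ ^ 2 / 2 ≤ u x / 2 := by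
    intro τ hτ
    have h1 : |τ * dd u v x| ≤ ρ * d := by
      rw [abs_mul, abs_of_nonneg hτ.1]
      calc τ * |dd u v x| ≤ 1 * (ρ * ‖v‖) := mul_le_mul hτ.2 (hρ v) (abs_nonneg _) zero_le_one
        _ ≤ ρ * d := by rw [one_mul]; exact mul_le_mul_of_nonneg_left hvd.le hρ0
    have h2 : A * ‖v‖ ^ 2 * τ ^ 2 ≤ A * d ^ 2 * 1 := by
      have : τ ^ 2 ≤ 1 := pow_le_one₀ hτ.1 hτ.2
      have : ‖v‖ ^ 2 ≤ d ^ 2 := pow_le_pow_left₀ (norm_nonneg _) hvd.le 2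
      gcongr
    linarith
  have hseg := seg_in h hx (v := v) (fun τ hτ => by
    have := hb τ hτ; have := (abs_le.1 (le_refl |τ * dd u v x|)).1
    linarith)
  have h1 := hseg 1 ⟨zero_le_one, le_rfl⟩
  have hxy : x + (1:ℝ) • v = y := by simp [hv]
  rw [hxy] at h1
  refine ⟨h1, ?_⟩
  have := taylor_abs (f := u) (x := x) (v := v) (K := A * ‖v‖ ^ 2) zero_le_one
      (fun s hs => c32 (h.cd _ (hseg s hs)))
      (fun s hs => by
        have := h.b2 _ (hseg s hs) v v
        linarith)
  rw [hxy] at this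
  have h3 := (abs_le.1 this).2
  have h4 := hb 1 ⟨zero_le_one, le_rfl⟩
  have := (abs_le.1 (le_refl |1 * dd u v x|)).2
  linarith

lemma gg_nonneg : 0 ≤ gg u u x := by
  unfold gg; exact Finset.sum_nonneg fun i _ => mul_self_nonneg _

lemma dd_le_gg (e : Eu N) : |dd u e x| ≤ √(gg u u x) * ‖e‖ := by
  rw [dd_bs_expand e]
  apply abs_le_of_sq_le_sq _ (by positivity)
  rw [mul_pow, Real.sq_sqrt gg_nonneg, ← sum_inner_sq (e := e), mul_comm]
  have := Finset.sum_mul_sq_le_sq_mul_sq Finset.univ (fun i => inner ℝ (bs i : Eu N) e) (fun i => dd u (bs i) x)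
  simp only [gg, ← pow_two]
  exact this

lemma dbs_le_gg (i : Fin N) : |dd u (bs i) x| ≤ √(gg u u x) := by
  have := dd_le_gg (u := u) (x := x) (bs i)
  rwa [bs_norm, mul_one] at this

/-- gradient bound of w at scale d -/
lemma gradw {A c ε ρ d : ℝ} (h : US Ω u A c) (hw : WS Ω u w ε) (hε : 0 < ε) (hx : x ∈ Ω)
    (hρ : ∀ e, |dd u e x| ≤ ρ * ‖e‖) (hρ0 : 0 ≤ ρ) (hd0 : 0 < d)
    (hd : ρ * d + A * d ^ 2 / 2 ≤ u x / 2) (i : Fin N) :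
    |dd w (bs i) x| ≤ N * (ε * (2 * u x)) / d + ε * d / 2 := by
  have hb := ball_in h hx hρ hρ0 hd
  refine grad_est hd0 (bs_norm i) (fun y hy => c32 (hw.cd y (hb y hy).1)) ?_ (fun y hy => hw.l0 y (hb y hy).1)
  intro y hy
  exact (hw.b0 y (hb y hy).1).trans (mul_le_mul_of_nonneg_left (hb y hy).2 hε.le)

lemma gradw_glob {A c ε : ℝ} (h : US Ω u A c) (hw : WS Ω u w ε) (hε : 0 < ε) (hx : x ∈ Ω) (i : Fin N) :
    |dd w (bs i) x| ≤ (8 * N * A ^ 2 + 1) * ε := by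
  have hu := h.pos x hx
  have hA := h.A1
  have huA := h.b0 x hx
  have hA2 : 1 ≤ A ^ 2 := one_le_pow₀ hA
  set d := u x / (4 * A ^ 2) with hd
  have hd0 : 0 < d := by positivity
  have hd4 : d * (4 * A ^ 2) = u x := by rw [hd]; field_simp
  have hdA : A * d ≤ u x / 4 := by nlinarith [mul_pos (by linarith : 0 < A) hd0]
  have hd1 : d ≤ 1 := by nlinarith [mul_pos (by linarith : 0 < A) hd0]
  have := gradw (d := d) h hw hε hx (h.b1 x hx) (by linarith) hd0 (by nlinarith) i
  refine this.trans ?_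
  have e1 : (N:ℝ) * (ε * (2 * u x)) / d = 8 * N * A ^ 2 * ε := by
    rw [← hd4]; field_simp; ring
  rw [e1]
  nlinarith

end thmD

section thmD2
variable {N : ℕ} {u w f g : Eu N → ℝ} {e e' x p : Eu N} {Ω : Set (Eu N)}

/-- region where `θ |∇u|² ≤ u` : interior Hessian bound -/
lemma hess_R {A c ε θ : ℝ} (hN : (1:ℝ) ≤ N) (h : US Ω u A c) (hw : WS Ω u w ε) (hε : 0 < ε) (hx : x ∈ Ω)
    (hθ : 0 < θ) (hθ1 : θ ≤ 1) (hR : θ * gg u u x ≤ u x) (i j : Fin N) :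
    |dd (dd w (bs i)) (bs j) x| ≤ (128 * N ^ 2 * A ^ 2 + N + 1) * ε / θ := by
  have hu := h.pos x hx
  have hA := h.A1
  have huA := h.b0 x hx
  have hA2 : 1 ≤ A ^ 2 := one_le_pow₀ hA
  set ρ := √(gg u u x) with hρ
  have hρ0 : 0 ≤ ρ := Real.sqrt_nonneg _
  have hρ2 : ρ ^ 2 = gg u u x := Real.sq_sqrt gg_nonneg
  set d := √(θ * u x) / (4 * A) with hd
  have hd0 : 0 < d := by positivity
  have hd2 : d ^ 2 * (16 * A ^ 2) = θ * u x := by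
    rw [hd, div_pow, Real.sq_sqrt (by positivity)]; field_simp; ring
  have hρd : ρ * d ≤ u x / 4 := by
    apply abs_le_of_sq_le_sq' _ (by positivity) |>.2
    have : (ρ * d) ^ 2 * (16 * A ^ 2) ≤ (u x) ^ 2 := by
      rw [mul_pow, mul_assoc, hd2, hρ2]; nlinarith
    nlinarith [sq_nonneg (ρ * d)]
  have hAd : A * d ^ 2 / 2 ≤ u x / 4 := by
    have h1 : A ≤ A ^ 2 := by nlinarith
    have : A * d ^ 2 ≤ A ^ 2 * d ^ 2 := mul_le_mul_of_nonneg_right h1 (sq_nonneg d)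
    nlinarith
  have hd1 : d ≤ 1 := by
    apply abs_le_of_sq_le_sq' _ (by positivity) |>.2
    nlinarith [sq_nonneg d]
  have hb := ball_in h hx (dd_le_gg (u := u) (x := x)) hρ0 (d := d) (by linarith)
  set g1 := N * (ε * (2 * u x)) / (d / 2) + ε * (d / 2) / 2 with hg1
  have hsub : ∀ y ∈ Metric.ball x (d / 2), ∀ z ∈ Metric.ball y (d / 2), z ∈ Metric.ball x d := by
    intro y hy z hz
    rw [Metric.mem_ball] at *
    linarith [dist_triangle z y x]
  have hgr : ∀ y ∈ Metric.ball x (d / 2), |dd w (bs i) y| ≤ g1 := by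
    intro y hy
    refine grad_est (by positivity) (bs_norm i) (fun z hz => c32 (hw.cd z (hb z (hsub y hy z hz)).1)) ?_
      (fun z hz => hw.l0 z (hb z (hsub y hy z hz)).1)
    intro z hz
    have := hb z (hsub y hy z hz)
    exact (hw.b0 z this.1).trans (mul_le_mul_of_nonneg_left this.2 hε.le)
  have hxd : ∀ y ∈ Metric.ball x (d / 2), y ∈ Ω := fun y hy =>
    (hb y (Metric.ball_subset_ball (by linarith) hy)).1
  have := grad_est (w := dd w (bs i)) (x := x) (by positivity : 0 < d / 2) (bs_norm j)
    (fun y hy => c3dd (hw.cd y (hxd y hy)) _) hgr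
    (fun y hy => by rw [lap_dd (hw.cd y (hxd y hy))]; exact hw.l1 y (hxd y hy) _ (bs_norm i).le)
  refine this.trans ?_
  have e0 : u x = d ^ 2 * (16 * A ^ 2) / θ := by rw [hd2]; field_simp
  have e1 : N * g1 / (d / 2) = (128 * N ^ 2 * A ^ 2) * ε / θ + N * ε / 2 := by
    rw [hg1, e0]; field_simp; ring
  have e3 : (128 * N ^ 2 * A ^ 2 + N + 1) * ε / θ = 128 * N ^ 2 * A ^ 2 * ε / θ + N * (ε / θ) + ε / θ := by
    ring
  rw [e1, e3]
  have e4 : 0 ≤ N * ε := by positivity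
  have e2 : ε ≤ ε / θ := by rw [le_div_iff₀ hθ]; nlinarith
  have : (N:ℝ) * ε ≤ N * (ε / θ) := by gcongr
  have : ε * (d / 2) ≤ ε := by nlinarith
  linarith

/-- scale in the good region `u ≤ 2θ|∇u|²` -/
lemma good_scale {A c θ : ℝ} (h : US Ω u A c) (hx : x ∈ Ω) (hθ : 0 < θ) (hθ1 : θ ≤ 1/2)
    (hG : u x ≤ 2 * θ * gg u u x) :
    0 < √(gg u u x) ∧ ∃ d > 0, d ≤ θ * √(gg u u x) ∧ u x = 4 * A * √(gg u u x) * d ∧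
      √(gg u u x) * d + A * d ^ 2 / 2 ≤ u x / 2 := by
  have hu := h.pos x hx
  have hA := h.A1
  set ρ := √(gg u u x) with hρ
  have hρ2 : ρ ^ 2 = gg u u x := Real.sq_sqrt gg_nonneg
  have hQ : 0 < gg u u x := by
    by_contra hn
    have : 2 * θ * gg u u x ≤ 0 := mul_nonpos_of_nonneg_of_nonpos (by positivity) (not_lt.1 hn)
    linarith
  have hρ0 : 0 < ρ := Real.sqrt_pos.2 hQ
  refine ⟨hρ0, u x / (4 * A * ρ), by positivity, ?_, by field_simp, ?_⟩
  · rw [div_le_iff₀ (by positivity)]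
    rw [← hρ2] at hG
    have : 0 ≤ θ * ρ ^ 2 := by positivity
    nlinarith
  · have e1 : ρ * (u x / (4 * A * ρ)) = u x / (4 * A) := by field_simp
    have e2 : A * (u x / (4 * A * ρ)) ^ 2 / 2 = u x * (u x / (32 * A * ρ ^ 2)) := by field_simp; ring
    rw [e1, e2]
    have h1 : u x / (4 * A) ≤ u x / 4 := by
      apply div_le_div_of_nonneg_left hu.le (by norm_num); linarith
    have h2 : u x / (32 * A * ρ ^ 2) ≤ 1 / 4 := by
      rw [div_le_iff₀ (by positivity), hρ2]; nlinarith
    nlinarith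

/-- gradient in the good region -/
lemma gradw_good {A c ε θ : ℝ} (h : US Ω u A c) (hw : WS Ω u w ε) (hε : 0 < ε) (hx : x ∈ Ω)
    (hθ : 0 < θ) (hθ1 : θ ≤ 1/2) (hG : u x ≤ 2 * θ * gg u u x) (i : Fin N) :
    |dd w (bs i) x| ≤ (8 * N * A ^ 2 + 1) * ε * √(gg u u x) := by
  obtain ⟨hρ0, d, hd0, hdθ, hud, hd⟩ := good_scale h hx hθ hθ1 hG
  have hA := h.A1
  set ρ := √(gg u u x) with hρ
  have := gradw h hw hε hx dd_le_gg hρ0.le hd0 hd i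
  refine this.trans ?_
  have e1 : N * (ε * (2 * u x)) / d = 8 * N * A * ε * ρ := by rw [hud]; field_simp; ring
  rw [e1]
  have : (8:ℝ) * N * A * ε * ρ ≤ 8 * N * A ^ 2 * ε * ρ := by
    have : A ≤ A ^ 2 := by nlinarith
    gcongr
  have : ε * d ≤ ε * ρ := by
    apply mul_le_mul_of_nonneg_left _ hε.le
    nlinarith
  nlinarith [mul_pos hε hρ0]

noncomputable def zf (u w : Eu N → ℝ) (i j : Fin N) (y : Eu N) : ℝ :=
  dd u (bs i) y * dd w (bs j) y - dd u (bs j) y * dd w (bs i) y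

lemma zf_cd (hu : ContDiffAt ℝ 3 u x) (hw : ContDiffAt ℝ 3 w x) (i j : Fin N) :
    ContDiffAt ℝ 2 (zf u w i j) x :=
  ((c3dd hu _).mul (c3dd hw _)).sub ((c3dd hu _).mul (c3dd hw _))

lemma gg_le {a b : ℝ} (ha : ∀ k, |dd f (bs k) x| ≤ a) (hb : ∀ k, |dd g (bs k) x| ≤ b) (ha0 : 0 ≤ a) :
    |gg f g x| ≤ N * (a * b) := by
  unfold gg
  refine (Finset.abs_sum_le_sum_abs _ _).trans ?_
  refine (Finset.sum_le_sum (g := fun _ => a * b) fun i _ => ?_).trans (by simp)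
  rw [abs_mul]
  exact mul_le_mul (ha i) (hb i) (abs_nonneg _) ha0

lemma zf_lap {A c ε M' : ℝ} (h : US Ω u A c) (hw : WS Ω u w ε) (hε : 0 < ε) (hx : x ∈ Ω)
    (hM : ∀ i j, |dd (dd w (bs i)) (bs j) x| ≤ M') (i j : Fin N) :
    |lap (zf u w i j) x| ≤ 2 * (A + A * (8 * N * A ^ 2 + 1)) * ε + 4 * N * A * M' := by
  have hu3 := h.cd x hx
  have hw3 := hw.cd x hx
  have hA := h.A1
  have one : ∀ i j : Fin N, |lap (fun y => dd u (bs i) y * dd w (bs j) y) x| ≤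
      (A + A * (8 * N * A ^ 2 + 1)) * ε + 2 * N * A * M' := by
    intro i j
    rw [lap_mul (c3dd hu3 _) (c3dd hw3 _), lap_dd hu3, lap_dd hw3]
    have b1 : |dd u (bs i) x| ≤ A := by simpa [bs_norm] using h.b1 x hx (bs i)
    have b2 : |dd (lap w) (bs j) x| ≤ ε := hw.l1 x hx _ (bs_norm j).le
    have b3 := gradw_glob h hw hε hx j
    have b4 : |dd (lap u) (bs i) x| ≤ A := by simpa [bs_norm] using h.b3 x hx (bs i)
    have b5 : |gg (dd u (bs i)) (dd w (bs j)) x| ≤ N * (A * M') := by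
      apply gg_le _ (fun k => hM j k) (by linarith)
      intro k; simpa [bs_norm] using h.b2 x hx (bs i) (bs k)
    have c1 : |dd u (bs i) x * dd (lap w) (bs j) x| ≤ A * ε := by
      rw [abs_mul]; exact mul_le_mul b1 b2 (abs_nonneg _) (by linarith)
    have c2 : |dd w (bs j) x * dd (lap u) (bs i) x| ≤ (8 * N * A ^ 2 + 1) * ε * A := by
      rw [abs_mul]; exact mul_le_mul b3 b4 (abs_nonneg _) (by positivity)
    rw [abs_le] at *
    constructor <;> linarith [c1.1, c1.2, c2.1, c2.2, b5.1, b5.2]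
  have : lap (zf u w i j) x = lap (fun y => dd u (bs i) y * dd w (bs j) y) x -
      lap (fun y => dd u (bs j) y * dd w (bs i) y) x :=
    lap_sub ((c3dd hu3 _).mul (c3dd hw3 _)) ((c3dd hu3 _).mul (c3dd hw3 _))
  rw [this]
  have h1 := abs_le.1 (one i j)
  have h2 := abs_le.1 (one j i)
  rw [abs_le]
  constructor <;> linarith [h1.1, h1.2, h2.1, h2.2]

set_option maxHeartbeats 1000000 in
/-- decay of `z` at the boundary -/
lemma zf_lim {A c ε M : ℝ} (hN : (1:ℝ) ≤ N) (h : US Ω u A c) (hw : WS Ω u w ε) (hε : 0 < ε) (hM0 : 0 ≤ M)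
    (hM : ∀ x ∈ Ω, ∀ i j, |dd (dd w (bs i)) (bs j) x| ≤ M) (i j : Fin N) :
    ∃ C, ∀ x ∈ Ω, √(u x) ≤ 1 / (5 * A) → |zf u w i j x| ≤ C * √(u x) := by
  have hA := h.A1
  have hM2 : ∀ x ∈ Ω, ∀ v : Eu N, |dd (dd w v) v x| ≤ N * (‖v‖ * (N * (‖v‖ * M))) := by
    intro x hx v
    have hw2 := c32 (hw.cd x hx)
    have key : ∀ (f : Eu N → ℝ) (B : ℝ), (∀ k, |dd f (bs k) x| ≤ B) → |dd f v x| ≤ N * (‖v‖ * B) := by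
      intro f B hB
      rw [dd_bs_expand v]
      refine (Finset.abs_sum_le_sum_abs _ _).trans ?_
      refine (Finset.sum_le_sum (g := fun _ => ‖v‖ * B) fun i _ => ?_).trans (by simp)
      rw [abs_mul]
      have := abs_real_inner_le_norm (bs i) v
      rw [bs_norm, one_mul] at this
      exact mul_le_mul this (hB i) (abs_nonneg _) (norm_nonneg _)
    apply key
    intro k
    rw [dd_comm hw2]
    apply key
    intro l
    exact hM x hx k l
  set Cg := N * (A * ((8 * N * A ^ 2 + 1) * ε)) with hCg
  refine ⟨ε * (1 + 10 * A * A ^ 2 * N) + ε + 5 * A * Cg + N * (N * M) * (9 * (N * A ^ 2)), ?_⟩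
  intro x hx htx
  have hu := h.pos x hx
  set t := √(u x) with ht
  have ht0 : 0 < t := Real.sqrt_pos.2 hu
  have ht2 : t ^ 2 = u x := Real.sq_sqrt hu.le
  set Q := gg u u x with hQ
  have hQ0 : 0 ≤ Q := gg_nonneg
  set ρ := √Q with hρ
  have hρ0 : 0 ≤ ρ := Real.sqrt_nonneg _
  have hρ2 : ρ ^ 2 = Q := Real.sq_sqrt hQ0
  have bA : ∀ k, |dd u (bs k) x| ≤ A := fun k => by simpa [bs_norm] using h.b1 x hx (bs k)
  have hQA : Q ≤ N * A ^ 2 := by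
    have := (abs_le.1 (gg_le bA bA (by linarith))).2
    rw [pow_two]; exact this
  set e1 : Eu N := dd u (bs i) x • bs j - dd u (bs j) x • bs i with he1
  set e2 : Eu N := ∑ k, dd u (bs k) x • bs k with he2
  have d1 : dd u e1 x = 0 := by
    rw [he1, dd_sub_arg, dd_smul_arg, dd_smul_arg]; ring
  have de2 : ∀ f : Eu N → ℝ, dd f e2 x = gg u f x := by
    intro f
    simp only [he2, dd, map_sum, map_smul, smul_eq_mul, gg]
  have d2 : dd u e2 x = Q := de2 u
  have z1 : dd w e1 x = zf u w i j x := by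
    rw [he1, dd_sub_arg, dd_smul_arg, dd_smul_arg, zf]
  have n1 : ‖e1‖ ≤ 2 * ρ := by
    refine (norm_sub_le _ _).trans ?_
    rw [norm_smul, norm_smul, bs_norm, bs_norm, Real.norm_eq_abs, Real.norm_eq_abs]
    linarith [dbs_le_gg (u := u) (x := x) i, dbs_le_gg (u := u) (x := x) j]
  have n2 : ‖e2‖ = ρ := by
    have hk : ∀ k, inner ℝ (bs k : Eu N) e2 = dd u (bs k) x := by
      intro k
      rw [he2, inner_sum]
      simp only [inner_smul_right]
      rw [Finset.sum_eq_single k]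
      · rw [real_inner_self_eq_norm_sq, bs_norm]; simp
      · intro b _ hb
        simp [bs, EuclideanSpace.inner_single_left, hb.symm]
      · simp
    have : ‖e2‖ ^ 2 = ρ ^ 2 := by
      rw [← sum_inner_sq, hρ2, hQ, gg]
      exact Finset.sum_congr rfl fun k _ => by rw [hk k]; ring
    exact (pow_left_inj₀ (norm_nonneg _) hρ0 two_ne_zero).1 this
  have dwe2 : |dd w e2 x| ≤ Cg := by
    rw [de2]; exact gg_le bA (fun k => gradw_glob h hw hε hx k) (by linarith)
  set v : Eu N := t • e1 + (5 * A * t ^ 2) • e2 with hv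
  have htA : 5 * A * t ≤ 1 := by
    rw [le_div_iff₀ (by positivity)] at htx; linarith
  have nv : ‖v‖ ≤ 3 * t * ρ := by
    refine (norm_add_le _ _).trans ?_
    rw [norm_smul, norm_smul, n2, Real.norm_eq_abs, Real.norm_eq_abs, abs_of_pos ht0,
      abs_of_pos (by positivity)]
    have : t * ‖e1‖ ≤ t * (2 * ρ) := by gcongr
    have : 5 * A * t ^ 2 * ρ ≤ 1 * (t * ρ) := by
      have : 5 * A * t ^ 2 * ρ = (5 * A * t) * (t * ρ) := by ring
      rw [this]; gcongr
    linarith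
  have nv2 : ‖v‖ ^ 2 ≤ 9 * t ^ 2 * Q := by
    have := pow_le_pow_left₀ (norm_nonneg _) nv 2
    rw [← hρ2]; nlinarith
  have duv : dd u v x = 5 * A * t ^ 2 * Q := by
    rw [hv, dd_add_arg, dd_smul_arg, dd_smul_arg, d1, d2]; ring
  have dwv : dd w v x = t * zf u w i j x + 5 * A * t ^ 2 * dd w e2 x := by
    rw [hv, dd_add_arg, dd_smul_arg, dd_smul_arg, z1]
  have hAt : 0 ≤ A * t ^ 2 * Q := by positivity
  have hAv : A * ‖v‖ ^ 2 ≤ 9 * (A * t ^ 2 * Q) := by nlinarith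
  have hseg := seg_in h hx (v := v) (fun τ hτ => by
    rw [duv]
    have h1 : τ ^ 2 ≤ τ := by nlinarith [hτ.1, hτ.2]
    have h2 : A * ‖v‖ ^ 2 * τ ^ 2 ≤ 9 * (A * t ^ 2 * Q) * τ := by
      apply mul_le_mul hAv h1 (sq_nonneg _) (by positivity)
    nlinarith [mul_nonneg hτ.1 hAt])
  have hy := hseg 1 ⟨zero_le_one, le_rfl⟩
  have T1 := taylor_abs (f := u) (x := x) (v := v) (K := 9 * (A * t ^ 2 * Q)) zero_le_one
      (fun s hs => c32 (h.cd _ (hseg s hs)))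
      (fun s hs => by
        have := h.b2 _ (hseg s hs) v v
        nlinarith)
  have T2 := taylor_abs (f := w) (x := x) (v := v) (K := N * (N * M) * (9 * t ^ 2 * Q)) zero_le_one
      (fun s hs => c32 (hw.cd _ (hseg s hs)))
      (fun s hs => by
        refine (hM2 _ (hseg s hs) v).trans ?_
        have : N * (‖v‖ * (N * (‖v‖ * M))) = N * (N * M) * ‖v‖ ^ 2 := by ring
        rw [this]; gcongr)
  rw [duv] at T1
  rw [dwv] at T2
  have huy : u (x + (1:ℝ) • v) ≤ (1 + 10 * A * A ^ 2 * N) * t ^ 2 := by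
    have := (abs_le.1 T1).2
    have h3 : A * t ^ 2 * Q ≤ A * t ^ 2 * (N * A ^ 2) := by gcongr
    rw [← ht2] at this
    nlinarith
  have hwy := hw.b0 _ hy
  have hwy2 : |w (x + (1:ℝ) • v)| ≤ ε * ((1 + 10 * A * A ^ 2 * N) * t ^ 2) :=
    hwy.trans (by gcongr)
  have hwx := hw.b0 x hx
  rw [← ht2] at hwx
  have h4 : |5 * A * t ^ 2 * dd w e2 x| ≤ 5 * A * t ^ 2 * Cg := by
    rw [abs_mul, abs_of_pos (by positivity : 0 < 5 * A * t ^ 2)]; gcongr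
  have h5 : N * (N * M) * (9 * t ^ 2 * Q) ≤ N * (N * M) * (9 * t ^ 2 * (N * A ^ 2)) := by gcongr
  have h6 : 0 ≤ N * (N * M) * (9 * t ^ 2 * Q) := by positivity
  have fin : |t * zf u w i j x| ≤ (ε * (1 + 10 * A * A ^ 2 * N) + ε + 5 * A * Cg
      + N * (N * M) * (9 * (N * A ^ 2))) * t ^ 2 := by
    have a1 := abs_le.1 hwy2
    have a2 := abs_le.1 hwx
    have a3 := abs_le.1 h4
    have a4 := abs_le.1 T2
    obtain ⟨a11, a12⟩ := a1
    obtain ⟨a21, a22⟩ := a2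
    obtain ⟨a31, a32⟩ := a3
    obtain ⟨a41, a42⟩ := a4
    clear T1 T2 hwy2 hwx h4 hwy
    refine abs_le.2 ⟨?_, ?_⟩
    · ring_nf at *
      linarith
    · ring_nf at *
      linarith
  rw [abs_mul, abs_of_pos ht0] at fin
  have : t * |zf u w i j x| ≤ t * ((ε * (1 + 10 * A * A ^ 2 * N) + ε + 5 * A * Cg
      + N * (N * M) * (9 * (N * A ^ 2))) * t) := by linarith
  exact le_of_mul_le_mul_left this ht0

end thmD2

section thmD3
variable {N : ℕ} {u w f g : Eu N → ℝ} {e e' x p : Eu N} {Ω : Set (Eu N)}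

lemma lap_sum {ι : Type*} (s : Finset ι) (F : ι → Eu N → ℝ) (h : ∀ i ∈ s, ContDiffAt ℝ 2 (F i) x) :
    lap (fun y => ∑ i ∈ s, F i y) x = ∑ i ∈ s, lap (F i) x := by
  classical
  induction s using Finset.induction_on with
  | empty => simp [lap_const]
  | insert a s ha ih =>
    simp only [Finset.sum_insert ha]
    rw [lap_add (f := F a) (g := fun y => ∑ i ∈ s, F i y) (h a (by simp))
      (ContDiffAt.sum fun i hi => h i (by simp [hi])), ih fun i hi => h i (by simp [hi])]

lemma gg_cd (h : ContDiffAt ℝ 3 u x) : ContDiffAt ℝ 2 (gg u u) x := by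
  have : gg u u = fun y => ∑ i, dd u (bs i) y * dd u (bs i) y := rfl
  rw [this]
  exact ContDiffAt.sum fun i _ => (c3dd h _).mul (c3dd h _)

lemma gg_lap_le {A c : ℝ} (h : US Ω u A c) (hx : x ∈ Ω) : lap (gg u u) x ≤ 2 * N * (N + 1) * A ^ 2 := by
  have h3 := h.cd x hx
  have hA := h.A1
  have e : gg u u = fun y => ∑ i, dd u (bs i) y * dd u (bs i) y := rfl
  rw [e, lap_sum _ (fun i y => dd u (bs i) y * dd u (bs i) y) fun i _ => (c3dd h3 _).mul (c3dd h3 _)]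
  refine (Finset.sum_le_sum (g := fun _ => 2 * (N + 1) * A ^ 2) fun i _ => ?_).trans (by simp; linarith)
  rw [lap_mul (c3dd h3 _) (c3dd h3 _), lap_dd h3]
  have b1 : |dd u (bs i) x| ≤ A := by simpa [bs_norm] using h.b1 x hx (bs i)
  have b4 : |dd (lap u) (bs i) x| ≤ A := by simpa [bs_norm] using h.b3 x hx (bs i)
  have b5 : |gg (dd u (bs i)) (dd u (bs i)) x| ≤ N * (A * A) := by
    apply gg_le _ _ (by linarith) <;>
    · intro k; simpa [bs_norm] using h.b2 x hx (bs i) (bs k)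
  have b6 : dd u (bs i) x * dd (lap u) (bs i) x ≤ A * A := by
    refine (le_abs_self _).trans ?_
    rw [abs_mul]; exact mul_le_mul b1 b4 (abs_nonneg _) (by linarith)
  have := (abs_le.1 b5).2
  nlinarith

noncomputable def sf (u : Eu N → ℝ) (y : Eu N) : ℝ := gg u u y + u y

lemma sf_cd (h : ContDiffAt ℝ 3 u x) : ContDiffAt ℝ 2 (sf u) x := (gg_cd h).add (c32 h)

lemma sf_dd {A c : ℝ} (h : US Ω u A c) (hx : x ∈ Ω) (i : Fin N) :
    |dd (sf u) (bs i) x| ≤ (2 * N * A + 1) * √(gg u u x) := by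
  have h3 := h.cd x hx
  have e : sf u = fun y => (∑ i, dd u (bs i) y * dd u (bs i) y) + u y := rfl
  have hd : ∀ j : Fin N, DifferentiableAt ℝ (fun y => dd u (bs j) y * dd u (bs j) y) x := fun j =>
    (c2d (c3dd h3 _)).mul (c2d (c3dd h3 _))
  rw [e, dd_add (DifferentiableAt.fun_sum fun j _ => hd j) (c2d (c32 h3)),
    dd_sum _ (fun i y => dd u (bs i) y * dd u (bs i) y) fun j _ => hd j]
  have hA := h.A1
  set ρ := √(gg u u x)
  have h1 : |∑ j, dd (fun y => dd u (bs j) y * dd u (bs j) y) (bs i) x| ≤ N * (2 * (ρ * A)) := by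
    refine (Finset.abs_sum_le_sum_abs _ _).trans ?_
    refine (Finset.sum_le_sum (g := fun _ => 2 * (ρ * A)) fun j _ => ?_).trans (by simp)
    rw [dd_mul (c2d (c3dd h3 _)) (c2d (c3dd h3 _)), ← two_mul, abs_mul, abs_two, abs_mul]
    have b2 : |dd (dd u (bs j)) (bs i) x| ≤ A := by simpa [bs_norm] using h.b2 x hx (bs j) (bs i)
    have := mul_le_mul (dbs_le_gg (u := u) (x := x) j) b2 (abs_nonneg _) (Real.sqrt_nonneg _)
    linarith
  have h2 := dbs_le_gg (u := u) (x := x) i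
  refine (abs_add_le _ _).trans ?_
  linarith

noncomputable def phf (θ : ℝ) (u : Eu N → ℝ) (y : Eu N) : ℝ := θ ^ 2 * (u y * sf u y) / (θ * sf u y + u y)

lemma sf_pos {A c : ℝ} (h : US Ω u A c) (hx : x ∈ Ω) : 0 < sf u x := by
  have := h.pos x hx
  have := gg_nonneg (u := u) (x := x)
  unfold sf; linarith

lemma phf_cd {A c θ : ℝ} (h : US Ω u A c) (hθ : 0 < θ) (hx : x ∈ Ω) : ContDiffAt ℝ 2 (phf θ u) x := by
  have h3 := h.cd x hx
  have := h.pos x hx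
  have := sf_pos h hx
  unfold phf
  exact (contDiffAt_const.mul ((c32 h3).mul (sf_cd h3))).div ((contDiffAt_const.mul (sf_cd h3)).add (c32 h3))
    (by positivity)

lemma gg_add_right (hf : DifferentiableAt ℝ f x) (hg : DifferentiableAt ℝ g x) (a : ℝ) :
    gg u (fun y => a * f y + g y) x = a * gg u f x + gg u g x := by
  simp only [gg, Finset.mul_sum, ← Finset.sum_add_distrib]
  refine Finset.sum_congr rfl fun i _ => ?_
  rw [dd_add (hf.const_mul a) hg, dd_cmul a hf]; ring

lemma phf_lap {A c θ : ℝ} (h : US Ω u A c) (hθ : 0 < θ) (hx : x ∈ Ω) :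
    lap (phf θ u) x * (θ * sf u x + u x) ^ 2 =
      θ ^ 3 * (sf u x) ^ 2 * lap u x + θ ^ 2 * (u x) ^ 2 * lap (sf u) x
      - 2 * θ ^ 3 / (θ * sf u x + u x) * ∑ i, (sf u x * dd u (bs i) x - u x * dd (sf u) (bs i) x) ^ 2 := by
  have h3 := h.cd x hx
  have hu2 := c32 h3
  have hs2 := sf_cd h3
  have hp2 := phf_cd h hθ hx
  have hu := h.pos x hx
  have hs := sf_pos h hx
  set D : Eu N → ℝ := fun y => θ * sf u y + u y with hD
  have hD0 : 0 < D x := by simp only [hD]; positivity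
  have hD2 : ContDiffAt ℝ 2 D x := (contDiffAt_const.mul hs2).add hu2
  have ev : (fun y => phf θ u y * D y) =ᶠ[𝓝 x] fun y => θ ^ 2 * (u y * sf u y) := by
    filter_upwards [h.op.mem_nhds hx] with y hy
    have hu := h.pos y hy
    have hs := sf_pos h hy
    have : D y ≠ 0 := by simp only [hD]; positivity
    simp only [phf]
    exact div_mul_cancel₀ _ this
  have L := lap_congr ev
  rw [lap_mul hp2 hD2, lap_cmul _ (hu2.mul hs2), lap_mul hu2 hs2] at L
  have e1 : lap D x = θ * lap (sf u) x + lap u x := by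
    rw [hD, lap_add (f := fun y => θ * sf u y) (contDiffAt_const.mul hs2) hu2, lap_cmul _ hs2]
  have e2 : ∀ e, dd D e x = θ * dd (sf u) e x + dd u e x := by
    intro e
    rw [hD, dd_add (f := fun y => θ * sf u y) ((c2d hs2).const_mul θ) (c2d hu2), dd_cmul _ (c2d hs2)]
  have e3 : ∀ e, dd (phf θ u) e x * (D x) ^ 2 =
      θ ^ 2 * (θ * sf u x ^ 2 * dd u e x + u x ^ 2 * dd (sf u) e x) := by
    intro e
    have L1 := dd_congr (e := e) ev
    rw [dd_mul (c2d hp2) (c2d hD2), dd_cmul (f := fun y => u y * sf u y) _ ((c2d hu2).mul (c2d hs2)), dd_mul (c2d hu2) (c2d hs2), e2] at L1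
    have e4 : phf θ u x * D x = θ ^ 2 * (u x * sf u x) := ev.self_of_nhds
    have : dd (phf θ u) e x * (D x) ^ 2 = D x * (θ ^ 2 * (u x * dd (sf u) e x + sf u x * dd u e x))
      - (phf θ u x * D x) * (θ * dd (sf u) e x + dd u e x) := by linear_combination (D x) * L1
    rw [this, e4]; simp only [hD]; ring
  have e4 : phf θ u x * D x = θ ^ 2 * (u x * sf u x) := ev.self_of_nhds
  have e5 : gg (phf θ u) D x * (D x) ^ 2 = ∑ i, θ ^ 2 * (θ * sf u x ^ 2 * dd u (bs i) x + u x ^ 2 * dd (sf u) (bs i) x)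
      * (θ * dd (sf u) (bs i) x + dd u (bs i) x) := by
    rw [gg, Finset.sum_mul]
    refine Finset.sum_congr rfl fun i _ => ?_
    rw [← e3, ← e2]; ring
  have e6 : ∑ i, (sf u x * dd u (bs i) x - u x * dd (sf u) (bs i) x) ^ 2 * (2 * θ ^ 3) =
      2 * (gg (phf θ u) D x * (D x) ^ 2) - 2 * θ ^ 2 * (D x) ^ 2 * gg u (sf u) x := by
    rw [e5, gg, Finset.mul_sum, Finset.mul_sum, ← Finset.sum_sub_distrib]
    refine Finset.sum_congr rfl fun i _ => ?_
    simp only [hD]; ring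
  rw [← Finset.sum_mul] at e6
  set S := ∑ i, (sf u x * dd u (bs i) x - u x * dd (sf u) (bs i) x) ^ 2
  have hDx : θ * sf u x + u x = D x := rfl
  rw [hDx]
  rw [e1] at L
  field_simp
  have : lap (phf θ u) x * D x ^ 3 = D x ^ 2 * (θ ^ 2 * (u x * lap (sf u) x + sf u x * lap u x))
     - D x * (phf θ u x * D x) * (θ * lap (sf u) x + lap u x) - S * (2 * θ ^ 3) := by
    rw [e6]; linear_combination D x ^ 2 * L
  rw [e4] at this
  rw [this, ← hDx]; ring

set_option maxHeartbeats 1000000 in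
lemma phf_lap_le {A c θ : ℝ} (h : US Ω u A c) (hθ : 0 < θ) (hx : x ∈ Ω) :
    lap (phf θ u) x ≤ 2 * N * (N + 1) * A ^ 2 * θ ^ 2 ∧
    (θ ≤ 1/2 → θ ^ 2 * (N * (2 * N * A + 1) ^ 2) ≤ 1/8 → u x ≤ θ * sf u x →
      lap (phf θ u) x ≤ 2 * N * (N + 1) * A ^ 2 * θ ^ 2 - 1/32) := by
  have h3 := h.cd x hx
  have hL := phf_lap h hθ hx
  have hu := h.pos x hx
  have hs := sf_pos h hx
  have hc := h.c0
  have hA := h.A1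
  have hlu := h.lapc x hx
  have hls : lap (sf u) x ≤ 2 * N * (N + 1) * A ^ 2 := by
    have : sf u = fun y => gg u u y + u y := rfl
    rw [this, lap_add (gg_cd h3) (c32 h3)]
    linarith [gg_lap_le h hx]
  set C4 := 2 * N * (N + 1) * A ^ 2 with hC4
  have hC40 : 0 ≤ C4 := by positivity
  set s := sf u x with hsdef
  set D := θ * s + u x with hD
  have hD0 : 0 < D := by positivity
  set S := ∑ i, (s * dd u (bs i) x - u x * dd (sf u) (bs i) x) ^ 2 with hS
  have hS0 : 0 ≤ S := Finset.sum_nonneg fun i _ => sq_nonneg _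
  have t1 : θ ^ 3 * s ^ 2 * lap u x ≤ 0 := mul_nonpos_of_nonneg_of_nonpos (by positivity) (by linarith)
  have huD : u x ^ 2 ≤ D ^ 2 := by
    apply pow_le_pow_left₀ hu.le; rw [hD]; nlinarith [mul_pos hθ hs]
  have t2 : θ ^ 2 * u x ^ 2 * lap (sf u) x ≤ C4 * θ ^ 2 * D ^ 2 := by
    calc θ ^ 2 * u x ^ 2 * lap (sf u) x ≤ θ ^ 2 * u x ^ 2 * C4 := by gcongr
      _ ≤ θ ^ 2 * D ^ 2 * C4 := by gcongr
      _ = _ := by ring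
  have hD2 : 0 < D ^ 2 := by positivity
  constructor
  · have t3 : 0 ≤ 2 * θ ^ 3 / D * S := by positivity
    have : lap (phf θ u) x * D ^ 2 ≤ C4 * θ ^ 2 * D ^ 2 := by rw [hL]; linarith
    exact le_of_mul_le_mul_right this hD2
  · intro h1 h2 h4
    have hQs : gg u u x = s - u x := by rw [hsdef, sf]; ring
    have hQ1 : gg u u x ≤ s := by linarith
    have hQ2 : s / 2 ≤ gg u u x := by nlinarith
    have b1 : ∑ i, (dd (sf u) (bs i) x) ^ 2 ≤ N * (2 * N * A + 1) ^ 2 * s := by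
      refine (Finset.sum_le_sum (g := fun _ => (2 * N * A + 1) ^ 2 * s) fun i _ => ?_).trans
        (by simp; linarith)
      have := pow_le_pow_left₀ (abs_nonneg _) (sf_dd h hx i) 2
      rw [sq_abs, mul_pow, Real.sq_sqrt gg_nonneg] at this
      refine this.trans ?_
      gcongr
    have b2 : s ^ 2 * gg u u x / 2 - u x ^ 2 * ∑ i, (dd (sf u) (bs i) x) ^ 2 ≤ S := by
      rw [hS, gg, Finset.mul_sum, Finset.mul_sum, Finset.sum_div, ← Finset.sum_sub_distrib]
      refine Finset.sum_le_sum fun i _ => ?_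
      nlinarith [sq_nonneg (s * dd u (bs i) x - 2 * (u x * dd (sf u) (bs i) x))]
    have b3 : u x ^ 2 * ∑ i, (dd (sf u) (bs i) x) ^ 2 ≤ s ^ 3 / 8 := by
      calc u x ^ 2 * ∑ i, (dd (sf u) (bs i) x) ^ 2 ≤ (θ * s) ^ 2 * (N * (2 * N * A + 1) ^ 2 * s) := by
            gcongr
        _ = (θ ^ 2 * (N * (2 * N * A + 1) ^ 2)) * s ^ 3 := by ring
        _ ≤ 1/8 * s ^ 3 := by gcongr
        _ = _ := by ring
    have b4 : s ^ 3 / 8 ≤ S := by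
      have : s ^ 2 * (s / 2) ≤ s ^ 2 * gg u u x := by gcongr
      nlinarith
    have b5 : D ^ 2 / 32 ≤ 2 * θ ^ 3 / D * S := by
      have hD3 : D ≤ 2 * θ * s := by linarith
      have : D ^ 3 ≤ (2 * θ * s) ^ 3 := pow_le_pow_left₀ hD0.le hD3 3
      rw [div_mul_eq_mul_div, le_div_iff₀ hD0]
      have : θ ^ 3 * (s ^ 3 / 8) ≤ θ ^ 3 * S := by gcongr
      have e8 : (2 * θ * s) ^ 3 = 64 * (θ ^ 3 * (s ^ 3 / 8)) := by ring
      have e9 : D ^ 2 / 32 * D = D ^ 3 / 32 := by ring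
      rw [e9]
      linarith
    have : lap (phf θ u) x * D ^ 2 ≤ (C4 * θ ^ 2 - 1/32) * D ^ 2 := by rw [hL]; linarith
    exact le_of_mul_le_mul_right this hD2

lemma phf_bd {A c θ : ℝ} (h : US Ω u A c) (hθ : 0 < θ) (hx : x ∈ Ω) : 0 ≤ phf θ u x ∧ phf θ u x ≤ θ * u x := by
  have hu := h.pos x hx
  have hs := sf_pos h hx
  unfold phf
  constructor
  · positivity
  · rw [div_le_iff₀ (by positivity)]
    nlinarith [mul_pos hθ (mul_pos hu hu)]

end thmD3

section thmD4
variable {N : ℕ} {u w f g : Eu N → ℝ} {e e' x p : Eu N} {Ω : Set (Eu N)}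

noncomputable def K1c (n A : ℝ) : ℝ := 2 * (A + A * (8 * n * A ^ 2 + 1))
noncomputable def C2c (n A : ℝ) : ℝ := 128 * n ^ 2 * A ^ 2 + n + 1
noncomputable def K2c (n A : ℝ) : ℝ := K1c n A + 4 * n * A * C2c n A
noncomputable def Gac (n A c ε θ M : ℝ) : ℝ :=
  (2 * K2c n A * ε / θ + 128 * n * A * M * (2 * n * (n + 1) * A ^ 2) * θ ^ 2) / c + 128 * n * A * M * θ

set_option maxHeartbeats 1000000 in
lemma zf_bound {A c ε M θ : ℝ} (hN : (1:ℝ) ≤ N) (h : US Ω u A c) (hw : WS Ω u w ε) (hε : 0 < ε) (hM0 : 0 < M)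
    (hM : ∀ x ∈ Ω, ∀ i j, |dd (dd w (bs i)) (bs j) x| ≤ M) (hθ : 0 < θ) (hθ1 : θ ≤ 1/2)
    (hθ2 : θ ^ 2 * (N * (2 * N * A + 1) ^ 2) ≤ 1/8) (i j : Fin N) :
    ∀ x ∈ Ω, |zf u w i j x| ≤ Gac N A c ε θ M * u x := by
  have hA := h.A1
  have hc := h.c0
  set K1 := K1c N A with hK1
  have hK10 : 0 < K1 := by rw [hK1, K1c]; positivity
  set C2 := C2c N A with hC2
  have hC20 : 0 < C2 := by rw [hC2, C2c]; positivity
  set K2 := K2c N A with hK2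
  have hK2e : K2 = K1 + 4 * N * A * C2 := rfl
  have hK20 : 0 < K2 := by rw [hK2e]; positivity
  set C4 : ℝ := 2 * N * (N + 1) * A ^ 2 with hC4
  set β : ℝ := 128 * N * A * M with hβ
  have hβ0 : 0 < β := by positivity
  set α : ℝ := (2 * K2 * ε / θ + β * C4 * θ ^ 2) / c with hα
  have hα0 : 0 < α := by positivity
  have hαc : α * c = 2 * K2 * ε / θ + β * C4 * θ ^ 2 := by rw [hα]; field_simp
  have hεθ : ε ≤ ε / θ := by rw [le_div_iff₀ hθ]; nlinarith
  have hK2ε : 0 < K2 * ε / θ := by positivity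
  have hLap : ∀ x ∈ Ω, α * lap u x + β * lap (phf θ u) x < -|lap (zf u w i j) x| := by
    intro x hx
    have l1 : α * lap u x ≤ -(α * c) := by nlinarith [h.lapc x hx]
    have hK1ε : K1 * ε ≤ K1 * ε / θ := by rw [mul_div_assoc]; gcongr
    have hp := phf_lap_le h hθ hx
    by_cases hg : u x ≤ θ * sf u x
    · have l2 := mul_le_mul_of_nonneg_left (hp.2 hθ1 hθ2 hg) hβ0.le
      have l3 := zf_lap h hw hε hx (hM x hx) i j
      have l4 : K1 * ε / θ ≤ K2 * ε / θ := by
        have : K1 ≤ K2 := by rw [hK2e]; linarith [show 0 < 4 * N * A * C2 by positivity]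
        gcongr
      change _ ≤ K1 * ε + _ at l3
      have e1 : β * (C4 * θ ^ 2 - 1/32) = β * C4 * θ ^ 2 - 4 * N * A * M := by rw [hβ]; ring
      have e2 : 2 * K2 * ε / θ = 2 * (K2 * ε / θ) := by ring
      rw [e1] at l2
      rw [hαc, e2] at l1
      linarith
    · have hR : θ * gg u u x ≤ u x := by
        have : gg u u x ≤ sf u x := by unfold sf; linarith [h.pos x hx]
        nlinarith
      have l2 := mul_le_mul_of_nonneg_left hp.1 hβ0.le
      have l3 := zf_lap h hw hε hx (fun i j => hess_R hN h hw hε hx hθ (by linarith) hR i j) i j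
      change _ ≤ K1 * ε + 4 * N * A * (C2 * ε / θ) at l3
      have e2 : 2 * K2 * ε / θ = 2 * (K2 * ε / θ) := by ring
      have e3 : K2 * ε / θ = K1 * ε / θ + 4 * N * A * (C2 * ε / θ) := by rw [hK2e]; ring
      have e4 : β * (C4 * θ ^ 2) = β * C4 * θ ^ 2 := by ring
      rw [e4] at l2
      rw [hαc, e2] at l1
      linarith
  obtain ⟨C, hC⟩ := zf_lim hN h hw hε hM0.le hM i j
  have hCpos : ∀ x ∈ Ω, √(u x) ≤ 1 / (5 * A) → |zf u w i j x| ≤ (|C| + 1) * √(u x) := by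
    intro x hx hx2
    refine (hC x hx hx2).trans ?_
    gcongr
    linarith [le_abs_self C]
  have hlimz : ∀ p ∈ frontier Ω, ∀ κ > 0, ∀ᶠ x in 𝓝[Ω] p, |zf u w i j x| ≤ κ := by
    intro p hp κ hκ
    have t : Tendsto (fun x => √(u x)) (𝓝[Ω] p) (𝓝 0) := by
      have := (Real.continuous_sqrt.tendsto 0).comp (h.lim p hp)
      rw [Real.sqrt_zero] at this
      exact this
    have e1 := t.eventually_le_const (u := 1 / (5 * A)) (by positivity)
    have e2 := t.eventually_le_const (u := κ / (|C| + 1)) (by positivity)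
    filter_upwards [e1, e2, self_mem_nhdsWithin] with y h1 h2 h3
    refine (hCpos y h3 h1).trans ?_
    rw [le_div_iff₀ (by positivity)] at h2
    linarith
  have hcdz : ∀ x ∈ Ω, ContDiffAt ℝ 2 (zf u w i j) x := fun x hx => zf_cd (h.cd x hx) (hw.cd x hx) i j
  have main : ∀ σ : ℝ, |σ| = 1 → ∀ x ∈ Ω, σ * zf u w i j x - (α * u x + β * phf θ u x) ≤ 0 := by
    intro σ hσ
    apply maxP h.op h.bd
    · intro x hx
      exact (contDiffAt_const.mul (hcdz x hx)).sub ((contDiffAt_const.mul (c32 (h.cd x hx))).add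
        (contDiffAt_const.mul (phf_cd h hθ hx)))
    · intro p hp κ hκ
      filter_upwards [hlimz p hp κ hκ, self_mem_nhdsWithin] with y h1 h2
      have := h.pos y h2
      have h3 := (phf_bd h hθ h2).1
      have h4 : σ * zf u w i j y ≤ |zf u w i j y| := by
        refine (le_abs_self _).trans ?_; rw [abs_mul, hσ, one_mul]
      have : 0 ≤ α * u y := by positivity
      have : 0 ≤ β * phf θ u y := by positivity
      linarith
    · intro x hx _
      rw [lap_sub (f := fun y => σ * zf u w i j y) (g := fun y => α * u y + β * phf θ u y)
        (contDiffAt_const.mul (hcdz x hx)) ((contDiffAt_const.mul (c32 (h.cd x hx))).add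
        (contDiffAt_const.mul (phf_cd h hθ hx))), lap_cmul _ (hcdz x hx),
        lap_add (f := fun y => α * u y) (g := fun y => β * phf θ u y) (contDiffAt_const.mul (c32 (h.cd x hx)))
        (contDiffAt_const.mul (phf_cd h hθ hx)), lap_cmul _ (c32 (h.cd x hx)), lap_cmul _ (phf_cd h hθ hx)]
      have h4 : -|lap (zf u w i j) x| ≤ σ * lap (zf u w i j) x := by
        have := neg_abs_le (σ * lap (zf u w i j) x); rwa [abs_mul, hσ, one_mul] at this
      linarith [hLap x hx]
  intro x hx
  have m1 := main 1 (by simp) x hx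
  have m2 := main (-1) (by simp) x hx
  have h3 := (phf_bd h hθ hx).2
  have h5 : β * phf θ u x ≤ β * (θ * u x) := by gcongr
  have eG : Gac N A c ε θ M * u x = α * u x + β * (θ * u x) := by
    simp only [Gac, hα, hβ, hC4, ← hK2]; ring
  rw [eG, abs_le]
  constructor <;> linarith

/-- linear algebra -/
lemma lin_alg {a : Fin N → ℝ} {B : Fin N → Fin N → ℝ} {ρ H ε : ℝ} (hN : (1:ℝ) ≤ N) (hρ : 0 < ρ)
    (hsym : ∀ i j, B i j = B j i) (ha : ∀ i, |a i| ≤ ρ) (hQ : ∑ i, a i ^ 2 = ρ ^ 2)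
    (hE : ∀ i j k, |a i * B j k - a j * B i k| ≤ H * ρ) (htr : |∑ i, B i i| ≤ ε) (hH : 0 ≤ H) (j k : Fin N) :
    |B j k| ≤ ε + 3 * N ^ 2 * H := by
  set b : Fin N → ℝ := fun k => ∑ i, a i * B i k with hb
  have s1 : ∀ j k, |ρ ^ 2 * B j k - a j * b k| ≤ N * H * ρ ^ 2 := by
    intro j k
    have : ρ ^ 2 * B j k - a j * b k = ∑ i, a i * (a i * B j k - a j * B i k) := by
      rw [← hQ, hb, Finset.sum_mul, Finset.mul_sum, ← Finset.sum_sub_distrib]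
      exact Finset.sum_congr rfl fun i _ => by ring
    rw [this]
    refine (Finset.abs_sum_le_sum_abs _ _).trans ?_
    refine (Finset.sum_le_sum (g := fun _ => H * ρ ^ 2) fun i _ => ?_).trans (by simp; linarith)
    rw [abs_mul]
    have := mul_le_mul (ha i) (hE i j k) (abs_nonneg _) hρ.le
    linarith
  have s2 : |ρ ^ 2 * ∑ i, B i i - ∑ i, a i * b i| ≤ N ^ 2 * H * ρ ^ 2 := by
    rw [Finset.mul_sum, ← Finset.sum_sub_distrib]
    refine (Finset.abs_sum_le_sum_abs _ _).trans ?_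
    refine (Finset.sum_le_sum (g := fun _ => N * H * ρ ^ 2) fun i _ => s1 i i).trans (by simp; linarith)
  have s3 : ∀ k, |ρ ^ 2 * b k - a k * ∑ i, a i * b i| ≤ N ^ 2 * H * ρ ^ 3 := by
    intro k
    have : ρ ^ 2 * b k - a k * ∑ i, a i * b i = ∑ i, a i * (ρ ^ 2 * B k i - a k * b i) := by
      rw [hb, Finset.mul_sum, Finset.mul_sum, ← Finset.sum_sub_distrib]
      exact Finset.sum_congr rfl fun i _ => by rw [hsym i k]; ring
    rw [this]
    refine (Finset.abs_sum_le_sum_abs _ _).trans ?_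
    refine (Finset.sum_le_sum (g := fun _ => N * H * ρ ^ 3) fun i _ => ?_).trans (by simp; linarith)
    rw [abs_mul]
    have := mul_le_mul (ha i) (s1 k i) (abs_nonneg _) hρ.le
    linarith
  set τ := ∑ i, B i i with hτ
  set σ := ∑ i, a i * b i with hσ
  have hNN : (N:ℝ) ≤ N ^ 2 := by nlinarith
  -- combine
  have key : |ρ ^ 4 * B j k| ≤ (ε + 3 * N ^ 2 * H) * ρ ^ 4 := by
    have e : ρ ^ 4 * B j k = ρ ^ 2 * (ρ ^ 2 * B j k - a j * b k) + a j * (ρ ^ 2 * b k - a k * σ)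
        - a j * a k * (ρ ^ 2 * τ - σ) + a j * a k * (ρ ^ 2 * τ) := by ring
    rw [e]
    have haa : |a j * a k| ≤ ρ * ρ := by
      rw [abs_mul]; exact mul_le_mul (ha j) (ha k) (abs_nonneg _) hρ.le
    have t1 : |ρ ^ 2 * (ρ ^ 2 * B j k - a j * b k)| ≤ N ^ 2 * H * ρ ^ 4 := by
      rw [abs_mul, abs_of_pos (by positivity : 0 < ρ ^ 2)]
      calc ρ ^ 2 * _ ≤ ρ ^ 2 * (N * H * ρ ^ 2) := by gcongr; exact s1 j k
        _ = N * (H * ρ ^ 4) := by ring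
        _ ≤ N ^ 2 * (H * ρ ^ 4) := by gcongr
        _ = _ := by ring
    have t2 : |a j * (ρ ^ 2 * b k - a k * σ)| ≤ N ^ 2 * H * ρ ^ 4 := by
      rw [abs_mul]
      calc _ ≤ ρ * (N ^ 2 * H * ρ ^ 3) := mul_le_mul (ha j) (s3 k) (abs_nonneg _) hρ.le
        _ = _ := by ring
    have t3 : |a j * a k * (ρ ^ 2 * τ - σ)| ≤ N ^ 2 * H * ρ ^ 4 := by
      rw [abs_mul]
      calc _ ≤ ρ * ρ * (N ^ 2 * H * ρ ^ 2) := mul_le_mul haa s2 (abs_nonneg _) (by positivity)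
        _ = _ := by ring
    have t4 : |a j * a k * (ρ ^ 2 * τ)| ≤ ε * ρ ^ 4 := by
      rw [abs_mul, abs_mul (ρ ^ 2), abs_of_pos (by positivity : 0 < ρ ^ 2)]
      calc _ ≤ ρ * ρ * (ρ ^ 2 * ε) := mul_le_mul haa (by gcongr) (by positivity) (by positivity)
        _ = _ := by ring
    obtain ⟨t11, t12⟩ := abs_le.1 t1
    obtain ⟨t21, t22⟩ := abs_le.1 t2
    obtain ⟨t31, t32⟩ := abs_le.1 t3
    obtain ⟨t41, t42⟩ := abs_le.1 t4
    rw [abs_le]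
    constructor <;> linarith
  rw [abs_mul, abs_of_pos (by positivity : 0 < ρ ^ 4), mul_comm] at key
  exact le_of_mul_le_mul_right key (by positivity)

noncomputable def hc (n A c ε θ M : ℝ) : ℝ :=
  8 * n * A * Gac n A c ε θ M + (K1c n A * ε + 4 * n * A * M) * θ + 2 * (A * ((8 * n * A ^ 2 + 1) * ε))

set_option maxHeartbeats 1000000 in
lemma hess_good {A c ε M θ : ℝ} (hN : (1:ℝ) ≤ N) (h : US Ω u A c) (hw : WS Ω u w ε) (hε : 0 < ε) (hM0 : 0 < M)
    (hM : ∀ x ∈ Ω, ∀ i j, |dd (dd w (bs i)) (bs j) x| ≤ M) (hθ : 0 < θ) (hθ1 : θ ≤ 1/2)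
    (hθ2 : θ ^ 2 * (N * (2 * N * A + 1) ^ 2) ≤ 1/8) (hx : x ∈ Ω) (hG : u x ≤ 2 * θ * gg u u x) (i j : Fin N) :
    |dd (dd w (bs i)) (bs j) x| ≤ ε + 3 * N ^ 2 * hc N A c ε θ M := by
  obtain ⟨hρ0, d, hd0, hdθ, hud, hd⟩ := good_scale h hx hθ hθ1 hG
  have hA := h.A1
  have hcc := h.c0
  set ρ := √(gg u u x) with hρ
  have hb := ball_in h hx dd_le_gg hρ0.le hd
  set Γ := Gac N A c ε θ M with hΓ
  have hΓ0 : 0 ≤ Γ := by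
    rw [hΓ, Gac, K2c, K1c, C2c]; positivity
  set F := K1c N A * ε + 4 * N * A * M with hF
  have hF0 : 0 ≤ F := by rw [hF, K1c]; positivity
  have hu3 := h.cd x hx
  have hw3 := hw.cd x hx
  have gz : ∀ i j k, |dd (zf u w i j) (bs k) x| ≤ (8 * N * A * Γ + F * θ) * ρ := by
    intro i j k
    have := grad_est (w := zf u w i j) hd0 (bs_norm k) (M := Γ * (2 * u x)) (F := F)
      (fun y hy => zf_cd (h.cd y (hb y hy).1) (hw.cd y (hb y hy).1) i j)
      (fun y hy => (zf_bound hN h hw hε hM0 hM hθ hθ1 hθ2 i j y (hb y hy).1).trans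
        (mul_le_mul_of_nonneg_left (hb y hy).2 hΓ0))
      (fun y hy => zf_lap h hw hε (hb y hy).1 (hM y (hb y hy).1) i j)
    refine this.trans ?_
    have e1 : N * (Γ * (2 * u x)) / d = 8 * N * A * Γ * ρ := by rw [hud]; field_simp; ring
    rw [e1]
    have : F * d ≤ F * (θ * ρ) := by gcongr
    have : 0 ≤ F * (θ * ρ) := by positivity
    linarith
  have ez : ∀ i j k, dd (zf u w i j) (bs k) x =
      (dd u (bs i) x * dd (dd w (bs j)) (bs k) x - dd u (bs j) x * dd (dd w (bs i)) (bs k) x)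
      + dd w (bs j) x * dd (dd u (bs i)) (bs k) x - dd w (bs i) x * dd (dd u (bs j)) (bs k) x := by
    intro i j k
    have a1 : ∀ i, DifferentiableAt ℝ (dd u (bs i)) x := fun i => c2d (c3dd hu3 _)
    have a2 : ∀ i, DifferentiableAt ℝ (dd w (bs i)) x := fun i => c2d (c3dd hw3 _)
    have : zf u w i j = fun y => dd u (bs i) y * dd w (bs j) y - dd u (bs j) y * dd w (bs i) y := rfl
    rw [this, dd_sub (f := fun y => dd u (bs i) y * dd w (bs j) y) (g := fun y => dd u (bs j) y * dd w (bs i) y)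
      ((a1 i).mul (a2 j)) ((a1 j).mul (a2 i)), dd_mul (a1 i) (a2 j), dd_mul (a1 j) (a2 i)]
    ring
  have t : ∀ i j k, |dd w (bs j) x * dd (dd u (bs i)) (bs k) x| ≤ A * ((8 * N * A ^ 2 + 1) * ε) * ρ := by
    intro i j k
    have g := gradw_good h hw hε hx hθ hθ1 hG j
    have b2 : |dd (dd u (bs i)) (bs k) x| ≤ A := by simpa [bs_norm] using h.b2 x hx (bs i) (bs k)
    rw [abs_mul]
    have := mul_le_mul g b2 (abs_nonneg _) (by positivity)
    linarith
  have hH : 0 ≤ hc N A c ε θ M := by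
    change 0 ≤ 8 * N * A * Γ + F * θ + 2 * (A * ((8 * N * A ^ 2 + 1) * ε))
    positivity
  refine lin_alg (a := fun i => dd u (bs i) x) (B := fun i j => dd (dd w (bs i)) (bs j) x) hN hρ0
    (fun i j => dd_comm (c32 hw3)) (fun i => dbs_le_gg i) ?_ ?_ (hw.l0 x hx) hH i j
  · rw [hρ, Real.sq_sqrt gg_nonneg, gg]; simp only [pow_two]
  · intro i j k
    change _ ≤ (8 * N * A * Γ + F * θ + 2 * (A * ((8 * N * A ^ 2 + 1) * ε))) * ρ
    obtain ⟨x1, x2⟩ := abs_le.1 (gz i j k)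
    obtain ⟨y1, y2⟩ := abs_le.1 (t i j k)
    obtain ⟨z1, z2⟩ := abs_le.1 (t j i k)
    rw [ez] at x1 x2
    rw [abs_le]
    constructor <;> linarith

/-- choice of the parameter -/
lemma theta_ex (n A c : ℝ) (hn : 1 ≤ n) (hA : 1 ≤ A) (hc0 : 0 < c) :
    ∃ θ C, 0 < θ ∧ θ ≤ 1/2 ∧ θ ^ 2 * (n * (2 * n * A + 1) ^ 2) ≤ 1/8 ∧ 0 < C ∧
      ∀ ε M, 0 < ε → 0 < M → ε + 3 * n ^ 2 * hc n A c ε θ M ≤ M / 2 + C * ε ∧ C2c n A * ε / θ ≤ M / 2 + C * ε := by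
  set P : ℝ := n * (2 * n * A + 1) ^ 2 with hP
  set C6 : ℝ := 3 * n ^ 2 * (8 * n * A * (128 * n * A * (2 * n * (n + 1) * A ^ 2) / c + 128 * n * A) + 4 * n * A) with hC6
  have hP0 : 0 < P := by positivity
  have hC60 : 0 < C6 := by positivity
  set θ : ℝ := 1 / (2 + 8 * P + 2 * C6) with hθ
  have hθ0 : 0 < θ := by positivity
  have hθe : θ * (2 + 8 * P + 2 * C6) = 1 := by rw [hθ]; field_simp
  have hθ1 : θ ≤ 1/2 := by nlinarith [mul_pos hθ0 hP0, mul_pos hθ0 hC60]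
  have hθP : θ * P ≤ 1/8 := by nlinarith [mul_pos hθ0 hP0, mul_pos hθ0 hC60]
  have hθC : θ * C6 ≤ 1/2 := by nlinarith [mul_pos hθ0 hP0, mul_pos hθ0 hC60]
  set C5 : ℝ := 3 * n ^ 2 * (8 * n * A * (2 * K2c n A / θ / c) + K1c n A * θ + 2 * (A * (8 * n * A ^ 2 + 1))) with hC5
  have hK1 : 0 < K1c n A := by rw [K1c]; positivity
  have hC2 : 0 < C2c n A := by rw [C2c]; positivity
  have hK2 : 0 < K2c n A := by rw [K2c]; positivity
  have hC50 : 0 < C5 := by positivity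
  refine ⟨θ, 1 + C5 + C2c n A / θ, hθ0, hθ1, ?_, by positivity, ?_⟩
  · have : θ ^ 2 * P = θ * (θ * P) := by ring
    rw [this]; nlinarith [mul_pos hθ0 hP0]
  · intro ε M hε hM
    constructor
    · have e1 : ε + 3 * n ^ 2 * hc n A c ε θ M = (1 + C5) * ε + 3 * n ^ 2 * (8 * n * A * (128 * n * A * (2 * n * (n + 1) * A ^ 2) / c * θ + 128 * n * A) + 4 * n * A) * θ * M := by
        rw [hc, Gac, hC5]; ring
      have e2 : 3 * n ^ 2 * (8 * n * A * (128 * n * A * (2 * n * (n + 1) * A ^ 2) / c * θ + 128 * n * A) + 4 * n * A) * θ * M ≤ C6 * θ * M := by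
        rw [hC6]
        gcongr
        have : 0 < 128 * n * A * (2 * n * (n + 1) * A ^ 2) / c := by positivity
        nlinarith
      have e3 : C6 * θ * M ≤ 1/2 * M := by gcongr; linarith
      have e4 : 0 < C2c n A / θ * ε := by positivity
      rw [e1]; linarith
    · have e1 : C2c n A * ε / θ = C2c n A / θ * ε := by ring
      rw [e1]
      have : 0 < C5 * ε := by positivity
      linarith

theorem thmD {A c : ℝ} (hN : (1:ℝ) ≤ N) (hA : 1 ≤ A) (hc0 : 0 < c) : ∃ C, 0 < C ∧ ∀ (Ω : Set (Eu N)) (u w : Eu N → ℝ) (ε M : ℝ),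
    US Ω u A c → WS Ω u w ε → 0 < ε → (∀ x ∈ Ω, ∀ i j, |dd (dd w (bs i)) (bs j) x| ≤ M) →
    ∀ x ∈ Ω, ∀ i j, |dd (dd w (bs i)) (bs j) x| ≤ C * ε := by
  obtain ⟨θ, C, hθ, hθ1, hθ2, hC, hθC⟩ := theta_ex N A c hN hA hc0
  refine ⟨2 * C, by positivity, ?_⟩
  intro Ω u w ε M h hw hε hM
  have step : ∀ M, 0 < M → (∀ x ∈ Ω, ∀ i j, |dd (dd w (bs i)) (bs j) x| ≤ M) →
      ∀ x ∈ Ω, ∀ i j, |dd (dd w (bs i)) (bs j) x| ≤ M / 2 + C * ε := by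
    intro M hM0 hM x hx i j
    by_cases hg : u x ≤ 2 * θ * gg u u x
    · exact (hess_good hN h hw hε hM0 hM hθ hθ1 hθ2 hx hg i j).trans (hθC ε M hε hM0).1
    · refine (hess_R hN h hw hε hx hθ (by linarith) ?_ i j).trans (hθC ε M hε hM0).2
      have := gg_nonneg (u := u) (x := x)
      nlinarith
  have it : ∀ n : ℕ, ∀ x ∈ Ω, ∀ i j, |dd (dd w (bs i)) (bs j) x| ≤ (|M| + 1) / 2 ^ n + 2 * C * ε := by
    intro n
    induction n with
    | zero =>
      intro x hx i j
      refine (hM x hx i j).trans ?_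
      have : 0 < C * ε := by positivity
      simp
      linarith [le_abs_self M]
    | succ n ih =>
      intro x hx i j
      refine (step _ (by positivity) ih x hx i j).trans (le_of_eq ?_)
      rw [pow_succ]; field_simp; ring
  intro x hx i j
  have : Tendsto (fun n : ℕ => (|M| + 1) / 2 ^ n + 2 * C * ε) atTop (𝓝 (0 + 2 * C * ε)) := by
    apply Tendsto.add_const
    exact tendsto_const_nhds.div_atTop (tendsto_pow_atTop_atTop_of_one_lt (by norm_num))
  rw [zero_add] at this
  exact ge_of_tendsto' this fun n => it n x hx i j

end thmD4

section lpA
variable {N : ℕ} {u v w f g r t : Eu N → ℝ} {e e' x p : Eu N} {Ω K : Set (Eu N)}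

lemma cd_glob {n : WithTop ℕ∞} (_hΩ : IsOpen Ω) (hK : IsCompact K) (hKΩ : K ⊆ Ω)
    (hf : ∀ x ∈ Ω, ContDiffAt ℝ n f x)
    (h0 : ∀ x, x ∉ K → f x = 0) : ContDiff ℝ n f ∧ HasCompactSupport f := by
  refine ⟨contDiff_iff_contDiffAt.2 fun x => ?_, HasCompactSupport.intro hK h0⟩
  by_cases hx : x ∈ K
  · exact hf x (hKΩ hx)
  · have : f =ᶠ[𝓝 x] fun _ => 0 := by
      filter_upwards [hK.isClosed.isOpen_compl.mem_nhds hx] with y hy using h0 y hy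
    exact contDiffAt_const.congr_of_eventuallyEq this

lemma int_dd_zero (hf : ContDiff ℝ 1 f) (hs : HasCompactSupport f) :
    Integrable (dd f e) ∧ ∫ x, dd f e x = 0 := by
  have hc : Continuous (dd f e) := (hf.continuous_fderiv (by simp)).clm_apply continuous_const
  have hs2 : HasCompactSupport (dd f e) := by
    apply (hs.fderiv (𝕜 := ℝ)).mono
    intro x hx
    simp only [Function.mem_support, dd] at *
    intro h; rw [h] at hx; simp at hx
  have hi : Integrable (dd f e) := hc.integrable_of_hasCompactSupport hs2
  refine ⟨hi, ?_⟩
  have := integral_mul_fderiv_eq_neg_fderiv_mul_of_integrable (μ := volume) (𝕜 := ℝ) (f := f) (g := fun _ : Eu N => (1:ℝ)) (v := e)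
    (by simp only [mul_one]; exact hi) (by simp) (by simpa using hf.continuous.integrable_of_hasCompactSupport hs)
    (fun x _ => hf.differentiable (by simp) x) (fun x _ => differentiableAt_const _)
  simp at this
  exact this

structure SS (Ω : Set (Eu N)) (lam mu : ℝ) (u v r t : Eu N → ℝ) : Prop where
  op : IsOpen Ω
  bd : Bornology.IsBounded Ω
  l0 : 0 < lam
  m0 : 0 < mu
  uc : Continuous u
  vc : Continuous v
  u0 : ∀ x, x ∉ Ω → u x = 0
  v0 : ∀ x, x ∉ Ω → v x = 0
  u2 : ∀ x ∈ Ω, ContDiffAt ℝ 2 u x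
  v2 : ∀ x ∈ Ω, ContDiffAt ℝ 2 v x
  r2 : ∀ x ∈ Ω, ContDiffAt ℝ 2 r x
  t2 : ∀ x ∈ Ω, ContDiffAt ℝ 2 t x
  eu : ∀ x ∈ Ω, -lap u x = mu * exp (v x)
  ev : ∀ x ∈ Ω, -lap v x = lam * exp (u x)
  st : ∀ x ∈ Ω, 2 * (√lam * √mu * exp ((u x + v x) / 2)) ≤ -(lap r x + gg r r x) - (lap t x + gg t t x)

lemma SS.symm {lam mu : ℝ} (h : SS Ω lam mu u v r t) : SS Ω mu lam v u t r where
  op := h.op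
  bd := h.bd
  l0 := h.m0
  m0 := h.l0
  uc := h.vc
  vc := h.uc
  u0 := h.v0
  v0 := h.u0
  u2 := h.v2
  v2 := h.u2
  r2 := h.t2
  t2 := h.r2
  eu := h.ev
  ev := h.eu
  st := fun x hx => by
    have := h.st x hx
    rw [add_comm (v x)]
    linarith

lemma lev_compact (hb : Bornology.IsBounded Ω) (hu : Continuous u) (h0 : ∀ x, x ∉ Ω → u x = 0) {δ : ℝ} (hδ : 0 < δ) :
    IsCompact {x | δ ≤ u x} ∧ {x | δ ≤ u x} ⊆ Ω := by
  have hs : {x | δ ≤ u x} ⊆ Ω := by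
    intro x hx
    by_contra h
    have := h0 x h
    simp at hx; linarith
  exact ⟨Metric.isCompact_of_isClosed_isBounded (isClosed_le continuous_const hu) (hb.subset hs), hs⟩

lemma A1 {lam mu : ℝ} (h : SS Ω lam mu u v r t) {G k J : ℝ → ℝ} (hk : Continuous k)
    (hG : ∀ s, HasDerivAt G (k s) s) (hJ : ∀ s, HasDerivAt J (k s ^ 2) s) (hG0 : ∀ s ≤ 1, G s = 0)
    (hJ0 : ∀ s ≤ 1, J s = 0) :
    ∫ x in Ω, √lam * √mu * exp ((u x + v x) / 2) * G (u x) ^ 2 ≤ ∫ x in Ω, mu * exp (v x) * J (u x) := by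
  have hGd : deriv G = k := funext fun s => (hG s).deriv
  have hJd : deriv J = fun s => k s ^ 2 := funext fun s => (hJ s).deriv
  have hG1 : ContDiff ℝ 1 G := by
    rw [contDiff_one_iff_deriv, hGd]; exact ⟨fun s => (hG s).differentiableAt, hk⟩
  have hJ1 : ContDiff ℝ 1 J := by
    rw [contDiff_one_iff_deriv, hJd]; exact ⟨fun s => (hJ s).differentiableAt, hk.pow 2⟩
  obtain ⟨hK, hKΩ⟩ := lev_compact h.bd h.uc h.u0 (zero_lt_one)
  set Z : Fin N → Eu N → ℝ := fun i y => J (u y) * dd u (bs i) y -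
    G (u y) * (G (u y) * (1/2 * (dd r (bs i) y + dd t (bs i) y))) with hZ
  have hZc : ∀ i, ∀ x ∈ Ω, ContDiffAt ℝ 1 (Z i) x := by
    intro i x hx
    have hu := h.u2 x hx
    have e1 : ContDiffAt ℝ 1 (fun y => J (u y)) x := hJ1.contDiffAt.comp x (c21 hu)
    have e2 : ContDiffAt ℝ 1 (fun y => G (u y)) x := hG1.contDiffAt.comp x (c21 hu)
    exact (e1.mul (hu.dd (by norm_num) _)).sub (e2.mul (e2.mul (contDiffAt_const.mul
      (((h.r2 x hx).dd (by norm_num) _).add ((h.t2 x hx).dd (by norm_num) _)))))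
  have hZ0 : ∀ i, ∀ x, x ∉ {x | 1 ≤ u x} → Z i x = 0 := by
    intro i x hx
    have : u x ≤ 1 := by simp at hx; exact hx.le
    simp only [hZ, hG0 _ this, hJ0 _ this]; ring
  have hZg := fun i => cd_glob h.op hK hKΩ (hZc i) (hZ0 i)
  have hZi := fun i => int_dd_zero (e := bs i) (hZg i).1 (hZg i).2
  have hdiv : ∫ x, ∑ i, dd (Z i) (bs i) x = 0 := by
    rw [integral_finsetSum _ fun i _ => (hZi i).1]
    exact Finset.sum_eq_zero fun i _ => (hZi i).2
  have hdivi : Integrable (fun x => ∑ i, dd (Z i) (bs i) x) := integrable_finsetSum _ fun i _ => (hZi i).1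
  have hdivΩ : ∫ x in Ω, ∑ i, dd (Z i) (bs i) x = 0 := by
    rw [setIntegral_eq_integral_of_forall_compl_eq_zero, hdiv]
    intro x hx
    refine Finset.sum_eq_zero fun i _ => ?_
    have hxK : x ∉ {x | 1 ≤ u x} := fun h' => hx (hKΩ h')
    have : Z i =ᶠ[𝓝 x] fun _ => 0 := by
      filter_upwards [hK.isClosed.isOpen_compl.mem_nhds hxK] with y hy using hZ0 i y hy
    rw [dd_congr this, dd_const]
  have pt : ∀ x ∈ Ω, √lam * √mu * exp ((u x + v x) / 2) * G (u x) ^ 2 ≤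
      mu * exp (v x) * J (u x) + ∑ i, dd (Z i) (bs i) x := by
    intro x hx
    have hu := h.u2 x hx
    have hr := h.r2 x hx
    have ht := h.t2 x hx
    have d1 : DifferentiableAt ℝ (fun y => J (u y)) x := (hJ (u x)).differentiableAt.comp x (c2d hu)
    have d2 : DifferentiableAt ℝ (fun y => G (u y)) x := (hG (u x)).differentiableAt.comp x (c2d hu)
    have hz : ∀ i, dd (Z i) (bs i) x = J (u x) * dd (dd u (bs i)) (bs i) x + k (u x) ^ 2 * (dd u (bs i) x) ^ 2
        - 1/2 * G (u x) ^ 2 * (dd (dd r (bs i)) (bs i) x + dd (dd t (bs i)) (bs i) x)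
        - G (u x) * k (u x) * dd u (bs i) x * (dd r (bs i) x + dd t (bs i) x) := by
      intro i
      have d3 : DifferentiableAt ℝ (fun y => dd r (bs i) y + dd t (bs i) y) x := (c2dd hr _).add (c2dd ht _)
      have d4 : DifferentiableAt ℝ (fun y => 1/2 * (dd r (bs i) y + dd t (bs i) y)) x := d3.const_mul _
      have d5 : DifferentiableAt ℝ (fun y => G (u y) * (1/2 * (dd r (bs i) y + dd t (bs i) y))) x := d2.mul d4
      simp only [hZ]
      rw [dd_sub (f := fun y => J (u y) * dd u (bs i) y) (g := fun y =>
         G (u y) * (G (u y) * (1/2 * (dd r (bs i) y + dd t (bs i) y)))) (d1.mul (c2dd hu _)) (d2.mul d5),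
        dd_mul d1 (c2dd hu _), dd_mul d2 d5, dd_mul d2 d4, dd_cmul _ d3, dd_add (c2dd hr _) (c2dd ht _),
        dd_comp (hJ (u x)).differentiableAt (c2d hu), dd_comp (hG (u x)).differentiableAt (c2d hu), hGd, hJd]
      ring
    have hsum : ∑ i, dd (Z i) (bs i) x = J (u x) * lap u x + (k (u x) ^ 2 * gg u u x
       - 1/2 * G (u x) ^ 2 * (lap r x + lap t x) - G (u x) * k (u x) * (gg u r x + gg u t x)) := by
      simp only [hz, lap_def, gg, Finset.mul_sum, ← Finset.sum_add_distrib, ← Finset.sum_sub_distrib]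
      exact Finset.sum_congr rfl fun i _ => by ring
    have sq : ∀ q : Eu N → ℝ, G (u x) * k (u x) * gg u q x ≤ 1/2 * k (u x) ^ 2 * gg u u x + 1/2 * G (u x) ^ 2 * gg q q x := by
      intro q
      simp only [gg, Finset.mul_sum, ← Finset.sum_add_distrib]
      refine Finset.sum_le_sum fun i _ => ?_
      nlinarith [sq_nonneg (k (u x) * dd u (bs i) x - G (u x) * dd q (bs i) x)]
    have s1 := sq r
    have s2 := sq t
    have hst := mul_le_mul_of_nonneg_right (h.st x hx) (sq_nonneg (G (u x)))
    have heu : lap u x = -(mu * exp (v x)) := by linarith [h.eu x hx]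
    rw [hsum, heu]
    linarith
  have hcl : IsCompact (closure Ω) := h.bd.isCompact_closure
  have ion : ∀ q : Eu N → ℝ, Continuous q → IntegrableOn q Ω := fun q hq =>
    (hq.continuousOn.integrableOn_compact hcl).mono_set subset_closure
  have hGc : Continuous G := hG1.continuous
  have hJc : Continuous J := hJ1.continuous
  have uc := h.uc
  have vc := h.vc
  have i2 : IntegrableOn (fun x => mu * exp (v x) * J (u x)) Ω := ion _ (by fun_prop)
  calc ∫ x in Ω, √lam * √mu * exp ((u x + v x) / 2) * G (u x) ^ 2
      ≤ ∫ x in Ω, (mu * exp (v x) * J (u x) + ∑ i, dd (Z i) (bs i) x) := by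
        apply setIntegral_mono_on (ion _ (by fun_prop)) (i2.add hdivi.integrableOn) h.op.measurableSet pt
    _ = _ := by
        rw [integral_add i2 hdivi.integrableOn, hdivΩ, add_zero]

end lpA

section lpB
variable {N : ℕ} {u v w f g r t : Eu N → ℝ} {e e' x p : Eu N} {Ω K : Set (Eu N)}

noncomputable def kf (s : ℝ) : ℝ := 15/8 * max 0 (exp (15/8 * s) - exp (15/8))
noncomputable def Gf (s : ℝ) : ℝ := ∫ σ in (1:ℝ)..s, kf σ
noncomputable def Jf (s : ℝ) : ℝ := ∫ σ in (1:ℝ)..s, kf σ ^ 2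

lemma kf_cont : Continuous kf := by unfold kf; fun_prop
lemma Gf_deriv (s : ℝ) : HasDerivAt Gf (kf s) s := (kf_cont.integral_hasStrictDerivAt 1 s).hasDerivAt
lemma Jf_deriv (s : ℝ) : HasDerivAt Jf (kf s ^ 2) s := ((kf_cont.pow 2).integral_hasStrictDerivAt 1 s).hasDerivAt

lemma kf_zero {s : ℝ} (hs : s ≤ 1) : kf s = 0 := by
  have : exp (15/8 * s) ≤ exp (15/8) := by rw [exp_le_exp]; linarith
  rw [kf, max_eq_left (by linarith)]; simp

lemma Gf_zero (s : ℝ) (hs : s ≤ 1) : Gf s = 0 := by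
  unfold Gf
  rw [intervalIntegral.integral_symm, intervalIntegral.integral_congr (g := fun _ => 0)]
  · simp
  · intro x hx
    rw [uIcc_of_le hs] at hx
    exact kf_zero hx.2

lemma Jf_zero (s : ℝ) (hs : s ≤ 1) : Jf s = 0 := by
  unfold Jf
  rw [intervalIntegral.integral_symm, intervalIntegral.integral_congr (g := fun _ => 0)]
  · simp
  · intro x hx
    rw [uIcc_of_le hs] at hx
    simp [kf_zero hx.2]

lemma Gf_nonneg (s : ℝ) : 0 ≤ Gf s := by
  rcases le_total s 1 with h | h
  · rw [Gf_zero s h]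
  · exact intervalIntegral.integral_nonneg h fun x _ => by unfold kf; positivity

lemma mono_of_deriv {F F' : ℝ → ℝ} (h : ∀ s, HasDerivAt F (F' s) s) {a b : ℝ} (h0 : ∀ s, a ≤ s → 0 ≤ F' s) (hab : a ≤ b) :
    F a ≤ F b := by
  have : MonotoneOn F (Ici a) := by
    apply monotoneOn_of_deriv_nonneg (convex_Ici a)
    · exact fun s _ => (h s).continuousAt.continuousWithinAt
    · exact fun s _ => (h s).differentiableAt.differentiableWithinAt
    · intro s hs
      rw [interior_Ici] at hs
      rw [(h s).deriv]; exact h0 s (le_of_lt hs)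
  exact this (mem_Ici.2 le_rfl) hab hab

lemma Jf_le (s : ℝ) : Jf s ≤ 15/16 * exp (15/4 * s) := by
  rcases le_total s 1 with h | h
  · rw [Jf_zero s h]; positivity
  · have hd : ∀ s, HasDerivAt (fun s => 15/16 * exp (15/4 * s) - Jf s) (15/16 * (exp (15/4 * s) * (15/4)) - kf s ^ 2) s := by
      intro s
      have := (((hasDerivAt_id s).const_mul (15/4)).exp.const_mul (15/16)).sub (Jf_deriv s)
      exact this.congr_deriv (by simp)
    have := mono_of_deriv hd (a := 1) (b := s) (fun s hs => by
      have h1 : exp (15/4 * s) = exp (15/8 * s) ^ 2 := by rw [← exp_nat_mul]; congr 1; push_cast; ring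
      have h2 : exp (15/8) ≤ exp (15/8 * s) := by rw [exp_le_exp]; linarith
      rw [h1, kf, max_eq_right (by linarith)]
      have := exp_pos (15/8)
      nlinarith) h
    simp only [Jf_zero 1 le_rfl] at this
    have := exp_pos (15/4 * 1)
    linarith

lemma Gf_ge : ∀ s, 0 ≤ s → exp (15/8 * s) ≤ Gf s + 2 * exp (15/8) * (1 + s) := by
  intro s hs0
  have hp := exp_pos (15/8)
  rcases le_total s 1 with h | h
  · have h2 : exp (15/8 * s) ≤ exp (15/8) := by rw [exp_le_exp]; linarith
    have := Gf_nonneg s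
    nlinarith
  · have hd : ∀ s, HasDerivAt (fun s => Gf s + 2 * exp (15/8) * (1 + s) - exp (15/8 * s))
        (kf s + 2 * exp (15/8) - exp (15/8 * s) * (15/8)) s := by
      intro s
      have := ((Gf_deriv s).add (((hasDerivAt_id s).const_add 1).const_mul (2 * exp (15/8)))).sub
        (((hasDerivAt_id s).const_mul (15/8)).exp)
      exact this.congr_deriv (by simp)
    have := mono_of_deriv hd (a := 1) (b := s) (fun s hs => by
      have h3 : exp (15/8 * s) - exp (15/8) ≤ max 0 (exp (15/8 * s) - exp (15/8)) := le_max_right _ _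
      rw [kf]
      linarith) h
    simp only [Gf_zero 1 le_rfl, mul_one] at this
    linarith

lemma Gf_sq (s : ℝ) (hs : 0 ≤ s) : exp (15/4 * s) ≤ 31/30 * Gf s ^ 2 + 1000 * exp (15/4) * exp (2 * s) := by
  have h := Gf_ge s hs
  have h0 := Gf_nonneg s
  have e1 : exp (15/4 * s) = exp (15/8 * s) ^ 2 := by rw [← exp_nat_mul]; congr 1; push_cast; ring
  have e2 : exp (15/4) = exp (15/8) ^ 2 := by rw [← exp_nat_mul]; congr 1; push_cast; ring
  have e3 : exp (2 * s) = exp s ^ 2 := by rw [← exp_nat_mul]; congr 1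
  have h1 : 1 + s ≤ exp s := by linarith [add_one_le_exp s]
  have hp := exp_pos (15/8)
  set c := exp (15/8)
  set E := exp s
  have h2 : exp (15/8 * s) ≤ Gf s + 2 * c * E := by nlinarith
  have h3 := pow_le_pow_left₀ (exp_pos _).le h2 2
  rw [e1, e2, e3]
  nlinarith [sq_nonneg (Gf s - 60 * (c * E)), sq_nonneg (c * E)]

lemma pt_ineq (U V : ℝ) : exp V * exp (15/4 * U) + exp U * exp (15/4 * V) ≤
    exp ((U + V) / 2) * (exp (15/4 * U) + exp (15/4 * V)) := by
  set a := exp (U / 2)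
  set b := exp (V / 2)
  have e1 : exp V = b * b := by rw [← exp_add]; ring_nf
  have e2 : exp U = a * a := by rw [← exp_add]; ring_nf
  have e3 : exp ((U + V) / 2) = a * b := by rw [← exp_add]; ring_nf
  have e4 : exp (15/4 * U) = a * exp (13/4 * U) := by rw [← exp_add]; ring_nf
  have e5 : exp (15/4 * V) = b * exp (13/4 * V) := by rw [← exp_add]; ring_nf
  rw [e1, e2, e3, e4, e5]
  have ha : 0 < a := exp_pos _
  have hb : 0 < b := exp_pos _
  have : 0 ≤ (a - b) * (exp (13/4 * U) - exp (13/4 * V)) := by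
    rcases le_total U V with h | h
    · apply mul_nonneg_of_nonpos_of_nonpos
      · rw [sub_nonpos, exp_le_exp]; linarith
      · rw [sub_nonpos, exp_le_exp]; linarith
    · apply mul_nonneg
      · rw [sub_nonneg, exp_le_exp]; linarith
      · rw [sub_nonneg, exp_le_exp]; linarith
  nlinarith [mul_nonneg (mul_pos ha hb).le this]

lemma SS.ion {lam mu : ℝ} (h : SS Ω lam mu u v r t) {q : Eu N → ℝ} (hq : Continuous q) : IntegrableOn q Ω :=
  (hq.continuousOn.integrableOn_compact h.bd.isCompact_closure).mono_set subset_closure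

lemma bdry_le {Ω : Set (Eu N)} (hΩ : IsOpen Ω) (hu : Continuous f) (h0 : ∀ x, x ∉ Ω → f x ≤ 0) :
    ∀ p ∈ frontier Ω, ∀ κ > 0, ∀ᶠ x in 𝓝[Ω] p, f x ≤ κ := by
  intro p hp κ hκ
  have hpn : p ∉ Ω := by
    rw [hΩ.frontier_eq] at hp; exact hp.2
  have : f p < κ := lt_of_le_of_lt (h0 p hpn) hκ
  exact (((hu.tendsto p).mono_left nhdsWithin_le_nhds).eventually_lt_const this).mono fun x hx => hx.le

lemma SS.nonneg {lam mu : ℝ} (h : SS Ω lam mu u v r t) (x : Eu N) : 0 ≤ u x := by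
  by_cases hx : x ∈ Ω
  · have := maxP (f := fun y => (-1) * u y) h.op h.bd (fun x hx => contDiffAt_const.mul (h.u2 x hx))
      (bdry_le h.op (continuous_const.mul h.uc) fun x hx => by rw [h.u0 x hx]; simp) (fun x hx _ => by
        rw [lap_cmul _ (h.u2 x hx)]
        have := h.eu x hx
        have := mul_pos h.m0 (exp_pos (v x))
        linarith) x hx
    linarith
  · rw [h.u0 x hx]

lemma SS.diff {lam mu L : ℝ} (h : SS Ω lam mu u v r t) (hL : 0 ≤ L) (hm : mu ≤ lam * exp L) (x : Eu N) : u x ≤ v x + L := by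
  by_cases hx : x ∈ Ω
  · have := maxP (f := fun y => (u y - v y) - L) h.op h.bd (fun x hx => ((h.u2 x hx).sub (h.v2 x hx)).sub contDiffAt_const)
      (bdry_le h.op ((h.uc.sub h.vc).sub continuous_const) fun x hx => by rw [h.u0 x hx, h.v0 x hx]; linarith) (fun x hx hp => by
        rw [lap_sub (f := fun y => u y - v y) (g := fun _ => L) ((h.u2 x hx).sub (h.v2 x hx)) contDiffAt_const, lap_const,
          lap_sub (h.u2 x hx) (h.v2 x hx)]
        have h1 := h.eu x hx
        have h2 := h.ev x hx
        have h3 : exp L * exp (v x) < exp (u x) := by rw [← exp_add, exp_lt_exp]; linarith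
        have h4 := mul_lt_mul_of_pos_left h3 h.l0
        have h5 := mul_le_mul_of_nonneg_right hm (exp_pos (v x)).le
        linarith) x hx
    linarith
  · rw [h.u0 x hx, h.v0 x hx]; linarith

end lpB

section lpC
variable {N : ℕ} {u v w f g r t : Eu N → ℝ} {e e' x p : Eu N} {Ω K : Set (Eu N)}

lemma SS.Iineq {lam mu : ℝ} (h : SS Ω lam mu u v r t) :
    ∫ x in Ω, exp ((u x + log lam + (v x + log mu)) / 2) * (exp (15/4 * (u x + log lam)) + exp (15/4 * (v x + log mu))) ≤
    32 * (1000 * exp (15/4)) * ∫ x in Ω, exp ((u x + log lam + (v x + log mu)) / 2) *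
      (exp (15/4 * log lam) * exp (2 * u x) + exp (15/4 * log mu) * exp (2 * v x)) := by
  have uc := h.uc
  have vc := h.vc
  have hGc : Continuous Gf := continuous_iff_continuousAt.2 fun s => (Gf_deriv s).continuousAt
  have hJc : Continuous Jf := continuous_iff_continuousAt.2 fun s => (Jf_deriv s).continuousAt
  set p := exp (15/4 * log lam) with hp
  set q := exp (15/4 * log mu) with hq
  have p0 : 0 < p := exp_pos _
  have q0 : 0 < q := exp_pos _
  set D : Eu N → ℝ := fun x => exp ((u x + log lam + (v x + log mu)) / 2) with hD
  have Dc : Continuous D := by simp only [hD]; fun_prop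
  have D0 : ∀ x, 0 < D x := fun x => exp_pos _
  have sl : ∀ a : ℝ, 0 < a → √a = exp (log a / 2) := by
    intro a ha
    rw [exp_half, exp_log ha]
  have hD1 : ∀ x, √lam * √mu * exp ((u x + v x) / 2) = D x := by
    intro x
    rw [sl lam h.l0, sl mu h.m0, ← exp_add, ← exp_add]; simp only [hD]; ring_nf
  have hD2 : ∀ x, √mu * √lam * exp ((v x + u x) / 2) = D x := by
    intro x
    rw [mul_comm (√mu), add_comm (v x), hD1]
  have a1 := A1 h kf_cont Gf_deriv Jf_deriv Gf_zero Jf_zero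
  have a2 := A1 h.symm kf_cont Gf_deriv Jf_deriv Gf_zero Jf_zero
  simp only [hD1] at a1
  simp only [hD2] at a2
  set I := ∫ x in Ω, D x * (exp (15/4 * (u x + log lam)) + exp (15/4 * (v x + log mu))) with hI
  have epu : ∀ x, exp (15/4 * (u x + log lam)) = p * exp (15/4 * u x) := by
    intro x; rw [hp, ← exp_add]; ring_nf
  have epv : ∀ x, exp (15/4 * (v x + log mu)) = q * exp (15/4 * v x) := by
    intro x; rw [hq, ← exp_add]; ring_nf
  have emu : ∀ x, mu * exp (v x) = exp (v x + log mu) := by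
    intro x; rw [exp_add, exp_log h.m0]; ring
  have elam : ∀ x, lam * exp (u x) = exp (u x + log lam) := by
    intro x; rw [exp_add, exp_log h.l0]; ring
  -- first step
  have s1 : p * (∫ x in Ω, D x * Gf (u x) ^ 2) + q * (∫ x in Ω, D x * Gf (v x) ^ 2) ≤ 15/16 * I := by
    have b1 : p * (∫ x in Ω, mu * exp (v x) * Jf (u x)) + q * (∫ x in Ω, lam * exp (u x) * Jf (v x)) ≤ 15/16 * I := by
      rw [hI, ← integral_const_mul, ← integral_const_mul, ← integral_const_mul, ← integral_add]
      · apply setIntegral_mono_on (h.ion (by fun_prop)) (h.ion (by fun_prop)) h.op.measurableSet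
        intro x _
        have := pt_ineq (u x + log lam) (v x + log mu)
        have j1 := mul_le_mul_of_nonneg_left (Jf_le (u x)) (mul_pos p0 (exp_pos (v x + log mu))).le
        have j2 := mul_le_mul_of_nonneg_left (Jf_le (v x)) (mul_pos q0 (exp_pos (u x + log lam))).le
        rw [emu, elam]
        change _ ≤ 15/16 * (exp ((u x + log lam + (v x + log mu)) / 2) * _)
        rw [epu, epv] at *
        linarith
      · exact h.ion (by fun_prop)
      · exact h.ion (by fun_prop)
    have := mul_le_mul_of_nonneg_left a1 p0.le
    have := mul_le_mul_of_nonneg_left a2 q0.le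
    linarith
  set c := 1000 * exp (15/4)
  have s2 : I ≤ 31/30 * (p * (∫ x in Ω, D x * Gf (u x) ^ 2) + q * (∫ x in Ω, D x * Gf (v x) ^ 2))
      + c * ∫ x in Ω, D x * (p * exp (2 * u x) + q * exp (2 * v x)) := by
    rw [hI, ← integral_const_mul, ← integral_const_mul, ← integral_const_mul, ← integral_add (h.ion (by fun_prop)) (h.ion (by fun_prop)),
      ← integral_const_mul, ← integral_add (h.ion (by fun_prop)) (h.ion (by fun_prop))]
    apply setIntegral_mono_on (h.ion (by fun_prop)) (h.ion (by fun_prop)) h.op.measurableSet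
    intro x _
    have g1 := mul_le_mul_of_nonneg_left (Gf_sq (u x) (h.nonneg x)) (mul_pos p0 (D0 x)).le
    have g2 := mul_le_mul_of_nonneg_left (Gf_sq (v x) (h.symm.nonneg x)) (mul_pos q0 (D0 x)).le
    rw [epu, epv]
    linarith
  linarith

lemma lpBound (hb : Bornology.IsBounded Ω) (Λ : ℝ) (hΛ : 1 ≤ Λ) : ∃ C, 0 < C ∧ ∀ lam mu u v r t, SS Ω lam mu u v r t →
    1 / Λ ≤ lam → lam ≤ Λ → 1 / Λ ≤ mu → mu ≤ Λ → ∫ x in Ω, exp (19/4 * u x) ≤ C := by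
  have hΛ0 : 0 < Λ := by linarith
  set P := exp (15/4 * log Λ) with hP
  have P0 : 0 < P := exp_pos _
  set κ := (Λ ^ 2)⁻¹ * P⁻¹ with hκ
  have κ0 : 0 < κ := by positivity
  set c := 32 * (1000 * exp (15/4)) with hc
  have c0 : 0 < c := by positivity
  set K := c * (Λ ^ 2 * (P * (1 + Λ ^ 4))) with hK
  have K0 : 0 < K := by positivity
  set C3 := K * (2 * K / κ) ^ 3 with hC3
  have C30 : 0 < C3 := by positivity
  refine ⟨2 * (C3 * (volume Ω).toReal) / κ + 1, by positivity, ?_⟩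
  intro lam mu u v r t h l1 l2 m1 m2
  have uc := h.uc
  have vc := h.vc
  have hI := h.Iineq
  set L := 2 * log Λ with hL
  have hlΛ : 0 ≤ log Λ := log_nonneg hΛ
  have hL0 : 0 ≤ L := by positivity
  have eL : exp L = Λ ^ 2 := by rw [hL, two_mul, exp_add, exp_log hΛ0]; ring
  have dd1 : ∀ a b : ℝ, 1 / Λ ≤ a → b ≤ Λ → b ≤ a * exp L := by
    intro a b ha hb
    rw [eL]
    rw [div_le_iff₀ hΛ0] at ha
    nlinarith
  have d1 := h.diff hL0 (dd1 lam mu l1 m2)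
  have d2 := h.symm.diff hL0 (dd1 mu lam m1 l2)
  have logb : ∀ a : ℝ, 1 / Λ ≤ a → a ≤ Λ → -log Λ ≤ log a ∧ log a ≤ log Λ := by
    intro a h1 h2
    have a0 : 0 < a := lt_of_lt_of_le (by positivity) h1
    constructor
    · rw [← log_inv]; exact log_le_log (by positivity) (by rwa [← one_div])
    · exact log_le_log a0 h2
  obtain ⟨ll1, ll2⟩ := logb lam l1 l2
  obtain ⟨lm1, lm2⟩ := logb mu m1 m2
  have eΛ : ∀ n : ℕ, Λ ^ n = exp (n * log Λ) := by
    intro n; rw [exp_nat_mul, exp_log hΛ0]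
  have low : κ * (∫ x in Ω, exp (19/4 * u x)) ≤ ∫ x in Ω, exp ((u x + log lam + (v x + log mu)) / 2) * (exp (15/4 * (u x + log lam)) + exp (15/4 * (v x + log mu))) := by
    rw [← integral_const_mul]
    apply setIntegral_mono_on (h.ion (by fun_prop)) (h.ion (by fun_prop)) h.op.measurableSet
    intro x _
    have e1 : κ * exp (19/4 * u x) ≤ exp ((u x + log lam + (v x + log mu)) / 2) * exp (15/4 * (u x + log lam)) := by
      rw [hκ, hP, ← exp_neg, eΛ, ← exp_neg, ← exp_add, ← exp_add, ← exp_add, exp_le_exp]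
      push_cast
      linarith [d1 x, d2 x]
    have e2 : 0 < exp ((u x + log lam + (v x + log mu)) / 2) * exp (15/4 * (v x + log mu)) := by positivity
    linarith
  have up : c * (∫ x in Ω, exp ((u x + log lam + (v x + log mu)) / 2) *
      (exp (15/4 * log lam) * exp (2 * u x) + exp (15/4 * log mu) * exp (2 * v x))) ≤
      κ / 2 * (∫ x in Ω, exp (19/4 * u x)) + C3 * (volume Ω).toReal := by
    have : C3 * (volume Ω).toReal = ∫ x in Ω, C3 := by
      rw [setIntegral_const, smul_eq_mul, mul_comm]; rfl
    rw [this, ← integral_const_mul, ← integral_const_mul, ← integral_add (h.ion (by fun_prop)) (h.ion (by fun_prop))]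
    apply setIntegral_mono_on (h.ion (by fun_prop)) (h.ion (by fun_prop)) h.op.measurableSet
    intro x _
    have hu0 := h.nonneg x
    have e1 : exp ((u x + log lam + (v x + log mu)) / 2) * (exp (15/4 * log lam) * exp (2 * u x)) ≤ Λ ^ 2 * P * exp (3 * u x) := by
      rw [hP, eΛ, ← exp_add, ← exp_add, ← exp_add, ← exp_add, exp_le_exp]
      push_cast
      linarith [d1 x, d2 x]
    have e2 : exp ((u x + log lam + (v x + log mu)) / 2) * (exp (15/4 * log mu) * exp (2 * v x)) ≤ Λ ^ 2 * P * Λ ^ 4 * exp (3 * u x) := by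
      rw [hP, eΛ, eΛ, ← exp_add, ← exp_add, ← exp_add, ← exp_add, ← exp_add, exp_le_exp]
      push_cast
      linarith [d1 x, d2 x]
    have e3 : c * (exp ((u x + log lam + (v x + log mu)) / 2) * (exp (15/4 * log lam) * exp (2 * u x) + exp (15/4 * log mu) * exp (2 * v x)))
        ≤ K * exp (3 * u x) := by
      have := mul_le_mul_of_nonneg_left (add_le_add e1 e2) c0.le
      rw [hK]
      linarith
    refine e3.trans ?_
    have e4 : exp (4 * u x) ≤ exp (19/4 * u x) := by rw [exp_le_exp]; linarith
    have e5 : exp (3 * u x) = exp (u x) ^ 3 := by rw [← exp_nat_mul]; congr 1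
    have e6 : exp (4 * u x) = exp (u x) ^ 4 := by rw [← exp_nat_mul]; congr 1
    have X0 := exp_pos (u x)
    rcases le_total (2 * K / κ) (exp (u x)) with hx | hx
    · have : K * exp (u x) ^ 3 ≤ κ / 2 * exp (u x) ^ 4 := by
        rw [div_le_iff₀ κ0] at hx
        have := mul_le_mul_of_nonneg_right hx (pow_pos X0 3).le
        nlinarith
      rw [e6] at e4
      have := mul_le_mul_of_nonneg_left e4 (half_pos κ0).le
      rw [e5]; linarith
    · have : K * exp (u x) ^ 3 ≤ C3 := by rw [hC3]; gcongr
      rw [e5]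
      have : 0 < κ / 2 * exp (19/4 * u x) := by positivity
      linarith
  set S := ∫ x in Ω, exp (19/4 * u x)
  have : κ * S ≤ κ / 2 * S + C3 * (volume Ω).toReal := low.trans (hI.trans up)
  have e : S ≤ 2 * (C3 * (volume Ω).toReal) / κ := by
    rw [le_div_iff₀ κ0]; linarith
  linarith

end lpC

section linf
variable {N : ℕ} {u v w f g h r t : Eu N → ℝ} {e e' x p x0 : Eu N} {Ω K : Set (Eu N)}

noncomputable def ga (x : Eu N) : ℝ := exp (-(1/2) * ‖x‖ ^ 2)

lemma gauss_int {b : ℝ} (hb : 0 < b) : Integrable (fun x : Eu N => exp (-b * ‖x‖ ^ 2)) := by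
  have := (GaussianFourier.integrable_cexp_neg_mul_sq_norm_add_of_euclideanSpace (ι := Fin N) (b := (b : ℂ)) (by simpa using hb) 0 0).norm
  refine this.congr (Eventually.of_forall fun x => ?_)
  simp only [Complex.norm_exp]
  congr 1
  simp [← Complex.ofReal_pow]

lemma ga_int : Integrable (ga : Eu N → ℝ) := gauss_int (by norm_num)
lemma ga_pos (x : Eu N) : 0 < ga x := exp_pos _
lemma ga_le (x : Eu N) : ga x ≤ 1 := by
  unfold ga; rw [exp_le_one_iff]; nlinarith [sq_nonneg ‖x‖]
lemma ga_cd {n : WithTop ℕ∞} : ContDiff ℝ n (ga : Eu N → ℝ) := by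
  unfold ga
  exact (contDiff_const.mul (contDiff_norm_sq ℝ)).exp

lemma ga_int_pos : 0 < ∫ x, (ga x : ℝ) ∂(volume : Measure (Eu N)) := by
  refine (integral_pos_iff_support_of_nonneg (fun x => (ga_pos x).le) ga_int).2 ?_
  have : Function.support (ga : Eu N → ℝ) = univ := by
    ext x; simp [(ga_pos x).ne']
  rw [this]; exact isOpen_univ.measure_pos volume univ_nonempty

lemma dd_ga : dd ga e x = - (inner ℝ x e) * ga x := by
  have h1 : (ga : Eu N → ℝ) = fun y => (fun s => exp (-(1/2) * s)) (‖y - 0‖ ^ 2) := by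
    ext y; simp [ga]
  have h3 := dd_comp (e := e) (x := x) (φ := fun s => exp (-(1/2) * s)) (f := fun y : Eu N => ‖y - 0‖ ^ 2) (by fun_prop)
    ((nsq_cd (n := 1) 0).differentiable (by simp) x)
  rw [h1, h3, dd_nsq]
  have : HasDerivAt (fun s : ℝ => exp (-(1/2) * s)) (exp (-(1/2) * ‖x - 0‖^2) * (-(1/2) * 1)) (‖x - 0‖^2) :=
    ((hasDerivAt_id _).const_mul _).exp
  rw [this.deriv]; simp; ring

lemma ga_mom : Integrable (fun x : Eu N => ga x * ‖x‖) := by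
  refine (gauss_int (N := N) (b := 1/4) (by norm_num)).mono' ((ga_cd (n := 1)).continuous.mul continuous_norm).aestronglyMeasurable (Eventually.of_forall fun x => ?_)
  have h1 : ‖x‖ ≤ exp (1/4 * ‖x‖^2) := by
    have := add_one_le_exp (1/4 * ‖x‖^2)
    nlinarith [sq_nonneg (1 - ‖x‖/2)]
  rw [norm_of_nonneg (mul_nonneg (ga_pos x).le (norm_nonneg _))]
  calc ga x * ‖x‖ ≤ ga x * exp (1/4 * ‖x‖^2) := by gcongr; exact (ga_pos x).le
    _ = _ := by unfold ga; rw [← exp_add]; congr 1; ring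

lemma dd_dil (s : ℝ) (hf : DifferentiableAt ℝ f (x0 + s • x)) :
    dd (fun y => f (x0 + s • y)) e x = s * dd f e (x0 + s • x) := by
  unfold dd
  have h1 : HasFDerivAt (fun y : Eu N => x0 + s • y) (s • ContinuousLinearMap.id ℝ (Eu N)) x :=
    ((hasFDerivAt_id x).const_smul s).const_add x0
  have := (hf.hasFDerivAt.comp x h1).fderiv
  have h2 : fderiv ℝ (fun y => f (x0 + s • y)) x = _ := this
  rw [h2]; simp

lemma dil_supp (hs : HasCompactSupport f) {s : ℝ} (h0 : s ≠ 0) : HasCompactSupport (fun y => f (x0 + s • y)) := by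
  exact hs.comp_homeomorph ((Homeomorph.smulOfNeZero s h0).trans (Homeomorph.addLeft x0))

lemma gauss_mv {F ρ : ℝ} (h2 : ContDiff ℝ 2 h) (hs : HasCompactSupport h) (hl : ∀ x, -F ≤ lap h x)
    (h0 : fderiv ℝ h x0 = 0) (hρ : 0 < ρ) :
    ∫ z, ga z * (h x0 - h (x0 + ρ • z)) ≤ (∫ z, (ga z : ℝ) ∂(volume : Measure (Eu N))) * F * ρ ^ 2 / 2 := by
  set c := ∫ z, (ga z : ℝ) ∂(volume : Measure (Eu N)) with hc
  have hd : Differentiable ℝ h := h2.differentiable (by simp)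
  obtain ⟨B, hB⟩ : ∃ B, ∀ x, ‖fderiv ℝ h x‖ ≤ B :=
    (hs.fderiv (𝕜 := ℝ)).exists_bound_of_continuous (h2.continuous_fderiv (by simp))
  obtain ⟨B0, hB0⟩ : ∃ B, ∀ x, ‖h x‖ ≤ B := hs.exists_bound_of_continuous h2.continuous
  have gac : Continuous (ga : Eu N → ℝ) := (ga_cd (n := 1)).continuous
  have hfc : Continuous (fderiv ℝ h) := h2.continuous_fderiv (by simp)
  have key : ∀ s : ℝ, Integrable (fun z => ga z * - dd h z (x0 + s • z)) ∧
      HasDerivAt (fun s : ℝ => ∫ z, ga z * (h x0 - h (x0 + s • z))) (∫ z, ga z * - dd h z (x0 + s • z)) s := by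
    intro s
    refine hasDerivAt_integral_of_dominated_loc_of_deriv_le (𝕜 := ℝ) (μ := (volume : Measure (Eu N)))
      (F := fun s z => ga z * (h x0 - h (x0 + s • z))) (F' := fun s z => ga z * - dd h z (x0 + s • z)) (s := univ) (bound := fun z => B * (ga z * ‖z‖))
      univ_mem ?_ ?_ ?_ ?_ ?_ ?_
    · refine Eventually.of_forall fun s => Continuous.aestronglyMeasurable ?_
      have := h2.continuous
      fun_prop
    · refine (ga_int.mul_const (2 * B0)).mono' (Continuous.aestronglyMeasurable ?_) (Eventually.of_forall fun z => ?_)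
      · have := h2.continuous
        fun_prop
      · rw [norm_mul, norm_of_nonneg (ga_pos z).le]
        gcongr
        · exact (ga_pos z).le
        · have := norm_sub_le (h x0) (h (x0 + s • z))
          linarith [hB0 x0, hB0 (x0 + s • z)]
    · refine Continuous.aestronglyMeasurable ?_
      have : Continuous fun z => dd h z (x0 + s • z) := (hfc.comp (by fun_prop)).clm_apply continuous_id
      exact gac.mul this.neg
    · refine Eventually.of_forall fun z s _ => ?_
      rw [norm_mul, norm_of_nonneg (ga_pos z).le, norm_neg, Real.norm_eq_abs]
      have := abs_dd_le (e := z) (hB (x0 + s • z))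
      nlinarith [ga_pos z]
    · exact ga_mom.const_mul B
    · refine Eventually.of_forall fun z s _ => ?_
      have := ((line_deriv (e := z) s (hd (x0 + s • z))).const_sub (h x0)).const_mul (ga z)
      exact this
  have hb : ∀ s ∈ Icc 0 ρ, ∫ z, ga z * - dd h z (x0 + s • z) ≤ (c * F) * s := by
    intro s hs'
    rcases hs'.1.eq_or_lt with h0' | h0'
    · subst h0'
      simp [dd, h0]
    set X : Fin N → Eu N → ℝ := fun i z => ga z * dd h (bs i) (x0 + s • z) with hX
    have hdh : ∀ i, ContDiff ℝ 1 (dd h (bs i)) := fun i => contDiff_iff_contDiffAt.2 fun x =>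
      (h2.contDiffAt (x := x)).dd (m := 1) (by norm_num) _
    have hXc : ∀ i, ContDiff ℝ 1 (X i) := fun i => by
      exact ga_cd.mul ((hdh i).comp (by fun_prop))
    have hds : ∀ i, HasCompactSupport (dd h (bs i)) := fun i => by
      apply (hs.fderiv (𝕜 := ℝ)).mono
      intro x hx
      simp only [Function.mem_support, dd] at *
      intro h; rw [h] at hx; simp at hx
    have hXs : ∀ i, HasCompactSupport (X i) := fun i => (dil_supp (hds i) h0'.ne').mul_left
    have hXi := fun i => int_dd_zero (e := bs i) (hXc i) (hXs i)
    have hdiv : ∫ x, ∑ i, dd (X i) (bs i) x = 0 := by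
      rw [integral_finsetSum _ fun i _ => (hXi i).1]
      exact Finset.sum_eq_zero fun i _ => (hXi i).2
    have hdivi : Integrable (fun x => ∑ i, dd (X i) (bs i) x) := integrable_finsetSum _ fun i _ => (hXi i).1
    have hS : ∀ z, ∑ i, dd (X i) (bs i) z = s * (ga z * lap h (x0 + s • z)) - ga z * dd h z (x0 + s • z) := by
      intro z
      have : ∀ i, dd (X i) (bs i) z = s * ga z * dd (dd h (bs i)) (bs i) (x0 + s • z) -
          ga z * (inner ℝ (bs i) z * dd h (bs i) (x0 + s • z)) := by
        intro i
        have hdi := (hdh i).differentiable (by simp)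
        rw [hX]
        rw [dd_mul (f := ga) (g := fun z => dd h (bs i) (x0 + s • z)) ((ga_cd (n := 1)).differentiable (by simp) z)
          ((hdi.comp (by fun_prop : Differentiable ℝ fun z : Eu N => x0 + s • z)) z), dd_dil _ (hdi _), dd_ga, real_inner_comm]
        ring
      simp only [this, Finset.sum_sub_distrib, ← Finset.mul_sum, sum_inner_dd, lap_def]
      ring
    calc ∫ z, ga z * - dd h z (x0 + s • z) ≤ ∫ z, ((∑ i, dd (X i) (bs i) z) + (s * F) * ga z) := by
          refine integral_mono (key s).1 (hdivi.add (ga_int.const_mul _)) fun z => ?_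
          simp only [hS]
          have := mul_le_mul_of_nonneg_left (hl (x0 + s • z)) (mul_pos h0' (ga_pos z)).le
          linarith
      _ = c * F * s := by
          rw [integral_add hdivi (ga_int.const_mul _), hdiv, integral_const_mul]; ring
  have := incr_le hρ.le (fun s _ => (key s).2) hb
  simpa using this

end linf

section linf2
variable {N : ℕ} {u v w f g h r t : Eu N → ℝ} {e e' x p x0 : Eu N} {Ω K : Set (Eu N)}

noncomputable def Hf (s : ℝ) : ℝ := ∫ σ in (1:ℝ)..s, smoothTransition (σ - 1)

lemma sT_c : Continuous fun σ : ℝ => smoothTransition (σ - 1) :=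
  smoothTransition.continuous.comp (by fun_prop)

lemma Hf_d (s : ℝ) : HasDerivAt Hf (smoothTransition (s - 1)) s :=
  intervalIntegral.integral_hasDerivAt_right (sT_c.intervalIntegrable _ _)
    (sT_c.stronglyMeasurableAtFilter _ _) sT_c.continuousAt

lemma Hf_deriv : deriv Hf = fun s => smoothTransition (s - 1) := funext fun s => (Hf_d s).deriv

lemma Hf_cd : ContDiff ℝ 2 Hf := by
  have : (2 : WithTop ℕ∞) = 1 + 1 := by norm_num
  rw [this, contDiff_succ_iff_deriv, Hf_deriv]
  refine ⟨fun s => (Hf_d s).differentiableAt, by simp, ?_⟩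
  exact (smoothTransition.contDiff (n := 1)).comp (by fun_prop)

lemma Hf_zero {s : ℝ} (hs : s ≤ 1) : Hf s = 0 := by
  unfold Hf
  rw [intervalIntegral.integral_congr (g := fun _ => 0), intervalIntegral.integral_zero]
  intro σ hσ
  rw [uIcc_of_ge hs] at hσ
  exact smoothTransition.zero_of_nonpos (by linarith [hσ.2])

lemma Hf_le {s : ℝ} (hs : 1 ≤ s) : Hf s ≤ s := by
  have := Convex.image_sub_le_mul_sub_of_deriv_le (D := univ) convex_univ (f := Hf) (C := 1)
    (Hf_cd.continuous.continuousOn) (Hf_cd.differentiable (by simp)).differentiableOn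
    (by intro x _; rw [Hf_deriv]; exact smoothTransition.le_one _) 1 (mem_univ _) s (mem_univ _) hs
  rw [Hf_zero le_rfl] at this; linarith

lemma Hf_ge {s : ℝ} (hs : 2 ≤ s) : s - 2 ≤ Hf s := by
  have := Convex.mul_sub_le_image_sub_of_le_deriv (D := univ) convex_univ (f := Hf) (C := 0)
    (Hf_cd.continuous.continuousOn) (Hf_cd.differentiable (by simp)).differentiableOn
    (by intro x _; rw [Hf_deriv]; exact smoothTransition.nonneg _) 1 (mem_univ _) 2 (mem_univ _) (by norm_num)
  have h2 := Convex.mul_sub_le_image_sub_of_le_deriv (D := Ici 2) (convex_Ici _) (f := Hf) (C := 1)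
    (Hf_cd.continuous.continuousOn) (Hf_cd.differentiable (by simp)).differentiableOn
    (by intro x hx; rw [interior_Ici] at hx; rw [Hf_deriv]; exact (smoothTransition.one_of_one_le (by simp at hx; linarith)).ge)
    2 (by simp) s hs hs
  rw [Hf_zero le_rfl] at this; linarith

lemma Hf_dd (s : ℝ) : 0 ≤ deriv (deriv Hf) s := by
  rw [Hf_deriv]
  have : Monotone (fun s : ℝ => smoothTransition (s - 1)) := fun a b hab => smoothTransition.monotone (by linarith)
  exact this.deriv_nonneg

lemma ga_exp_bound {F ρ I : ℝ} {G : Eu N → ℝ} (h2 : ContDiff ℝ 2 h) (hs : HasCompactSupport h) (hl : ∀ x, -F ≤ lap h x)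
    (h0 : fderiv ℝ h x0 = 0) (hρ : 0 < ρ) (hF : 19/4 * (F * ρ ^ 2) = 1)
    (hG : Integrable G) (hI : ∫ x, G x ≤ I) (hhG : ∀ x, exp (19/4 * h x) ≤ 1 + G x) (hG0 : ∀ x, 0 ≤ G x) :
    exp (19/4 * h x0) * ((∫ z, (ga z : ℝ) ∂(volume : Measure (Eu N))) / 2) ≤
      (∫ z, (ga z : ℝ) ∂(volume : Measure (Eu N))) + (ρ⁻¹) ^ N * I := by
  have mv := gauss_mv h2 hs hl h0 hρ
  set c := ∫ z, (ga z : ℝ) ∂(volume : Measure (Eu N)) with hc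
  have gac : Continuous (ga : Eu N → ℝ) := (ga_cd (n := 1)).continuous
  obtain ⟨B0, hB0⟩ : ∃ B, ∀ x, ‖h x‖ ≤ B := hs.exists_bound_of_continuous h2.continuous
  have i1 : Integrable (fun z => ga z * (h x0 - h (x0 + ρ • z))) := by
    refine (ga_int.mul_const (2 * B0)).mono' (Continuous.aestronglyMeasurable ?_) (Eventually.of_forall fun z => ?_)
    · have := h2.continuous
      fun_prop
    · rw [norm_mul, norm_of_nonneg (ga_pos z).le]
      gcongr
      · exact (ga_pos z).le
      · have := norm_sub_le (h x0) (h (x0 + ρ • z))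
        linarith [hB0 x0, hB0 (x0 + ρ • z)]
  have i2 : Integrable (fun z => G (x0 + ρ • z)) :=
    (hG.comp_add_left x0).comp_smul hρ.ne'
  have e2 : ∫ z, G (x0 + ρ • z) = (ρ⁻¹) ^ N * ∫ z, G z := by
    have := Measure.integral_comp_smul_of_nonneg (volume : Measure (Eu N)) (fun y => G (x0 + y)) ρ (hR := hρ.le)
    rw [this, integral_add_left_eq_self]; simp
  have L : ∫ z, (ga z - 19/4 * (ga z * (h x0 - h (x0 + ρ • z)))) = c - 19/4 * ∫ z, ga z * (h x0 - h (x0 + ρ • z)) := by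
    rw [integral_sub ga_int (i1.const_mul _), integral_const_mul]
  have R : ∫ z, exp (-(19/4 * h x0)) * (ga z + G (x0 + ρ • z)) = exp (-(19/4 * h x0)) * (c + (ρ⁻¹) ^ N * ∫ z, G z) := by
    rw [integral_const_mul, integral_add ga_int i2, e2]
  have le : ∫ z, (ga z - 19/4 * (ga z * (h x0 - h (x0 + ρ • z)))) ≤ ∫ z, exp (-(19/4 * h x0)) * (ga z + G (x0 + ρ • z)) := by
    refine integral_mono (ga_int.sub (i1.const_mul _)) ((ga_int.add i2).const_mul _) fun z => ?_
    set y := x0 + ρ • z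
    have a1 := add_one_le_exp (19/4 * (h y - h x0))
    have a2 : exp (19/4 * (h y - h x0)) = exp (-(19/4 * h x0)) * exp (19/4 * h y) := by
      rw [← exp_add]; congr 1; ring
    have a3 := hhG y
    have a4 : ga z * (1 + G y) ≤ ga z + G y := by nlinarith [hG0 y, ga_le z]
    have a5 := exp_pos (-(19/4 * h x0))
    calc ga z - 19/4 * (ga z * (h x0 - h y)) = ga z * (19/4 * (h y - h x0) + 1) := by ring
      _ ≤ ga z * (exp (-(19/4 * h x0)) * (1 + G y)) := by
          refine mul_le_mul_of_nonneg_left (a1.trans ?_) (ga_pos z).le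
          rw [a2]; gcongr
      _ = exp (-(19/4 * h x0)) * (ga z * (1 + G y)) := by ring
      _ ≤ _ := by gcongr
  rw [L, R] at le
  have h1 : c / 2 ≤ exp (-(19/4 * h x0)) * (c + (ρ⁻¹) ^ N * ∫ z, G z) := by
    have : 19/4 * (c * F * ρ ^ 2 / 2) = c / 2 := by
      have : 19/4 * (c * F * ρ ^ 2 / 2) = c / 2 * (19/4 * (F * ρ ^ 2)) := by ring
      rw [this, hF, mul_one]
    linarith
  calc _ ≤ exp (19/4 * h x0) * (exp (-(19/4 * h x0)) * (c + (ρ⁻¹) ^ N * ∫ z, G z)) := by gcongr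
    _ = c + (ρ⁻¹) ^ N * ∫ z, G z := by rw [← mul_assoc, ← exp_add]; simp
    _ ≤ _ := by gcongr

theorem linfBound (hN : N ≤ 9) (hb : Bornology.IsBounded Ω) (Λ : ℝ) (hΛ : 1 ≤ Λ) :
    ∃ M, ∀ lam mu u v r t, SS Ω lam mu u v r t → 1/Λ ≤ lam → lam ≤ Λ → 1/Λ ≤ mu → mu ≤ Λ → ∀ x, u x ≤ M := by
  obtain ⟨C, hC0, hC⟩ := lpBound (Ω := Ω) hb Λ hΛ
  set c := ∫ z, (ga z : ℝ) ∂(volume : Measure (Eu N)) with hc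
  have hcp : 0 < c := ga_int_pos
  set D := √(19/4 * Λ^3) ^ 9 with hD
  set Q := 2 * exp (19/2) * (c + D * C) / c with hQ
  have hQ0 : 0 < Q := by positivity
  refine ⟨max 2 (4 * log Q), fun lam mu u v r t h hl1 hl2 hm1 hm2 => ?_⟩
  obtain ⟨hK, hKΩ⟩ := lev_compact h.bd h.uc h.u0 (zero_lt_one)
  by_contra! hcon
  obtain ⟨x1, hx1⟩ := hcon
  have hx12 : 2 < u x1 := lt_of_le_of_lt (le_max_left _ _) hx1
  obtain ⟨x0, hx0K, hmax⟩ := hK.exists_isMaxOn ⟨x1, show 1 ≤ u x1 by linarith⟩ h.uc.continuousOn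
  have hmaxg : ∀ x, u x ≤ u x0 := by
    intro x
    by_cases hx : 1 ≤ u x
    · exact hmax hx
    · push Not at hx; exact hx.le.trans hx0K
  set M := u x0 with hM
  have hMx1 := hmaxg x1
  have hM2 : 2 < M := by linarith
  have hMQ : 4 * log Q < M := lt_of_lt_of_le (lt_of_le_of_lt (le_max_right _ _) hx1) hMx1
  set F := Λ ^ 3 * exp M with hF
  have hFp : 0 < F := by positivity
  have hmv : ∀ x, mu * exp (v x) ≤ F := by
    intro x
    have h1 := h.symm.diff (L := 2 * log Λ) (by have := log_nonneg hΛ; linarith) (by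
      have : exp (2 * log Λ) = Λ ^ 2 := by
        rw [two_mul, exp_add, exp_log (by linarith)]; ring
      rw [this]
      have : 1 ≤ mu * Λ := by rwa [div_le_iff₀ (by linarith)] at hm1
      nlinarith) x
    calc mu * exp (v x) ≤ Λ * exp (M + 2 * log Λ) := by
          gcongr
          linarith [hmaxg x]
      _ = F := by
          rw [hF, exp_add, two_mul, exp_add, exp_log (by linarith)]; ring
  have hh : ∀ x ∈ Ω, ContDiffAt ℝ 2 (fun y => Hf (u y)) x := fun x hx => Hf_cd.contDiffAt.comp x (h.u2 x hx)
  have hz : ∀ x, x ∉ {x | 1 ≤ u x} → Hf (u x) = 0 := by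
    intro x hx
    exact Hf_zero (by simp at hx; exact hx.le)
  obtain ⟨hcd, hcs⟩ := cd_glob h.op hK hKΩ hh hz
  have hlap : ∀ x, -F ≤ lap (fun y => Hf (u y)) x := by
    intro x
    by_cases hx : x ∈ {x | 1 ≤ u x}
    · rw [lap_comp Hf_cd (h.u2 x (hKΩ hx)), Hf_deriv]
      have e1 := h.eu x (hKΩ hx)
      have e2 := hmv x
      have e3 := smoothTransition.nonneg (u x - 1)
      have e4 := smoothTransition.le_one (u x - 1)
      have e5 : 0 ≤ deriv (fun s => smoothTransition (s - 1)) (u x) := by rw [← Hf_deriv]; exact Hf_dd _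
      have e6 : 0 ≤ gg u u x := gg_nonneg
      have e7 : lap u x = -(mu * exp (v x)) := by linarith
      have e8 : 0 < mu * exp (v x) := mul_pos h.m0 (exp_pos _)
      rw [e7]
      nlinarith [mul_nonneg e5 e6]
    · have : (fun y => Hf (u y)) =ᶠ[𝓝 x] fun _ => 0 := by
        filter_upwards [hK.isClosed.isOpen_compl.mem_nhds hx] with y hy using hz y hy
      rw [lap_congr this, lap_const]; linarith
  have hcrit : fderiv ℝ (fun y => Hf (u y)) x0 = 0 := by
    have hd := Hf_cd.differentiable (by simp)
    have : fderiv ℝ u x0 = 0 := IsLocalMax.fderiv_eq_zero (Eventually.of_forall hmaxg)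
    have h3 := ((hd (u x0)).hasDerivAt.comp_hasFDerivAt x0 (c2d (h.u2 x0 (hKΩ hx0K))).hasFDerivAt).fderiv
    have h4 : fderiv ℝ (fun y => Hf (u y)) x0 = _ := h3
    rw [h4, this, smul_zero]
  set q := √(19/4 * F) with hq
  have hq2 : q ^ 2 = 19/4 * F := sq_sqrt (by positivity)
  have hF1 : 1 ≤ F := by
    rw [hF]; exact one_le_mul_of_one_le_of_one_le (one_le_pow₀ hΛ) (one_le_exp (by linarith))
  have hq1 : 1 ≤ q := by rw [hq, one_le_sqrt]; linarith
  have hexpc : Continuous fun x => exp (19/4 * u x) := by have := h.uc; fun_prop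
  have hGi : IntegrableOn (fun x => exp (19/4 * u x)) Ω := h.ion hexpc
  have key := ga_exp_bound (x0 := x0) (h := fun y => Hf (u y)) (F := F) (ρ := q⁻¹) (I := C) (G := Ω.indicator fun x => exp (19/4 * u x))
    hcd hcs hlap hcrit (by positivity) (by
      rw [inv_pow, hq2]; field_simp) (hGi.integrable_indicator h.op.measurableSet)
    (by rw [integral_indicator h.op.measurableSet]; exact hC _ _ _ _ _ _ h hl1 hl2 hm1 hm2)
    (by
      intro x
      by_cases hx : 1 ≤ u x
      · have : x ∈ Ω := hKΩ hx
        rw [indicator_of_mem this]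
        have h1 : exp (19/4 * Hf (u x)) ≤ exp (19/4 * u x) := by
          gcongr; exact Hf_le hx
        linarith
      · rw [Hf_zero (not_le.1 hx).le]; simp
        exact indicator_nonneg (fun x _ => (exp_pos _).le) x)
    (fun x => indicator_nonneg (fun x _ => (exp_pos _).le) x)
  rw [inv_inv, ← hc] at key
  have k1 : exp (19/4 * (M - 2)) ≤ exp (19/4 * Hf M) := by gcongr; exact Hf_ge hM2.le
  have k2 : q ^ N ≤ D * exp (18/4 * M) := by
    calc q ^ N ≤ q ^ 9 := pow_le_pow_right₀ hq1 hN
      _ = D * exp (18/4 * M) := by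
        have : q = √(19/4 * Λ^3) * exp (M / 2) := by
          have e : exp M = exp (M/2) ^ 2 := by rw [← exp_nat_mul]; congr 1; push_cast; ring
          rw [hq, hF, ← mul_assoc, sqrt_mul (by positivity), e, sqrt_sq (exp_pos _).le]
        rw [this, mul_pow, hD, ← exp_nat_mul]; congr 2; push_cast; ring
  have k3 : 1 ≤ exp (18/4 * M) := one_le_exp (by linarith)
  have k4 : exp (19/4 * (M - 2)) * (c / 2) ≤ (c + D * C) * exp (18/4 * M) := by
    calc _ ≤ exp (19/4 * Hf M) * (c/2) := by gcongr
      _ ≤ c + q ^ N * C := key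
      _ ≤ c * exp (18/4 * M) + (D * exp (18/4 * M)) * C := by
          gcongr
          exact le_mul_of_one_le_right hcp.le k3
      _ = _ := by ring
  have k5 : exp (19/4 * (M-2)) * exp (19/2) = exp (M/4) * exp (18/4 * M) := by
    rw [← exp_add, ← exp_add]; congr 1; ring
  have k6 : exp (M/4) ≤ Q := by
    rw [hQ, le_div_iff₀ hcp]
    have : exp (M/4) * c * exp (18/4*M) ≤ 2 * exp (19/2) * (c + D * C) * exp (18/4*M) := by
      calc _ = 2 * exp (19/2) * (exp (19/4 * (M-2)) * (c / 2)) := by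
            have : exp (M/4) * c * exp (18/4*M) = (exp (M/4) * exp (18/4 * M)) * c := by ring
            rw [this, ← k5]; ring
        _ ≤ 2 * exp (19/2) * ((c + D * C) * exp (18/4 * M)) := by gcongr
        _ = _ := by ring
    exact le_of_mul_le_mul_right this (exp_pos _)
  have k7 : M / 4 ≤ log Q := (le_log_iff_exp_le hQ0).2 k6
  linarith

end linf2

section asm1
variable {N : ℕ} {u v w f g h r t : Eu N → ℝ} {e e' x p x0 : Eu N} {Ω K : Set (Eu N)}

lemma gradw0 {A c ε ρ d : ℝ} (h : US Ω u A c) (hcd : ∀ x ∈ Ω, ContDiffAt ℝ 2 w x)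
    (hb0 : ∀ x ∈ Ω, |w x| ≤ ε * u x) (hl0 : ∀ x ∈ Ω, |lap w x| ≤ ε) (hε : 0 < ε) (hx : x ∈ Ω)
    (hρ : ∀ e, |dd u e x| ≤ ρ * ‖e‖) (hρ0 : 0 ≤ ρ) (hd0 : 0 < d)
    (hd : ρ * d + A * d ^ 2 / 2 ≤ u x / 2) (i : Fin N) :
    |dd w (bs i) x| ≤ N * (ε * (2 * u x)) / d + ε * d / 2 := by
  have hb := ball_in h hx hρ hρ0 hd
  refine grad_est hd0 (bs_norm i) (fun y hy => (hcd y (hb y hy).1)) ?_ (fun y hy => hl0 y (hb y hy).1)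
  intro y hy
  exact (hb0 y (hb y hy).1).trans (mul_le_mul_of_nonneg_left (hb y hy).2 hε.le)

lemma gradw0_glob {A c ε : ℝ} (h : US Ω u A c) (hcd : ∀ x ∈ Ω, ContDiffAt ℝ 2 w x)
    (hb0 : ∀ x ∈ Ω, |w x| ≤ ε * u x) (hl0 : ∀ x ∈ Ω, |lap w x| ≤ ε) (hε : 0 < ε) (hx : x ∈ Ω) (i : Fin N) :
    |dd w (bs i) x| ≤ (8 * N * A ^ 2 + 1) * ε := by
  have hu := h.pos x hx
  have hA := h.A1
  have huA := h.b0 x hx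
  have hA2 : 1 ≤ A ^ 2 := one_le_pow₀ hA
  set d := u x / (4 * A ^ 2) with hd
  have hd0 : 0 < d := by positivity
  have hd4 : d * (4 * A ^ 2) = u x := by rw [hd]; field_simp
  have hdA : A * d ≤ u x / 4 := by nlinarith [mul_pos (by linarith : 0 < A) hd0]
  have hd1 : d ≤ 1 := by nlinarith [mul_pos (by linarith : 0 < A) hd0]
  have := gradw0 (d := d) h hcd hb0 hl0 hε hx (h.b1 x hx) (by linarith) hd0 (by nlinarith) i
  refine this.trans ?_
  have e1 : (N:ℝ) * (ε * (2 * u x)) / d = 8 * N * A ^ 2 * ε := by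
    rw [← hd4]; field_simp; ring
  rw [e1]
  nlinarith

lemma cmp1 {A c κ : ℝ} (h : US Ω u A c) (hcd : ∀ x ∈ Ω, ContDiffAt ℝ 2 w x)
    (hlim : ∀ p ∈ frontier Ω, Tendsto w (𝓝[Ω] p) (𝓝 0)) (hκ : 0 < κ) (hl : ∀ x ∈ Ω, -κ ≤ lap w x) :
    ∀ x ∈ Ω, w x ≤ 2 * κ / c * u x := by
  intro x hx
  have hc := h.c0
  have := maxP (f := fun y => w y - 2 * κ / c * u y) h.op h.bd
    (fun y hy => (hcd y hy).sub (contDiffAt_const.mul (c32 (h.cd y hy)))) (fun p hp η hη => by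
      have h1 := (hlim p hp).sub ((h.lim p hp).const_mul (2 * κ / c))
      simp only [mul_zero, sub_zero] at h1
      exact h1.eventually_le_const hη) (fun y hy _ => by
      rw [lap_sub (hcd y hy) (contDiffAt_const.mul (c32 (h.cd y hy))), lap_cmul _ (c32 (h.cd y hy))]
      have h1 := hl y hy
      have h2 := mul_le_mul_of_nonneg_left (h.lapc y hy) (by positivity : 0 ≤ 2 * κ / c)
      have h3 : 2 * κ / c * -c = -(2 * κ) := by field_simp
      linarith) x hx
  linarith

lemma cmpU {A c κ : ℝ} (h : US Ω u A c) (hcd : ∀ x ∈ Ω, ContDiffAt ℝ 2 w x)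
    (hlim : ∀ p ∈ frontier Ω, Tendsto w (𝓝[Ω] p) (𝓝 0)) (hκ : 0 < κ) (hl : ∀ x ∈ Ω, |lap w x| ≤ κ) :
    ∀ x ∈ Ω, |w x| ≤ 2 * κ / c * u x := by
  intro x hx
  have h1 := cmp1 h hcd hlim hκ (fun x hx => (abs_le.1 (hl x hx)).1) x hx
  have h2 := cmp1 (w := fun y => (-1) * w y) h (fun y hy => contDiffAt_const.mul (hcd y hy)) (fun p hp => by
    simpa using (hlim p hp).const_mul (-1)) hκ (fun y hy => by
      rw [lap_cmul _ (hcd y hy)]; linarith [(abs_le.1 (hl y hy)).2]) x hx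
  rw [abs_le]; constructor <;> linarith

/-- extension of the derivative to the closure -/
lemma ext_der {F : Type*} [NormedAddCommGroup F] [NormedSpace ℝ F] {f : Eu N → F} {n : ℕ} (hΩ : IsOpen Ω)
    (hf : ContDiffOn ℝ (n + 1 : ℕ) f (closure Ω)) :
    ContDiffOn ℝ n (extendFrom Ω (fderiv ℝ f)) (closure Ω) ∧
    (∀ x ∈ closure Ω, HasFDerivWithinAt f (extendFrom Ω (fderiv ℝ f) x) (closure Ω) x) ∧
    ∀ x ∈ Ω, extendFrom Ω (fderiv ℝ f) x = fderiv ℝ f x := by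
  have main : ∀ x ∈ closure Ω, ∃ f' : Eu N → Eu N →L[ℝ] F, HasFDerivWithinAt f (f' x) (closure Ω) x ∧
      ContDiffWithinAt ℝ n f' (closure Ω) x ∧ ∀ᶠ y in 𝓝[closure Ω] x, extendFrom Ω (fderiv ℝ f) y = f' y := by
    intro x hx
    have h1 := hf x hx
    push_cast at h1
    rw [contDiffWithinAt_succ_iff_hasFDerivWithinAt' (by simp)] at h1
    obtain ⟨U, hU, hUs, -, f', hf', hc⟩ := h1
    rw [insert_eq_of_mem hx] at hU hUs
    refine ⟨f', hf' x (mem_of_mem_nhdsWithin hx hU), hc, ?_⟩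
    have h2 := hc.eventually (by simp)
    rw [insert_eq_of_mem hx] at h2
    have h3 := eventually_eventually_nhdsWithin.2 hU
    filter_upwards [h2, h3, self_mem_nhdsWithin] with y hy hyU hyc
    refine extendFrom_eq hyc ?_
    have h4 : Tendsto f' (𝓝[Ω] y) (𝓝 (f' y)) := hy.continuousWithinAt.mono_left (nhdsWithin_mono y subset_closure)
    refine h4.congr' ?_
    filter_upwards [hyU.filter_mono (nhdsWithin_mono y subset_closure), self_mem_nhdsWithin] with z hz hzΩ
    exact ((hf' z hz).hasFDerivAt (mem_of_superset (hΩ.mem_nhds hzΩ) subset_closure)).fderiv.symm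
  refine ⟨fun x hx => ?_, fun x hx => ?_, fun x hx => ?_⟩
  · obtain ⟨f', h1, h2, h3⟩ := main x hx
    exact h2.congr_of_eventuallyEq h3 (h3.self_of_nhdsWithin hx)
  · obtain ⟨f', h1, h2, h3⟩ := main x hx
    rw [h3.self_of_nhdsWithin hx]; exact h1
  · obtain ⟨f', h1, h2, h3⟩ := main x (subset_closure hx)
    rw [h3.self_of_nhdsWithin (subset_closure hx)]
    exact (h1.hasFDerivAt (mem_of_superset (hΩ.mem_nhds hx) subset_closure)).fderiv.symm

noncomputable def G1 (Ω : Set (Eu N)) (f : Eu N → ℝ) : Eu N → Eu N →L[ℝ] ℝ := extendFrom Ω (fderiv ℝ f)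
noncomputable def G2 (Ω : Set (Eu N)) (f : Eu N → ℝ) : Eu N → Eu N →L[ℝ] Eu N →L[ℝ] ℝ :=
  extendFrom Ω (fderiv ℝ (G1 Ω f))

structure CC2 (Ω : Set (Eu N)) (f : Eu N → ℝ) : Prop where
  c0 : ContinuousOn f (closure Ω)
  c1 : ContinuousOn (G1 Ω f) (closure Ω)
  c2 : ContinuousOn (G2 Ω f) (closure Ω)
  d1 : ∀ x ∈ closure Ω, HasFDerivWithinAt f (G1 Ω f x) (closure Ω) x
  d2 : ∀ x ∈ closure Ω, HasFDerivWithinAt (G1 Ω f) (G2 Ω f x) (closure Ω) x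
  e1 : ∀ x ∈ Ω, G1 Ω f x = fderiv ℝ f x
  e2 : ∀ x ∈ Ω, G2 Ω f x = fderiv ℝ (fderiv ℝ f) x

lemma c2c (hΩ : IsOpen Ω) (hf : ContDiffOn ℝ 2 f (closure Ω)) : CC2 Ω f := by
  obtain ⟨h1, h2, h3⟩ := ext_der (n := 1) hΩ (by norm_num; exact hf)
  obtain ⟨k1, k2, k3⟩ := ext_der (n := 0) (f := G1 Ω f) hΩ (by norm_num; exact h1)
  refine ⟨hf.continuousOn, h1.continuousOn, k1.continuousOn, h2, k2, h3, fun x hx => ?_⟩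
  have := k3 x hx
  refine this.trans (Filter.EventuallyEq.fderiv_eq ?_)
  filter_upwards [hΩ.mem_nhds hx] with y hy using h3 y hy

lemma c2_bdd (hΩ : IsOpen Ω) (hb : Bornology.IsBounded Ω) (hf : ContDiffOn ℝ 2 f (closure Ω)) :
    ∃ A, 1 ≤ A ∧ ∀ x ∈ Ω, |f x| ≤ A ∧ (∀ e, |dd f e x| ≤ A * ‖e‖) ∧ ∀ e e', |dd (dd f e) e' x| ≤ A * ‖e‖ * ‖e'‖ := by
  have h := c2c hΩ hf
  have hK : IsCompact (closure Ω) := hb.isCompact_closure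
  obtain ⟨A0, h0⟩ := hK.exists_bound_of_continuousOn h.c0
  obtain ⟨A1, h1⟩ := hK.exists_bound_of_continuousOn h.c1
  obtain ⟨A2, h2⟩ := hK.exists_bound_of_continuousOn (E := Eu N →L[ℝ] Eu N →L[ℝ] ℝ) (f := G2 Ω f) h.c2
  refine ⟨max 1 (max A0 (max A1 A2)), le_max_left _ _, fun x hx => ?_⟩
  have hxc := subset_closure hx
  set A := max 1 (max A0 (max A1 A2))
  have b0 : A0 ≤ A := by simp [A]
  have b1 : A1 ≤ A := by simp [A]
  have b2 : A2 ≤ A := by simp [A]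
  have h1' := h1 x hxc
  have h2' := h2 x hxc
  rw [h.e1 x hx] at h1'
  rw [h.e2 x hx] at h2'
  refine ⟨(h0 x hxc).trans b0, fun e => abs_dd_le (h1'.trans b1), fun e e' => ?_⟩
  have hcd : ContDiffAt ℝ 2 f x := hf.contDiffAt (mem_of_superset (hΩ.mem_nhds hx) subset_closure)
  rw [dd_fderiv2 hcd]
  rw [← Real.norm_eq_abs]
  calc ‖fderiv ℝ (fderiv ℝ f) x e' e‖ ≤ ‖fderiv ℝ (fderiv ℝ f) x e'‖ * ‖e‖ := ContinuousLinearMap.le_opNorm _ _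
    _ ≤ (‖fderiv ℝ (fderiv ℝ f) x‖ * ‖e'‖) * ‖e‖ := by gcongr; exact ContinuousLinearMap.le_opNorm _ _
    _ ≤ (A * ‖e'‖) * ‖e‖ := by gcongr; exact h2'.trans b2
    _ = _ := by ring

end asm1

section asm2
variable {N : ℕ} {u v w f g h r t : Eu N → ℝ} {e e' x p x0 : Eu N} {Ω K : Set (Eu N)}

lemma evw_ball {s : Set (Eu N)} {P : Eu N → Prop} (h : ∀ᶠ y in 𝓝[s] x, P y) :
    ∃ δ > 0, ∀ y, y ∈ Metric.ball x δ → y ∈ s → P y := by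
  rw [eventually_nhdsWithin_iff, Metric.eventually_nhds_iff_ball] at h
  obtain ⟨δ, h1, h2⟩ := h
  exact ⟨δ, h1, fun y hy hs => h2 y hy hs⟩

lemma seg_lip {F : Type*} [NormedAddCommGroup F] [NormedSpace ℝ F] {g : Eu N → F} {B : ℝ} {y v : Eu N}
    (hg : ∀ y ∈ Ω, DifferentiableAt ℝ g y ∧ ‖fderiv ℝ g y‖ ≤ B)
    (hs : ∀ τ ∈ Icc (0:ℝ) 1, y + τ • v ∈ Ω) : ‖g (y + v) - g y‖ ≤ B * ‖v‖ := by
  have := norm_image_sub_le_of_norm_deriv_le_segment_01' (f := fun τ : ℝ => g (y + τ • v))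
    (f' := fun τ => fderiv ℝ g (y + τ • v) v) (C := B * ‖v‖) (fun τ hτ => by
      have h1 : HasDerivAt (fun s : ℝ => y + s • v) v τ := by
        simpa using ((hasDerivAt_id τ).smul_const v).const_add y
      exact ((hg _ (hs τ hτ)).1.hasFDerivAt.comp_hasDerivAt τ h1).hasDerivWithinAt) (fun τ hτ => by
      refine ((fderiv ℝ g (y + τ • v)).le_opNorm v).trans ?_
      gcongr
      exact (hg _ (hs τ ⟨hτ.1, hτ.2.le⟩)).2)
  simpa using this

lemma path_lip {F : Type*} [NormedAddCommGroup F] [NormedSpace ℝ F] {A c : ℝ} (h : US Ω u A c) {L : Eu N →L[ℝ] ℝ}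
    (hL : Tendsto (fderiv ℝ u) (𝓝[Ω] x) (𝓝 L)) (hL0 : L ≠ 0) :
    ∃ C δ, 0 ≤ C ∧ 0 < δ ∧ ∀ (g : Eu N → F) (B : ℝ), (∀ y ∈ Ω, DifferentiableAt ℝ g y ∧ ‖fderiv ℝ g y‖ ≤ B) →
      ∀ y ∈ Ω ∩ Metric.ball x δ, ∀ z ∈ Ω ∩ Metric.ball x δ, ‖g y - g z‖ ≤ C * B * ‖y - z‖ := by
  have hA := h.A1
  obtain ⟨ν, hν1, hν⟩ : ∃ ν, ‖ν‖ = 1 ∧ 0 < L ν := by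
    have : ∃ a, L a ≠ 0 := by
      by_contra! hc
      exact hL0 (ContinuousLinearMap.ext hc)
    obtain ⟨a, ha⟩ := this
    have hane : a ≠ 0 := by rintro rfl; simp at ha
    have han : 0 < ‖a‖ := norm_pos_iff.2 hane
    refine ⟨(SignType.sign (L a) * ‖a‖⁻¹ : ℝ) • a, ?_, ?_⟩
    · rw [norm_smul, norm_mul, norm_inv, norm_norm]
      rcases lt_or_gt_of_ne ha with h1 | h1
      · simp [h1, han.ne']
      · simp [h1, han.ne']
    · rw [map_smul, smul_eq_mul]
      have : (SignType.sign (L a) : ℝ) * L a = |L a| := by simp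
      have e : (SignType.sign (L a) * ‖a‖⁻¹ : ℝ) * L a = ‖a‖⁻¹ * |L a| := by rw [← this]; ring
      rw [e]; have := abs_pos.2 ha; positivity
  set m := L ν / 2 with hm
  have hm0 : 0 < m := by positivity
  have hev : ∀ᶠ y in 𝓝[Ω] x, m ≤ dd u ν y := by
    have : Tendsto (fun y => fderiv ℝ u y ν) (𝓝[Ω] x) (𝓝 (L ν)) :=
      ((ContinuousLinearMap.apply ℝ ℝ ν).continuous.tendsto L).comp hL
    exact this.eventually_const_le (by linarith)
  obtain ⟨δ0, hδ0, hδ⟩ := evw_ball hev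
  refine ⟨24 * A / m + 1, min δ0 (min (1/4) (m ^ 2 / (24 * A ^ 2))), by positivity, by positivity, ?_⟩
  intro g B hg y hy z hz
  by_cases hyz : y = z
  · subst hyz; simp
  have hr : 0 < ‖y - z‖ := norm_pos_iff.2 (sub_ne_zero.2 hyz)
  set R := ‖y - z‖ with hR
  have hRd : R < 2 * min δ0 (min (1/4) (m ^ 2 / (24 * A ^ 2))) := by
    have h1 := Metric.mem_ball.1 hy.2
    have h2 := Metric.mem_ball.1 hz.2
    have := dist_triangle_right y z x
    rw [hR, ← dist_eq_norm]; linarith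
  have hR1 : 2 * R < 1 := by
    have : min δ0 (min (1/4) (m ^ 2 / (24 * A ^ 2))) ≤ 1/4 := (min_le_right _ _).trans (min_le_left _ _)
    linarith
  have hR2 : 2 * R * (6 * A ^ 2) < m ^ 2 := by
    have : min δ0 (min (1/4) (m ^ 2 / (24 * A ^ 2))) ≤ m ^ 2 / (24 * A ^ 2) := (min_le_right _ _).trans (min_le_right _ _)
    have h3 : R < 2 * (m ^ 2 / (24 * A ^ 2)) := by linarith
    have h4 : 2 * (m ^ 2 / (24 * A ^ 2)) * (12 * A ^ 2) = m ^ 2 := by field_simp; norm_num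
    nlinarith [sq_pos_of_pos (by linarith : 0 < A)]
  set s := 12 * A * R / m with hs
  have hs0 : 0 < s := by positivity
  have hsm : s * m = 12 * A * R := by rw [hs]; field_simp
  have hsA : A * s ≤ m := by
    have : A * s * m ≤ m * m := by
      have : A * s * m = A * (s * m) := by ring
      rw [this, hsm]; nlinarith
    exact le_of_mul_le_mul_right this hm0
  have up : ∀ q ∈ Ω ∩ Metric.ball x (min δ0 (min (1/4) (m ^ 2 / (24 * A ^ 2)))),
      (∀ τ ∈ Icc (0:ℝ) 1, q + τ • (s • ν) ∈ Ω) ∧ s * m / 2 ≤ u (q + s • ν) := by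
    intro q hq
    have hqm : m ≤ dd u ν q := hδ q (Metric.ball_subset_ball (min_le_left _ _) hq.2) hq.1
    have hu := h.pos q hq.1
    have hseg := seg_in h hq.1 (v := s • ν) (fun τ hτ => by
      rw [dd_smul_arg, norm_smul, hν1, norm_of_nonneg hs0.le, mul_one]
      have h1 : s * m ≤ s * dd u ν q := mul_le_mul_of_nonneg_left hqm hs0.le
      have h2 : τ * (s * m) ≤ τ * (s * dd u ν q) := mul_le_mul_of_nonneg_left h1 hτ.1
      have h3 : A * s ^ 2 * τ ^ 2 ≤ τ * (s * m) := by
        have e : A * s ^ 2 * τ ^ 2 = (τ * s) * (A * s) * τ := by ring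
        rw [e]
        calc (τ * s) * (A * s) * τ ≤ (τ * s) * m * 1 := by
              gcongr
              · exact hτ.1
              · exact mul_nonneg (mul_nonneg hτ.1 hs0.le) hm0.le
              · exact mul_nonneg hτ.1 hs0.le
              · exact hτ.2
          _ = τ * (s * m) := by ring
      have h4 : 0 ≤ τ * (s * m) := mul_nonneg hτ.1 (by positivity)
      linarith)
    refine ⟨hseg, ?_⟩
    have := taylor_abs (f := u) (x := q) (v := s • ν) (K := A * ‖s • ν‖ ^ 2) zero_le_one
      (fun s hs => c32 (h.cd _ (hseg s hs)))
      (fun τ hτ => by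
        have := h.b2 _ (hseg τ hτ) (s • ν) (s • ν)
        linarith)
    rw [one_smul, dd_smul_arg, norm_smul, hν1, norm_of_nonneg hs0.le, mul_one] at this
    have h5 := (abs_le.1 this).1
    have h1 : s * m ≤ s * dd u ν q := mul_le_mul_of_nonneg_left hqm hs0.le
    have h6 : A * s ^ 2 ≤ s * m := by nlinarith
    linarith
  obtain ⟨y1, y2⟩ := up y hy
  obtain ⟨z1, z2⟩ := up z hz
  have hyq : y + s • ν ∈ Ω := by simpa using y1 1 (by simp)
  have hball := ball_in h hyq (d := 2 * R) (h.b1 _ hyq) (by linarith) (by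
    have : A * R * (2 * R) ≤ A * R * 1 := mul_le_mul_of_nonneg_left hR1.le (by positivity)
    rw [hsm] at y2
    nlinarith)
  have mid : ∀ τ ∈ Icc (0:ℝ) 1, (y + s • ν) + τ • (z - y) ∈ Ω := by
    intro τ hτ
    refine (hball _ ?_).1
    rw [mem_ball_iff_norm, add_sub_cancel_left, norm_smul, norm_of_nonneg hτ.1, norm_sub_rev, ← hR]
    nlinarith [hτ.2]
  have m1 := seg_lip hg y1
  have m2 := seg_lip hg mid
  have m3 := seg_lip hg z1
  have e : y + s • ν + (z - y) = z + s • ν := by abel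
  rw [e, norm_sub_rev z y, ← hR] at m2
  rw [norm_smul, hν1, norm_of_nonneg hs0.le, mul_one] at m1 m3
  have hsR : s = 12 * A / m * R := by rw [hs]; ring
  have tri : ‖g y - g z‖ ≤ ‖g (y + s • ν) - g y‖ + ‖g (z + s • ν) - g (y + s • ν)‖ + ‖g (z + s • ν) - g z‖ := by
    have e : g y - g z = -(g (y + s • ν) - g y) - (g (z + s • ν) - g (y + s • ν)) + (g (z + s • ν) - g z) := by abel
    rw [e]
    refine (norm_add_le _ _).trans (add_le_add_left ((norm_sub_le _ _).trans ?_) _)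
    rw [norm_neg]
  calc ‖g y - g z‖ ≤ B * s + B * R + B * s := by linarith
    _ = (24 * A / m + 1) * B * R := by rw [hsR]; ring

/-- critical boundary points -/
lemma crit_lip {A c : ℝ} (h : US Ω u A c) (hu : CC2 Ω u) (hx : x ∈ frontier Ω) (h0 : G1 Ω u x = 0) :
    ∃ C δ, 0 ≤ C ∧ 0 < δ ∧ ∀ (w : Eu N → ℝ) (ε : ℝ), 0 < ε → (∀ x ∈ Ω, ContDiffAt ℝ 2 w x) →
      (∀ x ∈ Ω, |w x| ≤ ε * u x) → (∀ x ∈ Ω, |lap w x| ≤ ε) →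
      ∀ y ∈ Ω ∩ Metric.ball x δ, ‖fderiv ℝ w y‖ ≤ C * ε * ‖y - x‖ := by
  have hA := h.A1
  rw [h.op.frontier_eq] at hx
  obtain ⟨K0, hK0⟩ := (hu.d2 x hx.1).isBigO_sub.bound
  obtain ⟨δ, hδ, hK0⟩ := evw_ball hK0
  set K := max K0 1 with hK
  have hK1 : 1 ≤ K := le_max_right _ _
  refine ⟨N * (2 * N * (4 * K + 2 * A) + (2 * K + A)), δ, by positivity, hδ, fun w ε hε hcd hb0 hl0 y hy => ?_⟩
  set R := ‖y - x‖ with hR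
  have hxy : y ≠ x := by rintro rfl; exact hx.2 hy.1
  have hR0 : 0 < R := norm_pos_iff.2 (sub_ne_zero.2 hxy)
  have hρ : ∀ e, |dd u e y| ≤ (K * R) * ‖e‖ := by
    intro e
    apply abs_dd_le
    have := hK0 y hy.2 (subset_closure hy.1)
    rw [h0, sub_zero, hu.e1 y hy.1] at this
    refine this.trans ?_
    gcongr; exact le_max_left _ _
  have huy := h.pos y hy.1
  have hub : u y ≤ (2 * K + A) * R ^ 2 := by
    by_contra! hlt
    have : ∀ᶠ d in 𝓝[>] R, 2 * (K * R) * d + A * d ^ 2 < u y := by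
      have hc : Continuous fun d : ℝ => 2 * (K * R) * d + A * d ^ 2 := by fun_prop
      exact ((hc.tendsto R).eventually_lt_const (by nlinarith)).filter_mono nhdsWithin_le_nhds
    obtain ⟨d, hd, hdR⟩ := (this.and self_mem_nhdsWithin).exists
    exact hx.2 (ball_in h hy.1 hρ (by positivity) (d := d) (by linarith) x (by
      rw [mem_ball_iff_norm, norm_sub_rev]; exact hdR)).1
  set k := 4 * K + 2 * A with hk
  have hk0 : 0 < k := by positivity
  set d := u y / (k * R) with hd
  have hd0 : 0 < d := by positivity
  have hdk : d * (k * R) = u y := by rw [hd]; field_simp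
  have hdR : d ≤ R := by
    have h1 : d * (k * R) ≤ R * (k * R) := by
      rw [hdk]; nlinarith [sq_pos_of_pos hR0]
    exact le_of_mul_le_mul_right h1 (by positivity)
  have hi : ∀ i, |dd w (bs i) y| ≤ (2 * N * k + (2 * K + A)) * ε * R := by
    intro i
    have := gradw0 (d := d) h hcd hb0 hl0 hε hy.1 hρ (by positivity) hd0 (by
      rw [← hdk, hk]
      have h1 : d * d ≤ d * R := mul_le_mul_of_nonneg_left hdR hd0.le
      have h2 : A * (d * d) ≤ A * (d * R) := mul_le_mul_of_nonneg_left h1 (by linarith)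
      nlinarith [mul_pos hd0 hR0]) i
    refine this.trans ?_
    have e1 : (N:ℝ) * (ε * (2 * u y)) / d = 2 * N * k * ε * R := by
      rw [← hdk]; field_simp
    rw [e1]
    have : ε * d / 2 ≤ (2 * K + A) * ε * R := by
      have : ε * d ≤ ε * R := mul_le_mul_of_nonneg_left hdR hε.le
      have h3 : 1 * (ε * R) ≤ (2 * K + A) * (ε * R) := mul_le_mul_of_nonneg_right (by linarith) (by positivity)
      nlinarith [mul_pos hε hR0]
    linarith
  refine (norm_fderiv_le hi).trans (le_of_eq (by ring))

end asm2

section asm3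
variable {N : ℕ} {u v w f g h r t : Eu N → ℝ} {e e' x p x0 : Eu N} {Ω K : Set (Eu N)}

lemma mem_cl {δ : ℝ} {y : Eu N} (hy : y ∈ closure Ω ∩ Metric.ball x δ) : y ∈ closure (Ω ∩ Metric.ball x δ) := by
  rw [inter_comm]
  exact Metric.isOpen_ball.inter_closure ⟨hy.2, hy.1⟩

lemma G_lip {A c : ℝ} (h : US Ω u A c) (hu : CC2 Ω u) (hu0 : ∀ x ∈ frontier Ω, u x = 0) (hx : x ∈ closure Ω) :
    ∃ C δ, 0 ≤ C ∧ 0 < δ ∧ ∀ (w : Eu N → ℝ) (ε : ℝ), 0 < ε → CC2 Ω w → (∀ x ∈ Ω, ContDiffAt ℝ 2 w x) →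
      (∀ x ∈ Ω, |w x| ≤ ε * u x) → (∀ x ∈ Ω, |lap w x| ≤ ε) → (∀ x ∈ Ω, ‖fderiv ℝ w x‖ ≤ ε) →
      (∀ x ∈ Ω, ‖fderiv ℝ (fderiv ℝ w) x‖ ≤ ε) → (∀ x ∈ frontier Ω, w x = 0) →
      ∀ y ∈ closure Ω ∩ Metric.ball x δ, |w y - w x| ≤ C * ε * ‖y - x‖ ∧
        ‖G1 Ω w y - G1 Ω w x‖ ≤ C * ε * ‖y - x‖ := by
  suffices hs : ∃ C δ, 0 ≤ C ∧ 0 < δ ∧ ∀ (w : Eu N → ℝ) (ε : ℝ), 0 < ε → CC2 Ω w → (∀ x ∈ Ω, ContDiffAt ℝ 2 w x) →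
      (∀ x ∈ Ω, |w x| ≤ ε * u x) → (∀ x ∈ Ω, |lap w x| ≤ ε) → (∀ x ∈ Ω, ‖fderiv ℝ w x‖ ≤ ε) →
      (∀ x ∈ Ω, ‖fderiv ℝ (fderiv ℝ w) x‖ ≤ ε) → (∀ x ∈ frontier Ω, w x = 0) →
      ∀ y ∈ Ω ∩ Metric.ball x δ, |w y - w x| ≤ C * ε * ‖y - x‖ ∧
        ‖G1 Ω w y - G1 Ω w x‖ ≤ C * ε * ‖y - x‖ by
    obtain ⟨C, δ, hC, hδ, H⟩ := hs
    refine ⟨C, δ, hC, hδ, fun w ε hε hw h1 h2 h3 h4 h5 h6 y hy => ?_⟩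
    have H' := H w ε hε hw h1 h2 h3 h4 h5 h6
    have hm : Ω ∩ Metric.ball x δ ⊆ closure Ω := fun z hz => subset_closure hz.1
    have hr : ContinuousWithinAt (fun y => C * ε * ‖y - x‖) (Ω ∩ Metric.ball x δ) y := by
      apply Continuous.continuousWithinAt; fun_prop
    constructor
    · exact ContinuousWithinAt.closure_le (mem_cl hy)
        ((((hw.c0 y hy.1).mono hm).sub continuousWithinAt_const).abs) hr (fun z hz => (H' z hz).1)
    · exact ContinuousWithinAt.closure_le (mem_cl hy)
        ((((hw.c1 y hy.1).mono hm).sub continuousWithinAt_const).norm) hr (fun z hz => (H' z hz).2)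
  by_cases hxΩ : x ∈ Ω
  · obtain ⟨δ, hδ, hb⟩ := Metric.isOpen_iff.1 h.op x hxΩ
    refine ⟨1, δ, zero_le_one, hδ, fun w ε hε hw h1 h2 h3 h4 h5 h6 y hy => ?_⟩
    have hseg : ∀ τ ∈ Icc (0:ℝ) 1, x + τ • (y - x) ∈ Ω := fun τ hτ => hb (by
      have := mem_ball_iff_norm.1 hy.2
      rw [mem_ball_iff_norm, add_sub_cancel_left, norm_smul, norm_of_nonneg hτ.1]
      nlinarith [hτ.2, norm_nonneg (y - x)])
    have m1 := seg_lip (g := w) (fun z hz => ⟨(h1 z hz).differentiableAt (by norm_num), h4 z hz⟩) hseg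
    have m2 := seg_lip (g := fderiv ℝ w) (fun z hz =>
      ⟨((h1 z hz).fderiv_right (m := 1) (by norm_num)).differentiableAt (by norm_num), h5 z hz⟩) hseg
    rw [add_sub_cancel] at m1 m2
    rw [one_mul, hw.e1 y hy.1, hw.e1 x hxΩ]
    exact ⟨m1, m2⟩
  have hxf : x ∈ frontier Ω := by rw [h.op.frontier_eq]; exact ⟨hx, hxΩ⟩
  obtain ⟨K0, hK0⟩ := (hu.d1 x hx).isBigO_sub.bound
  obtain ⟨δ0, hδ0, hK0⟩ := evw_ball hK0
  have val : ∀ (w : Eu N → ℝ) (ε : ℝ), 0 < ε → (∀ x ∈ Ω, |w x| ≤ ε * u x) → (∀ x ∈ frontier Ω, w x = 0) →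
      ∀ y ∈ Ω ∩ Metric.ball x δ0, |w y - w x| ≤ max K0 0 * ε * ‖y - x‖ := by
    intro w ε hε h1 h2 y hy
    rw [h2 x hxf, sub_zero]
    have := hK0 y hy.2 (subset_closure hy.1)
    rw [hu0 x hxf, sub_zero, norm_of_nonneg (h.pos y hy.1).le] at this
    refine (h1 y hy.1).trans ?_
    calc ε * u y ≤ ε * (max K0 0 * ‖y - x‖) := by
          exact mul_le_mul_of_nonneg_left (this.trans (mul_le_mul_of_nonneg_right (le_max_left _ _) (norm_nonneg _))) hε.le
      _ = _ := by ring
  suffices hs : ∃ C δ, 0 ≤ C ∧ 0 < δ ∧ ∀ (w : Eu N → ℝ) (ε : ℝ), 0 < ε → CC2 Ω w → (∀ x ∈ Ω, ContDiffAt ℝ 2 w x) →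
      (∀ x ∈ Ω, |w x| ≤ ε * u x) → (∀ x ∈ Ω, |lap w x| ≤ ε) →
      (∀ x ∈ Ω, ‖fderiv ℝ (fderiv ℝ w) x‖ ≤ ε) →
      ∀ y ∈ Ω ∩ Metric.ball x δ, ‖G1 Ω w y - G1 Ω w x‖ ≤ C * ε * ‖y - x‖ by
    obtain ⟨C, δ, hC, hδ, H⟩ := hs
    refine ⟨max C (max K0 0), min δ δ0, by positivity, by positivity, fun w ε hε hw h1 h2 h3 h4 h5 h6 y hy => ⟨?_, ?_⟩⟩
    · refine (val w ε hε h2 h6 y ⟨hy.1, Metric.ball_subset_ball (min_le_right _ _) hy.2⟩).trans ?_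
      exact mul_le_mul_of_nonneg_right (mul_le_mul_of_nonneg_right (le_max_right _ _) hε.le) (norm_nonneg _)
    · refine (H w ε hε hw h1 h2 h3 h5 y ⟨hy.1, Metric.ball_subset_ball (min_le_left _ _) hy.2⟩).trans ?_
      gcongr; exact le_max_left _ _
  by_cases hL : G1 Ω u x = 0
  · obtain ⟨C, δ, hC, hδ, H⟩ := crit_lip h hu hxf hL
    refine ⟨C, δ, hC, hδ, fun w ε hε hw h1 h2 h3 h5 y hy => ?_⟩
    have H' := H w ε hε h1 h2 h3
    have hm : Ω ∩ Metric.ball x δ ⊆ closure Ω := fun z hz => subset_closure hz.1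
    have hz : G1 Ω w x = 0 := by
      have := ContinuousWithinAt.closure_le (f := fun z => ‖G1 Ω w z‖) (g := fun z => C * ε * ‖z - x‖)
        (mem_cl ⟨hx, Metric.mem_ball_self hδ⟩) (((hw.c1 x hx).mono hm).norm)
        (by apply Continuous.continuousWithinAt; fun_prop) (fun z hz => by
          show ‖G1 Ω w z‖ ≤ _
          rw [hw.e1 z hz.1]; exact H' z hz)
      simpa using this
    rw [hz, sub_zero, hw.e1 y hy.1]
    exact H' y hy
  · obtain ⟨C, δ, hC, hδ, H⟩ := path_lip (F := Eu N →L[ℝ] ℝ) (x := x) (L := G1 Ω u x) h (by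
      refine ((hu.c1 x hx).mono subset_closure : Tendsto _ _ _).congr' ?_
      filter_upwards [self_mem_nhdsWithin] with y hy using hu.e1 y hy) hL
    refine ⟨C, δ, hC, hδ, fun w ε hε hw h1 h2 h3 h5 y hy => ?_⟩
    have H' := H (fderiv ℝ w) ε (fun z hz =>
      ⟨((h1 z hz).fderiv_right (m := 1) (by norm_num)).differentiableAt (by norm_num), h5 z hz⟩) y hy
    have hm : Ω ∩ Metric.ball x δ ⊆ closure Ω := fun z hz => subset_closure hz.1
    exact ContinuousWithinAt.closure_le (f := fun z => ‖G1 Ω w y - G1 Ω w z‖) (g := fun z => C * ε * ‖y - z‖)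
        (mem_cl ⟨hx, Metric.mem_ball_self hδ⟩) ((continuousWithinAt_const.sub ((hw.c1 x hx).mono hm)).norm)
        (by apply Continuous.continuousWithinAt; fun_prop) (fun z hz => by
          show ‖G1 Ω w y - G1 Ω w z‖ ≤ _
          rw [hw.e1 z hz.1, hw.e1 y hy.1]; exact H' z hz)

lemma lim_fd {F : Type*} [NormedAddCommGroup F] [NormedSpace ℝ F] {f : Eu N → F} {fk : ℕ → Eu N → F}
    {Lk : ℕ → Eu N →L[ℝ] F} {L : Eu N →L[ℝ] F} {s : Set (Eu N)}
    (hk : ∀ k, HasFDerivWithinAt (fk k) (Lk k) s x) (hL : Tendsto Lk atTop (𝓝 L))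
    (hη : ∀ η > 0, ∃ K, ∀ k ≥ K, ∀ᶠ y in 𝓝[s] x, ‖(f y - fk k y) - (f x - fk k x)‖ ≤ η * ‖y - x‖) :
    HasFDerivWithinAt f L s x := by
  rw [hasFDerivWithinAt_iff_isLittleO, Asymptotics.isLittleO_iff]
  intro η hη0
  obtain ⟨K, hK⟩ := hη (η / 3) (by positivity)
  obtain ⟨k, hkK, hkL⟩ := ((eventually_ge_atTop K).and (hL.eventually (Metric.ball_mem_nhds L (by positivity : 0 < η / 3)))).exists
  have h3 := hk k
  rw [hasFDerivWithinAt_iff_isLittleO, Asymptotics.isLittleO_iff] at h3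
  filter_upwards [hK k hkK, h3 (by positivity : 0 < η / 3)] with y h1 h2
  have h4 : ‖(Lk k - L) (y - x)‖ ≤ η / 3 * ‖y - x‖ := by
    refine (ContinuousLinearMap.le_opNorm _ _).trans ?_
    gcongr
    rw [← dist_eq_norm]; exact (Metric.mem_ball.1 hkL).le
  have e : f y - f x - L (y - x) = ((f y - fk k y) - (f x - fk k x)) + (fk k y - fk k x - Lk k (y - x)) + (Lk k - L) (y - x) := by
    rw [_root_.sub_apply]; abel
  rw [e]
  refine norm_add₃_le.trans ?_
  linarith

lemma hess_norm {B : ℝ} (hf : ContDiffAt ℝ 2 f x) (h : ∀ i j, |dd (dd f (bs i)) (bs j) x| ≤ B) :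
    ‖fderiv ℝ (fderiv ℝ f) x‖ ≤ N * (N * B) := by
  have h1 : ∀ i, ‖fderiv ℝ (dd f (bs i)) x‖ ≤ N * B := fun i => norm_fderiv_le (h i)
  rcases Nat.eq_zero_or_pos N with h0 | h0
  · subst h0
    have : fderiv ℝ (fderiv ℝ f) x = 0 := by
      ext a b; rw [Subsingleton.elim a 0]; simp
    rw [this]; simp
  have hB : 0 ≤ B := (abs_nonneg _).trans (h ⟨0, h0⟩ ⟨0, h0⟩)
  refine ContinuousLinearMap.opNorm_le_bound _ (by positivity) fun v => ?_
  have h2 := norm_fderiv_le (u := fun z => fderiv ℝ (fderiv ℝ f) x v z) (x := (0 : Eu N)) (B := N * B * ‖v‖) (fun i => by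
    have e : dd (fun z => fderiv ℝ (fderiv ℝ f) x v z) (bs i) (0 : Eu N) = fderiv ℝ (fderiv ℝ f) x v (bs i) := by
      unfold dd
      rw [ContinuousLinearMap.fderiv]
    rw [e, ← dd_fderiv2 hf]
    exact abs_dd_le (h1 i))
  rw [ContinuousLinearMap.fderiv] at h2
  refine h2.trans (le_of_eq (by ring))
end asm3

section asm4
variable {N : ℕ} {u v w f g h r t : Eu N → ℝ} {e e' x p x0 : Eu N} {Ω K : Set (Eu N)}

lemma cdat (hΩ : IsOpen Ω) (hf : ContDiffOn ℝ 2 f (closure Ω)) (hx : x ∈ Ω) : ContDiffAt ℝ 2 f x :=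
  hf.contDiffAt (mem_of_superset (hΩ.mem_nhds hx) subset_closure)

lemma csub {F : Type*} [NormedAddCommGroup F] {f g : Eu N → F} {s : Set (Eu N)} (hf : ContinuousOn f s)
    (hg : ContinuousOn g s) : ContinuousOn (fun x => f x - g x) s := hf.sub hg

lemma G_sub (hΩ : IsOpen Ω) (hf : ContDiffOn ℝ 2 f (closure Ω)) (hg : ContDiffOn ℝ 2 g (closure Ω)) :
    ∀ x ∈ closure Ω, G1 Ω (fun y => f y - g y) x = G1 Ω f x - G1 Ω g x ∧
      G2 Ω (fun y => f y - g y) x = G2 Ω f x - G2 Ω g x := by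
  have h1 := c2c hΩ hf
  have h2 := c2c hΩ hg
  have h3 := c2c hΩ (hf.sub hg)
  have s1 : ∀ x ∈ Ω, fderiv ℝ (fun y => f y - g y) x = fderiv ℝ f x - fderiv ℝ g x := fun x hx =>
    fderiv_fun_sub ((cdat hΩ hf hx).differentiableAt (by norm_num)) ((cdat hΩ hg hx).differentiableAt (by norm_num))
  have dfd : ∀ {f : Eu N → ℝ} {x}, ContDiffAt ℝ 2 f x → DifferentiableAt ℝ (fderiv ℝ f) x := fun h =>
    (h.fderiv_right (m := 1) (by norm_num)).differentiableAt (by norm_num)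
  have s2 : ∀ x ∈ Ω, fderiv ℝ (fderiv ℝ (fun y => f y - g y)) x = fderiv ℝ (fderiv ℝ f) x - fderiv ℝ (fderiv ℝ g) x := by
    intro x hx
    have : fderiv ℝ (fun y => f y - g y) =ᶠ[𝓝 x] fun z => fderiv ℝ f z - fderiv ℝ g z := by
      filter_upwards [hΩ.mem_nhds hx] with z hz using s1 z hz
    rw [this.fderiv_eq]
    exact fderiv_fun_sub (dfd (cdat hΩ hf hx)) (dfd (cdat hΩ hg hx))
  intro x hx
  constructor
  · exact Set.EqOn.of_subset_closure (s := Ω) (t := closure Ω) (f := G1 Ω (fun y => f y - g y))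
      (g := fun x => G1 Ω f x - G1 Ω g x)
      (fun z hz => by show _ = G1 Ω f z - G1 Ω g z; rw [h1.e1 z hz, h2.e1 z hz, ← s1 z hz]; exact h3.e1 z hz)
      h3.c1 (h1.c1.sub h2.c1) subset_closure le_rfl hx
  · exact Set.EqOn.of_subset_closure (s := Ω) (t := closure Ω) (f := G2 Ω (fun y => f y - g y))
      (g := fun x => G2 Ω f x - G2 Ω g x)
      (fun z hz => by show _ = G2 Ω f z - G2 Ω g z; rw [h1.e2 z hz, h2.e2 z hz, ← s2 z hz]; exact h3.e2 z hz)
      h3.c2 (csub (F := Eu N →L[ℝ] Eu N →L[ℝ] ℝ) (f := G2 Ω f) (g := G2 Ω g) h1.c2 h2.c2) subset_closure le_rfl hx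

lemma cauchy_lim {F : Type*} [NormedAddCommGroup F] [CompleteSpace F] {s : Set (Eu N)} {Fk : ℕ → Eu N → F}
    (hc : ∀ k, ContinuousOn (Fk k) s)
    (h : ∀ ε > 0, ∃ K, ∀ k ≥ K, ∀ m ≥ K, ∀ x ∈ s, ‖Fk k x - Fk m x‖ ≤ ε) :
    ∃ G : Eu N → F, ContinuousOn G s ∧ ∀ x ∈ s, Tendsto (fun k => Fk k x) atTop (𝓝 (G x)) := by
  have hcau : UniformCauchySeqOn Fk atTop s := by
    rw [Metric.uniformCauchySeqOn_iff]
    intro ε hε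
    obtain ⟨K, hK⟩ := h (ε / 2) (by positivity)
    refine ⟨K, fun m hm n hn x hx => ?_⟩
    rw [dist_eq_norm]
    linarith [hK m hm n hn x hx]
  have hl : ∀ x, ∃ l, x ∈ s → Tendsto (fun k => Fk k x) atTop (𝓝 l) := by
    intro x
    by_cases hx : x ∈ s
    · obtain ⟨l, hl⟩ := cauchySeq_tendsto_of_complete (hcau.cauchySeq hx)
      exact ⟨l, fun _ => hl⟩
    · exact ⟨0, fun h => absurd h hx⟩
  choose G hG using hl
  refine ⟨G, ?_, hG⟩
  exact (hcau.tendstoUniformlyOn_of_tendsto hG).continuousOn (Frequently.of_forall hc)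

lemma cd2_of {G : Eu N → Eu N →L[ℝ] ℝ} {T : Eu N → Eu N →L[ℝ] Eu N →L[ℝ] ℝ} {s : Set (Eu N)}
    (h1 : ∀ x ∈ s, HasFDerivWithinAt f (G x) s x) (h2 : ∀ x ∈ s, HasFDerivWithinAt G (T x) s x)
    (h3 : ContinuousOn T s) : ContDiffOn ℝ 2 f s := by
  intro x hx
  have e2 : (2 : WithTop ℕ∞) = 1 + 1 := by norm_num
  have e1 : (1 : WithTop ℕ∞) = 0 + 1 := by norm_num
  rw [e2, contDiffWithinAt_succ_iff_hasFDerivWithinAt (by norm_num)]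
  refine ⟨s, by rw [insert_eq_of_mem hx]; exact self_mem_nhdsWithin, by simp, G, h1, ?_⟩
  rw [e1, contDiffWithinAt_succ_iff_hasFDerivWithinAt (by norm_num)]
  refine ⟨s, by rw [insert_eq_of_mem hx]; exact self_mem_nhdsWithin, by simp, T, h2, ?_⟩
  exact (contDiffOn_zero (f := T).2 h3) x hx

lemma L_final {A c : ℝ} {a : ℕ → Eu N → ℝ} (hN : (1:ℝ) ≤ N) (h : US Ω u A c) (hu : ContDiffOn ℝ 2 u (closure Ω))
    (hu0 : ∀ x ∈ frontier Ω, u x = 0) (ha : ∀ k, ContDiffOn ℝ 2 (a k) (closure Ω))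
    (ha0 : ∀ k, ∀ x ∈ frontier Ω, a k x = 0)
    (hW : ∀ ε > 0, ∃ K, ∀ k ≥ K, ∀ m ≥ K, WS Ω u (fun y => a k y - a m y) ε)
    (hf : ∀ x ∈ closure Ω, Tendsto (fun k => a k x) atTop (𝓝 (f x))) :
    ContDiffOn ℝ 2 f (closure Ω) ∧ ∀ x ∈ Ω, Tendsto (fun k => lap (a k) x) atTop (𝓝 (lap f x)) := by
  have hΩ := h.op
  obtain ⟨C0, hC0, hD⟩ := thmD hN h.A1 h.c0
  have hA := h.A1
  set C := 1 + N * ((8 * N * A ^ 2 + 1)) + N * (N * C0) with hC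
  have hC1 : 1 ≤ C := by
    have : 0 ≤ N * ((8 * N * A ^ 2 + 1)) + N * (N * C0) := by positivity
    linarith
  have hcc := fun k => c2c hΩ (ha k)
  have hccd := fun k m => c2c hΩ ((ha k).sub (ha m))
  -- bounds for the differences
  have key : ∀ ε > 0, ∃ K, ∀ k ≥ K, ∀ m ≥ K, ∀ x ∈ Ω,
      |a k x - a m x| ≤ ε * u x ∧ |lap (fun y => a k y - a m y) x| ≤ ε ∧
      ‖fderiv ℝ (fun y => a k y - a m y) x‖ ≤ ε ∧ ‖fderiv ℝ (fderiv ℝ (fun y => a k y - a m y)) x‖ ≤ ε := by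
    intro ε hε
    have hε' : 0 < ε / C := by positivity
    have hε1 : ε / C ≤ ε := div_le_self hε.le hC1
    have hεC : C * (ε / C) = ε := by field_simp
    obtain ⟨K, hK⟩ := hW (ε / C) hε'
    refine ⟨K, fun k hk m hm x hx => ?_⟩
    have hw := hK k hk m hm
    obtain ⟨M, hM1, hM⟩ := c2_bdd hΩ h.bd ((ha k).sub (ha m))
    have hd := hD Ω u _ (ε / C) M h hw hε' (fun y hy i j => by
      have := (hM y hy).2.2 (bs i) (bs j)
      rw [bs_norm, bs_norm, mul_one, mul_one] at this
      exact this) x hx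
    refine ⟨(hw.b0 x hx).trans (mul_le_mul_of_nonneg_right hε1 (h.pos x hx).le), (hw.l0 x hx).trans hε1, ?_, ?_⟩
    · refine (norm_fderiv_le (fun i => gradw_glob h hw hε' hx i)).trans ?_
      calc (N:ℝ) * ((8 * N * A ^ 2 + 1) * (ε / C)) = (N * (8 * N * A ^ 2 + 1)) * (ε / C) := by ring
        _ ≤ C * (ε / C) := by
          refine mul_le_mul_of_nonneg_right ?_ hε'.le
          have : 0 ≤ N * (N * C0) := by positivity
          linarith
        _ = _ := hεC
    · refine (hess_norm (c32 (hw.cd x hx)) hd).trans ?_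
      calc (N:ℝ) * (N * (C0 * (ε / C))) = (N * (N * C0)) * (ε / C) := by ring
        _ ≤ C * (ε / C) := by
          refine mul_le_mul_of_nonneg_right ?_ hε'.le
          have : 0 ≤ N * ((8 * N * A ^ 2 + 1)) := by positivity
          linarith
        _ = _ := hεC
  have cau1 : ∀ ε > 0, ∃ K, ∀ k ≥ K, ∀ m ≥ K, ∀ x ∈ closure Ω, ‖G1 Ω (a k) x - G1 Ω (a m) x‖ ≤ ε := by
    intro ε hε
    obtain ⟨K, hK⟩ := key ε hε
    refine ⟨K, fun k hk m hm x hx => ?_⟩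
    rw [← (G_sub hΩ (ha k) (ha m) x hx).1]
    refine ContinuousWithinAt.closure_le (f := fun z => ‖G1 Ω (fun y => a k y - a m y) z‖) (g := fun _ => ε) hx
      (((hccd k m).c1 x hx).mono subset_closure).norm continuousWithinAt_const (fun z hz => ?_)
    have := (hccd k m).e1 z hz
    show ‖G1 Ω (fun y => a k y - a m y) z‖ ≤ ε
    rw [this]
    exact (hK k hk m hm z hz).2.2.1
  have cau2 : ∀ ε > 0, ∃ K, ∀ k ≥ K, ∀ m ≥ K, ∀ x ∈ closure Ω, ‖G2 Ω (a k) x - G2 Ω (a m) x‖ ≤ ε := by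
    intro ε hε
    obtain ⟨K, hK⟩ := key ε hε
    refine ⟨K, fun k hk m hm x hx => ?_⟩
    rw [← (G_sub hΩ (ha k) (ha m) x hx).2]
    refine ContinuousWithinAt.closure_le (f := fun z => ‖G2 Ω (fun y => a k y - a m y) z‖) (g := fun _ => ε) hx
      (ContinuousWithinAt.norm (f := G2 Ω (fun y => a k y - a m y)) (((hccd k m).c2 x hx).mono subset_closure))
      continuousWithinAt_const (fun z hz => ?_)
    have := (hccd k m).e2 z hz
    show ‖G2 Ω (fun y => a k y - a m y) z‖ ≤ ε
    rw [this]
    exact (hK k hk m hm z hz).2.2.2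
  obtain ⟨G, hGc, hG⟩ := cauchy_lim (fun k => (hcc k).c1) cau1
  obtain ⟨T, hTc, hT⟩ := cauchy_lim (F := Eu N →L[ℝ] Eu N →L[ℝ] ℝ) (Fk := fun k => G2 Ω (a k)) (fun k => (hcc k).c2) cau2
  have lip : ∀ x ∈ closure Ω, ∀ η > 0, ∃ K, ∀ k ≥ K, ∀ᶠ y in 𝓝[closure Ω] x,
      ‖(f y - a k y) - (f x - a k x)‖ ≤ η * ‖y - x‖ ∧
      ‖(G y - G1 Ω (a k) y) - (G x - G1 Ω (a k) x)‖ ≤ η * ‖y - x‖ := by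
    intro x hx η hη
    obtain ⟨C', δ, hC', hδ, H⟩ := G_lip h (c2c hΩ hu) hu0 hx
    obtain ⟨K, hK⟩ := key (η / (C' + 1)) (by positivity)
    refine ⟨K, fun k hk => ?_⟩
    have hb : ∀ᶠ y in 𝓝[closure Ω] x, y ∈ Metric.ball x δ := mem_nhdsWithin_of_mem_nhds (Metric.ball_mem_nhds x hδ)
    filter_upwards [hb, self_mem_nhdsWithin] with y hy hyc
    have hCη : C' * (η / (C' + 1)) ≤ η := by
      rw [mul_div_assoc', div_le_iff₀ (by positivity)]; nlinarith
    have hm : ∀ m ≥ K, ‖(a m y - a k y) - (a m x - a k x)‖ ≤ η * ‖y - x‖ ∧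
        ‖(G1 Ω (a m) y - G1 Ω (a k) y) - (G1 Ω (a m) x - G1 Ω (a k) x)‖ ≤ η * ‖y - x‖ := by
      intro m hm
      have hk' := hK m hm k hk
      obtain ⟨q1, q2⟩ := H (fun y => a m y - a k y) (η / (C' + 1)) (by positivity) (hccd m k)
        (fun z hz => (cdat hΩ (ha m) hz).sub (cdat hΩ (ha k) hz)) (fun z hz => (hk' z hz).1)
        (fun z hz => (hk' z hz).2.1) (fun z hz => (hk' z hz).2.2.1) (fun z hz => (hk' z hz).2.2.2)
        (fun z hz => by rw [ha0 m z hz, ha0 k z hz, sub_zero]) y ⟨hyc, hy⟩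
      rw [(G_sub hΩ (ha m) (ha k) y hyc).1, (G_sub hΩ (ha m) (ha k) x hx).1] at q2
      have hn : C' * (η / (C' + 1)) * ‖y - x‖ ≤ η * ‖y - x‖ := mul_le_mul_of_nonneg_right hCη (norm_nonneg _)
      exact ⟨q1.trans hn, q2.trans hn⟩
    constructor
    · refine le_of_tendsto ((((hf y hyc).sub_const _).sub ((hf x hx).sub_const _)).norm) ?_
      filter_upwards [eventually_ge_atTop K] with m hmK using (hm m hmK).1
    · refine le_of_tendsto ((((hG y hyc).sub_const _).sub ((hG x hx).sub_const _)).norm) ?_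
      filter_upwards [eventually_ge_atTop K] with m hmK using (hm m hmK).2
  have D1 : ∀ x ∈ closure Ω, HasFDerivWithinAt f (G x) (closure Ω) x := fun x hx =>
    lim_fd (fun k => (hcc k).d1 x hx) (hG x hx) (fun η hη => by
      obtain ⟨K, hK⟩ := lip x hx η hη
      exact ⟨K, fun k hk => (hK k hk).mono fun y hy => hy.1⟩)
  have D2 : ∀ x ∈ closure Ω, HasFDerivWithinAt G (T x) (closure Ω) x := fun x hx =>
    lim_fd (fun k => (hcc k).d2 x hx) (hT x hx) (fun η hη => by
      obtain ⟨K, hK⟩ := lip x hx η hη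
      exact ⟨K, fun k hk => (hK k hk).mono fun y hy => hy.2⟩)
  have hf2 : ContDiffOn ℝ 2 f (closure Ω) := cd2_of D1 D2 hTc
  refine ⟨hf2, fun x hx => ?_⟩
  have hfd : fderiv ℝ f =ᶠ[𝓝 x] G := by
    filter_upwards [hΩ.mem_nhds hx] with y hy
    exact ((D1 y (subset_closure hy)).hasFDerivAt (mem_of_superset (hΩ.mem_nhds hy) subset_closure)).fderiv
  have hfd2 : fderiv ℝ (fderiv ℝ f) x = T x := by
    rw [hfd.fderiv_eq]
    exact ((D2 x (subset_closure hx)).hasFDerivAt (mem_of_superset (hΩ.mem_nhds hx) subset_closure)).fderiv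
  rw [lap_def]
  simp only [lap_def]
  refine tendsto_finsetSum _ fun i _ => ?_
  rw [dd_fderiv2 (cdat hΩ hf2 hx), hfd2]
  have e : ∀ k, dd (dd (a k) (bs i)) (bs i) x = G2 Ω (a k) x (bs i) (bs i) := fun k => by
    rw [dd_fderiv2 (cdat hΩ (ha k) hx), (hcc k).e2 x hx]
  simp only [e]
  exact ((ContinuousLinearMap.apply ℝ ℝ (bs i)).continuous.tendsto _).comp
    (((ContinuousLinearMap.apply ℝ (Eu N →L[ℝ] ℝ) (bs i)).continuous.tendsto _).comp (hT x (subset_closure hx)))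
end asm4

section asm5
variable {N : ℕ} {u v w f g h r t : Eu N → ℝ} {e e' x p x0 : Eu N} {Ω K : Set (Eu N)}

lemma lap_log (hf : ContDiffAt ℝ 2 f x) (h0 : 0 < f x) :
    ContDiffAt ℝ 2 (fun y => log (f y)) x ∧
    lap (fun y => log (f y)) x + gg (fun y => log (f y)) (fun y => log (f y)) x = lap f x / f x := by
  have hl : ContDiffAt ℝ 2 (fun y => log (f y)) x := hf.log h0.ne'
  refine ⟨hl, ?_⟩
  have e : f =ᶠ[𝓝 x] fun y => exp (log (f y)) := by
    filter_upwards [hf.continuousAt.eventually_const_lt h0] with y hy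
    rw [exp_log hy]
  have h1 := lap_comp (φ := exp) contDiff_exp hl
  rw [← lap_congr e] at h1
  have h2 : deriv (deriv exp) (log (f x)) = exp (log (f x)) := by rw [Real.deriv_exp, Real.deriv_exp]
  rw [h2, Real.deriv_exp, exp_log h0] at h1
  rw [h1]; field_simp

lemma ind_ev (hΩ : IsOpen Ω) (hx : x ∈ Ω) (f : Eu N → ℝ) : indicator Ω f =ᶠ[𝓝 x] f := by
  filter_upwards [hΩ.mem_nhds hx] with y hy using indicator_of_mem hy f

lemma amgm {p q a b : ℝ} (ha : 0 < a) (hb : 0 < b) : 2 * (q * p) ≤ p ^ 2 * b / a + q ^ 2 * a / b := by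
  rw [div_add_div _ _ ha.ne' hb.ne', le_div_iff₀ (by positivity)]
  nlinarith [sq_nonneg (p * b - q * a)]

lemma SS_of {lam mu : ℝ} (hΩ : IsOpen Ω) (hb : Bornology.IsBounded Ω) (hl : 0 < lam) (hm : 0 < mu)
    (h : IsStableGelfandSolution Ω lam mu u v) :
    ∃ r t, SS Ω lam mu (indicator Ω u) (indicator Ω v) r t := by
  obtain ⟨⟨u2, v2, eu, ev, u0, v0⟩, l1, φ, ψ, hl1, hφ, hψ, pφ, pψ, eφ, eψ, -, -⟩ := h
  refine ⟨fun y => log (φ y), fun y => log (ψ y), hΩ, hb, hl, hm, continuous_indicator u0 u2.continuousOn,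
    continuous_indicator v0 v2.continuousOn, fun x hx => indicator_of_notMem hx _,
    fun x hx => indicator_of_notMem hx _, fun x hx => (cdat hΩ u2 hx).congr_of_eventuallyEq (ind_ev hΩ hx u),
    fun x hx => (cdat hΩ v2 hx).congr_of_eventuallyEq (ind_ev hΩ hx v),
    fun x hx => (lap_log (cdat hΩ hφ hx) (pφ x hx)).1, fun x hx => (lap_log (cdat hΩ hψ hx) (pψ x hx)).1,
    fun x hx => ?_, fun x hx => ?_, fun x hx => ?_⟩
  · rw [lap_congr (ind_ev hΩ hx u), indicator_of_mem hx]; exact eu x hx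
  · rw [lap_congr (ind_ev hΩ hx v), indicator_of_mem hx]; exact ev x hx
  · rw [(lap_log (cdat hΩ hφ hx) (pφ x hx)).2, (lap_log (cdat hΩ hψ hx) (pψ x hx)).2, indicator_of_mem hx,
      indicator_of_mem hx]
    have p1 := pφ x hx
    have p2 := pψ x hx
    have e1 := eφ x hx
    have e2 := eψ x hx
    have k := amgm (p := √mu * exp (v x / 2)) (q := √lam * exp (u x / 2)) p1 p2
    have s1 : (√mu * exp (v x / 2)) ^ 2 = mu * exp (v x) := by
      rw [mul_pow, Real.sq_sqrt hm.le, ← Real.exp_nat_mul]; congr 2; push_cast; ring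
    have s2 : (√lam * exp (u x / 2)) ^ 2 = lam * exp (u x) := by
      rw [mul_pow, Real.sq_sqrt hl.le, ← Real.exp_nat_mul]; congr 2; push_cast; ring
    have s3 : √lam * exp (u x / 2) * (√mu * exp (v x / 2)) = √lam * √mu * exp ((u x + v x) / 2) := by
      rw [add_div, Real.exp_add]; ring
    rw [s1, s2, s3] at k
    have t1 : -(lap φ x / φ x) = mu * exp (v x) * ψ x / φ x + l1 := by
      field_simp; linarith
    have t2 : -(lap ψ x / ψ x) = lam * exp (u x) * φ x / ψ x + l1 := by
      field_simp; linarith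
    linarith

lemma bd_lim (hc : ContinuousOn f (closure Ω)) (h0 : ∀ x ∈ frontier Ω, f x = 0) :
    ∀ p ∈ frontier Ω, Tendsto f (𝓝[Ω] p) (𝓝 0) := by
  intro p hp
  have h1 := (hc p (frontier_subset_closure hp)).mono subset_closure
  rw [← h0 p hp]; exact h1

lemma gel_smooth {lam mu : ℝ} (hΩ : IsOpen Ω) (h : IsGelfandSolution Ω lam mu u v) (hx : x ∈ Ω) :
    ContDiffAt ℝ 3 u x ∧ ContDiffAt ℝ 3 v x := by
  obtain ⟨u2, v2, eu, ev, u0, v0⟩ := h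
  have := sys_smooth hΩ (u2.mono subset_closure) (v2.mono subset_closure) eu ev
  have h3 : (3 : WithTop ℕ∞) ≤ ∞ := by
    exact WithTop.coe_le_coe.2 (le_top : (3 : ℕ∞) ≤ ⊤)
  exact ⟨(this.1.contDiffAt (hΩ.mem_nhds hx)).of_le h3, (this.2.contDiffAt (hΩ.mem_nhds hx)).of_le h3⟩

lemma dd_lap {c : ℝ} (hΩ : IsOpen Ω) (hv : ContDiffAt ℝ 2 v x) (hx : x ∈ Ω)
    (eu : ∀ x ∈ Ω, lap u x = -(c * exp (v x))) : dd (lap u) e x = -(c * exp (v x)) * dd v e x := by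
  have h1 : lap u =ᶠ[𝓝 x] fun y => (-c) * exp (v y) := by
    filter_upwards [hΩ.mem_nhds hx] with y hy
    rw [eu y hy]; ring
  have hd : DifferentiableAt ℝ v x := hv.differentiableAt (by norm_num)
  rw [dd_congr h1, dd_cmul (f := fun y => exp (v y)) _ hd.exp, dd_comp (φ := exp) Real.differentiableAt_exp hd, Real.deriv_exp]
  ring

lemma US_of {lam mu : ℝ} (hΩ : IsOpen Ω) (hb : Bornology.IsBounded Ω) (hm : 0 < mu)
    (h : IsGelfandSolution Ω lam mu u v) (hu : ∀ x ∈ Ω, 0 ≤ u x) (hv : ∀ x ∈ Ω, 0 ≤ v x) : ∃ A, US Ω u A mu := by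
  have hs := fun x (hx : x ∈ Ω) => gel_smooth hΩ h hx
  obtain ⟨u2, v2, eu, ev, u0, v0⟩ := h
  obtain ⟨A, hA1, hA⟩ := c2_bdd hΩ hb u2
  obtain ⟨B, hB1, hB⟩ := c2_bdd hΩ hb v2
  have hAm : A ≤ max A (mu * exp B * B) := le_max_left _ _
  refine ⟨max A (mu * exp B * B), hΩ, hb, fun x hx => (hs x hx).1, fun x hx => ?_, hm, fun x hx => ?_, hA1.trans hAm,
    fun x hx => (le_abs_self _).trans ((hA x hx).1.trans hAm), fun x hx e => ((hA x hx).2.1 e).trans (by gcongr),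
    fun x hx e e' => ((hA x hx).2.2 e e').trans (by gcongr), fun x hx e => ?_, bd_lim u2.continuousOn u0⟩
  · refine lt_of_le_of_ne (hu x hx) fun h0 => ?_
    have hcd := cdat hΩ u2 hx
    have hmax : IsLocalMax (fun y => (-1) * u y) x := by
      filter_upwards [hΩ.mem_nhds hx] with y hy
      rw [← h0]; linarith [hu y hy]
    have := lap_nonpos_of_max (f := fun y => (-1) * u y) (contDiffAt_const.mul hcd) hmax
    rw [lap_cmul _ hcd] at this
    have h1 := eu x hx
    have : 0 < mu * exp (v x) := by positivity
    linarith
  · have h1 := eu x hx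
    have : mu * 1 ≤ mu * exp (v x) := mul_le_mul_of_nonneg_left (Real.one_le_exp (hv x hx)) hm.le
    linarith
  · rw [dd_lap (c := mu) hΩ (cdat hΩ v2 hx) hx (fun y hy => by linarith [eu y hy]), abs_mul, abs_neg, abs_of_pos (by positivity)]
    have h1 : exp (v x) ≤ exp B := Real.exp_le_exp.2 ((le_abs_self _).trans (hB x hx).1)
    calc mu * exp (v x) * |dd v e x| ≤ mu * exp B * (B * ‖e‖) := by
          gcongr; exact (hB x hx).2.1 e
      _ = mu * exp B * B * ‖e‖ := by ring
      _ ≤ _ := mul_le_mul_of_nonneg_right (le_max_right _ _) (norm_nonneg _)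
end asm5

section asm6
variable {N : ℕ} {u v w f g h r t : Eu N → ℝ} {e e' x p x0 : Eu N} {Ω K : Set (Eu N)}

lemma exp_lip {a b M : ℝ} (ha : a ≤ M) (hb : b ≤ M) : |exp a - exp b| ≤ exp M * |a - b| := by
  have key : ∀ a b : ℝ, a ≤ M → b ≤ a → |exp a - exp b| ≤ exp M * |a - b| := by
    intro a b ha hba
    have h1 : exp b ≤ exp a := exp_le_exp.2 hba
    rw [abs_of_nonneg (by linarith), abs_of_nonneg (by linarith)]
    have h2 : exp b = exp a * exp (b - a) := by rw [← Real.exp_add]; congr 1; ring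
    have h3 := Real.add_one_le_exp (b - a)
    have h4 : exp a ≤ exp M := exp_le_exp.2 ha
    calc exp a - exp b = exp a * (1 - exp (b - a)) := by rw [h2]; ring
      _ ≤ exp a * (a - b) := mul_le_mul_of_nonneg_left (by linarith) (exp_pos a).le
      _ ≤ exp M * (a - b) := mul_le_mul_of_nonneg_right h4 (by linarith)
  rcases le_total b a with h | h
  · exact key a b ha h
  · rw [abs_sub_comm, abs_sub_comm a b]; exact key b a hb h

noncomputable def DC (N : ℕ) (A c : ℝ) : ℝ := (1 + 2 / c) * (1 + N * (8 * N * A ^ 2 + 1))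

lemma DC_one {A c : ℝ} (hc : 0 < c) : 1 ≤ DC N A c := by
  unfold DC
  have h1 : 1 ≤ 1 + 2 / c := by have : 0 < 2 / c := by positivity
                                linarith
  have h2 : (1:ℝ) ≤ 1 + N * (8 * N * A ^ 2 + 1) := by
    have : (0:ℝ) ≤ N * (8 * N * A ^ 2 + 1) := by positivity
    linarith
  exact one_le_mul_of_one_le_of_one_le h1 h2

lemma D_est {A c κ : ℝ} (h : US Ω u A c) (hcd : ∀ x ∈ Ω, ContDiffAt ℝ 2 w x)
    (hlim : ∀ p ∈ frontier Ω, Tendsto w (𝓝[Ω] p) (𝓝 0)) (hκ : 0 < κ) (hl : ∀ x ∈ Ω, |lap w x| ≤ κ) :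
    ∀ x ∈ Ω, |w x| ≤ DC N A c * κ * u x ∧ ‖fderiv ℝ w x‖ ≤ DC N A c * κ := by
  have hc := h.c0
  have h2c : 0 < 2 / c := by positivity
  set ε := (1 + 2 / c) * κ with hε
  have hε0 : 0 < ε := by positivity
  have hP : (0:ℝ) ≤ N * (8 * N * A ^ 2 + 1) := by positivity
  have hD : DC N A c * κ = (1 + N * (8 * N * A ^ 2 + 1)) * ε := by unfold DC; rw [hε]; ring
  have b0 : ∀ x ∈ Ω, |w x| ≤ ε * u x := fun x hx => (cmpU h hcd hlim hκ hl x hx).trans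
    (mul_le_mul_of_nonneg_right (by rw [hε]; have : 2 * κ / c = 2 / c * κ := by ring
                                    rw [this]; nlinarith) (h.pos x hx).le)
  have l0 : ∀ x ∈ Ω, |lap w x| ≤ ε := fun x hx => (hl x hx).trans (by rw [hε]; nlinarith)
  intro x hx
  rw [hD]
  constructor
  · refine (b0 x hx).trans (mul_le_mul_of_nonneg_right ?_ (h.pos x hx).le)
    nlinarith
  · refine (norm_fderiv_le fun i => gradw0_glob h hcd b0 l0 hε0 hx i).trans ?_
    nlinarith

structure CS (Ω : Set (Eu N)) (lam mu M A c : ℝ) (u0 : Eu N → ℝ) (τ : ℕ → ℝ) (U V : ℕ → Eu N → ℝ) : Prop where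
  us : US Ω u0 A c
  u0c : ContDiffOn ℝ 2 u0 (closure Ω)
  u00 : ∀ x ∈ frontier Ω, u0 x = 0
  τ1 : ∀ k, 1 / 2 ≤ τ k
  τ2 : ∀ k, τ k ≤ 1
  τ3 : Tendsto τ atTop (𝓝 1)
  m0 : 0 < mu
  sol : ∀ k, IsGelfandSolution Ω (τ k * lam) (τ k * mu) (U k) (V k)
  vM : ∀ k, ∀ x ∈ Ω, V k x ≤ M

def Cau (Ω : Set (Eu N)) (V : ℕ → Eu N → ℝ) : Prop :=
  ∀ ε > 0, ∃ K, ∀ k ≥ K, ∀ m ≥ K, ∀ x ∈ Ω, |V k x - V m x| ≤ ε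

def CauG (Ω : Set (Eu N)) (V : ℕ → Eu N → ℝ) : Prop :=
  ∀ ε > 0, ∃ K, ∀ k ≥ K, ∀ m ≥ K, ∀ x ∈ Ω, ∀ e, ‖e‖ ≤ 1 → |dd (V k) e x - dd (V m) e x| ≤ ε

variable {lam mu M A c : ℝ} {u0 : Eu N → ℝ} {τ : ℕ → ℝ} {U V : ℕ → Eu N → ℝ}

noncomputable def aa (τ : ℕ → ℝ) (U : ℕ → Eu N → ℝ) (k : ℕ) : Eu N → ℝ := fun y => (τ k)⁻¹ * U k y

lemma CS.τp (H : CS Ω lam mu M A c u0 τ U V) (k : ℕ) : 0 < τ k := by linarith [H.τ1 k]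

lemma CS.a2 (H : CS Ω lam mu M A c u0 τ U V) (k : ℕ) : ContDiffOn ℝ 2 (aa τ U k) (closure Ω) :=
  contDiffOn_const.mul (H.sol k).1

lemma CS.a3 (H : CS Ω lam mu M A c u0 τ U V) (k : ℕ) (hx : x ∈ Ω) : ContDiffAt ℝ 3 (aa τ U k) x :=
  contDiffAt_const.mul (gel_smooth H.us.op (H.sol k) hx).1

lemma CS.a0 (H : CS Ω lam mu M A c u0 τ U V) (k : ℕ) : ∀ x ∈ frontier Ω, aa τ U k x = 0 := fun x hx => by
  rw [aa, (H.sol k).2.2.2.2.1 x hx, mul_zero]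

lemma CS.lapa (H : CS Ω lam mu M A c u0 τ U V) (k : ℕ) (hx : x ∈ Ω) : lap (aa τ U k) x = -(mu * exp (V k x)) := by
  have h1 := (H.sol k).2.2.1 x hx
  have h2 := H.τp k
  unfold aa
  rw [lap_cmul _ (cdat H.us.op (H.sol k).1 hx)]
  have : lap (U k) x = -(τ k * mu * exp (V k x)) := by linarith
  rw [this]; field_simp

lemma CS.Ua (H : CS Ω lam mu M A c u0 τ U V) (k : ℕ) : U k = fun y => τ k * aa τ U k y := by
  have h2 := H.τp k
  funext y; unfold aa; field_simp

lemma CS.bdd (H : CS Ω lam mu M A c u0 τ U V) :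
    ∃ B, 0 < B ∧ ∀ k, ∀ x ∈ Ω, |aa τ U k x| ≤ B * u0 x ∧ ‖fderiv ℝ (aa τ U k) x‖ ≤ B := by
  have hm := H.m0
  have hD := DC_one (N := N) (A := A) H.us.c0
  refine ⟨DC N A c * (mu * exp M), by positivity, fun k => ?_⟩
  refine D_est H.us (fun x hx => c32 (H.a3 k hx)) (bd_lim (H.a2 k).continuousOn (H.a0 k)) (by positivity) fun x hx => ?_
  rw [H.lapa k hx, abs_neg, abs_of_pos (by positivity)]
  have := H.vM k x hx
  gcongr

lemma CS.dU (H : CS Ω lam mu M A c u0 τ U V) (k : ℕ) (hx : x ∈ Ω) : dd (U k) e x = τ k * dd (aa τ U k) e x := by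
  conv_lhs => rw [H.Ua k]
  exact dd_cmul _ ((H.a3 k hx).differentiableAt (by norm_num))

lemma CS.diff (H : CS Ω lam mu M A c u0 τ U V) (hV : Cau Ω V) : ∀ ε > 0, ∃ K, ∀ k ≥ K, ∀ m ≥ K, ∀ x ∈ Ω,
    |aa τ U k x - aa τ U m x| ≤ ε * u0 x ∧ ‖fderiv ℝ (fun y => aa τ U k y - aa τ U m y) x‖ ≤ ε ∧
    |lap (fun y => aa τ U k y - aa τ U m y) x| ≤ ε := by
  intro ε hε
  have hm := H.m0
  have hD := DC_one (N := N) (A := A) H.us.c0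
  have hD0 : 0 < DC N A c := by linarith
  obtain ⟨K, hK⟩ := hV (ε / DC N A c / (mu * exp M)) (by positivity)
  refine ⟨K, fun k hk m hm' x hx => ?_⟩
  have l : ∀ x ∈ Ω, |lap (fun y => aa τ U k y - aa τ U m y) x| ≤ ε / DC N A c := by
    intro x hx
    rw [lap_sub (c32 (H.a3 k hx)) (c32 (H.a3 m hx)), H.lapa k hx, H.lapa m hx]
    have e1 : -(mu * exp (V k x)) - -(mu * exp (V m x)) = -(mu * (exp (V k x) - exp (V m x))) := by ring
    rw [e1, abs_neg, abs_mul, abs_of_pos hm]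
    calc mu * |exp (V k x) - exp (V m x)| ≤ mu * (exp M * |V k x - V m x|) := by
          gcongr; exact exp_lip (H.vM k x hx) (H.vM m x hx)
      _ ≤ mu * (exp M * (ε / DC N A c / (mu * exp M))) := by gcongr; exact hK k hk m hm' x hx
      _ = ε / DC N A c := by field_simp
  have := D_est H.us (w := fun y => aa τ U k y - aa τ U m y) (fun x hx => (c32 (H.a3 k hx)).sub (c32 (H.a3 m hx)))
    (bd_lim ((H.a2 k).sub (H.a2 m)).continuousOn (fun x hx => by rw [H.a0 k x hx, H.a0 m x hx, sub_zero]))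
    (by positivity) l x hx
  have e1 : DC N A c * (ε / DC N A c) = ε := by field_simp
  rw [e1] at this
  exact ⟨this.1, this.2, (l x hx).trans (div_le_self hε.le hD)⟩

lemma CS.gU (H : CS Ω lam mu M A c u0 τ U V) : ∃ B, 0 < B ∧ ∀ k, ∀ x ∈ Ω, ∀ e, ‖e‖ ≤ 1 → |dd (U k) e x| ≤ B := by
  obtain ⟨B, hB0, hB⟩ := H.bdd
  refine ⟨B, hB0, fun k x hx e he => ?_⟩
  rw [H.dU k hx, abs_mul, abs_of_pos (H.τp k)]
  have := abs_dd_le (e := e) (hB k x hx).2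
  calc τ k * |dd (aa τ U k) e x| ≤ 1 * (B * 1) := by
        gcongr
        · exact H.τ2 k
        · exact this.trans (by gcongr)
    _ = B := by ring

lemma CS.cauG (H : CS Ω lam mu M A c u0 τ U V) (hV : Cau Ω V) : CauG Ω U := by
  intro ε hε
  obtain ⟨B, hB0, hB⟩ := H.bdd
  obtain ⟨K1, hK1⟩ := H.diff hV (ε / 2) (by positivity)
  have hτ := H.τ3.cauchySeq
  rw [Metric.cauchySeq_iff] at hτ
  obtain ⟨K2, hK2⟩ := hτ (ε / (2 * B)) (by positivity)
  refine ⟨max K1 K2, fun k hk m hm x hx e he => ?_⟩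
  have h1 := (hK1 k (le_of_max_le_left hk) m (le_of_max_le_left hm) x hx).2.1
  have h2 := hK2 k (le_of_max_le_right hk) m (le_of_max_le_right hm)
  rw [Real.dist_eq] at h2
  have h3 := abs_dd_le (e := e) h1
  rw [dd_sub ((H.a3 k hx).differentiableAt (by norm_num)) ((H.a3 m hx).differentiableAt (by norm_num))] at h3
  have h4 := abs_dd_le (e := e) (hB m x hx).2
  rw [H.dU k hx, H.dU m hx]
  have e1 : τ k * dd (aa τ U k) e x - τ m * dd (aa τ U m) e x
      = τ k * (dd (aa τ U k) e x - dd (aa τ U m) e x) + (τ k - τ m) * dd (aa τ U m) e x := by ring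
  rw [e1]
  refine (abs_add_le _ _).trans ?_
  rw [abs_mul, abs_mul, abs_of_pos (H.τp k)]
  have h5 : τ k * |dd (aa τ U k) e x - dd (aa τ U m) e x| ≤ 1 * (ε / 2 * 1) := by
    gcongr
    · exact H.τ2 k
    · exact h3.trans (by gcongr)
  have h6 : |τ k - τ m| * |dd (aa τ U m) e x| ≤ ε / (2 * B) * (B * 1) := by
    gcongr
    exact h4.trans (by gcongr)
  have h7 : ε / (2 * B) * (B * 1) = ε / 2 := by field_simp
  linarith

lemma CS.ws (H : CS Ω lam mu M A c u0 τ U V) (hV : Cau Ω V) (hG : CauG Ω V) {B : ℝ} (hB0 : 0 < B)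
    (hB : ∀ k, ∀ x ∈ Ω, ∀ e, ‖e‖ ≤ 1 → |dd (V k) e x| ≤ B) :
    ∀ ε > 0, ∃ K, ∀ k ≥ K, ∀ m ≥ K, WS Ω u0 (fun y => aa τ U k y - aa τ U m y) ε := by
  intro ε hε
  have hm0 := H.m0
  obtain ⟨K1, hK1⟩ := H.diff hV ε hε
  obtain ⟨K2, hK2⟩ := hV (ε / (2 * B * (mu * exp M))) (by positivity)
  obtain ⟨K3, hK3⟩ := hG (ε / (2 * (mu * exp M))) (by positivity)
  refine ⟨max K1 (max K2 K3), fun k hk m hm => ?_⟩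
  have hk1 := le_of_max_le_left hk
  have hm1 := le_of_max_le_left hm
  have hk2 := le_of_max_le_left (le_of_max_le_right hk)
  have hm2 := le_of_max_le_left (le_of_max_le_right hm)
  have hk3 := le_of_max_le_right (le_of_max_le_right hk)
  have hm3 := le_of_max_le_right (le_of_max_le_right hm)
  refine ⟨fun x hx => (H.a3 k hx).sub (H.a3 m hx), fun x hx => (hK1 k hk1 m hm1 x hx).1,
    fun x hx => (hK1 k hk1 m hm1 x hx).2.2, fun x hx e he => ?_⟩
  have hΩ := H.us.op
  have e0 : lap (fun y => aa τ U k y - aa τ U m y) =ᶠ[𝓝 x] fun y => lap (aa τ U k) y - lap (aa τ U m) y := by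
    filter_upwards [hΩ.mem_nhds hx] with y hy
    exact lap_sub (c32 (H.a3 k hy)) (c32 (H.a3 m hy))
  have dl : ∀ k, DifferentiableAt ℝ (lap (aa τ U k)) x := fun k =>
    ((H.a3 k hx).lap (m := 1) (by norm_num)).differentiableAt (by norm_num)
  rw [dd_congr e0, dd_sub (dl k) (dl m),
    dd_lap hΩ (cdat hΩ (H.sol k).2.1 hx) hx (fun y hy => H.lapa k hy),
    dd_lap hΩ (cdat hΩ (H.sol m).2.1 hx) hx (fun y hy => H.lapa m hy)]
  have e1 : -(mu * exp (V k x)) * dd (V k) e x - -(mu * exp (V m x)) * dd (V m) e x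
      = -(mu * (exp (V k x) * (dd (V k) e x - dd (V m) e x) + (exp (V k x) - exp (V m x)) * dd (V m) e x)) := by ring
  rw [e1, abs_neg, abs_mul, abs_of_pos hm0]
  have i1 : |exp (V k x) * (dd (V k) e x - dd (V m) e x)| ≤ exp M * (ε / (2 * (mu * exp M))) := by
    rw [abs_mul, abs_of_pos (exp_pos _)]
    have := H.vM k x hx
    have := hK3 k hk3 m hm3 x hx e he
    gcongr
  have i2 : |(exp (V k x) - exp (V m x)) * dd (V m) e x| ≤ exp M * (ε / (2 * B * (mu * exp M))) * B := by
    rw [abs_mul]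
    have h1 := exp_lip (H.vM k x hx) (H.vM m x hx)
    have h2 := hK2 k hk2 m hm2 x hx
    have h3 := hB m x hx e he
    gcongr
    exact h1.trans (by gcongr)
  calc mu * |exp (V k x) * (dd (V k) e x - dd (V m) e x) + (exp (V k x) - exp (V m x)) * dd (V m) e x|
      ≤ mu * (exp M * (ε / (2 * (mu * exp M))) + exp M * (ε / (2 * B * (mu * exp M))) * B) := by
        gcongr; exact (abs_add_le _ _).trans (add_le_add i1 i2)
    _ = ε := by field_simp; ring

lemma CS.cont (H : CS Ω lam mu M A c u0 τ U V)
    (hf : ∀ x ∈ closure Ω, Tendsto (fun k => U k x) atTop (𝓝 (f x))) : ContinuousOn f (closure Ω) := by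
  have hΩ := H.us.op
  obtain ⟨B, hB0, hB⟩ := H.bdd
  have hBU : ∀ k, ∀ x ∈ Ω, |U k x| ≤ B * u0 x ∧ DifferentiableAt ℝ (U k) x ∧ ‖fderiv ℝ (U k) x‖ ≤ B := by
    intro k x hx
    have hd : DifferentiableAt ℝ (aa τ U k) x := (H.a3 k hx).differentiableAt (by norm_num)
    obtain ⟨b1, b2⟩ := hB k x hx
    have t0 := H.τp k
    have t1 := H.τ2 k
    rw [H.Ua k]
    refine ⟨?_, hd.const_mul _, ?_⟩
    · rw [abs_mul, abs_of_pos t0]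
      nlinarith [abs_nonneg (aa τ U k x)]
    · rw [fderiv_const_mul hd, norm_smul, norm_of_nonneg t0.le]
      nlinarith [norm_nonneg (fderiv ℝ (aa τ U k) x)]
  intro x hx
  by_cases hxΩ : x ∈ Ω
  · obtain ⟨δ, hδ, hb⟩ := Metric.isOpen_iff.1 hΩ x hxΩ
    have hL : ∀ y ∈ Metric.ball x δ, dist (f y) (f x) ≤ B * dist y x := by
      intro y hy
      have hyΩ := hb hy
      rw [dist_eq_norm, dist_eq_norm]
      refine le_of_tendsto (((hf y (subset_closure hyΩ)).sub (hf x hx)).norm) (Eventually.of_forall fun k => ?_)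
      have := seg_lip (g := U k) (y := x) (v := y - x) (B := B) (Ω := Ω) (fun z hz => (hBU k z hz).2) (fun s hs => hb (by
        have := mem_ball_iff_norm.1 hy
        rw [mem_ball_iff_norm, add_sub_cancel_left, norm_smul, norm_of_nonneg hs.1]
        nlinarith [hs.2, norm_nonneg (y - x)]))
      rwa [add_sub_cancel] at this
    refine ContinuousAt.continuousWithinAt ?_
    rw [ContinuousAt, tendsto_iff_dist_tendsto_zero]
    refine squeeze_zero' (Eventually.of_forall fun _ => dist_nonneg)
      (by filter_upwards [Metric.ball_mem_nhds x hδ] with y hy using hL y hy) ?_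
    have : Tendsto (fun y => B * dist y x) (𝓝 x) (𝓝 (B * dist x x)) := by
      apply Continuous.tendsto; fun_prop
    simpa using this
  · have fr : ∀ y ∈ closure Ω, y ∉ Ω → y ∈ frontier Ω := fun y hy hyn => by rw [hΩ.frontier_eq]; exact ⟨hy, hyn⟩
    have hle : ∀ y ∈ closure Ω, |f y| ≤ B * u0 y := by
      intro y hy
      refine le_of_tendsto (hf y hy).abs (Eventually.of_forall fun k => ?_)
      by_cases hyΩ : y ∈ Ω
      · exact (hBU k y hyΩ).1
      · rw [(H.sol k).2.2.2.2.1 y (fr y hy hyΩ), H.u00 y (fr y hy hyΩ)]; simp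
    have hz : u0 x = 0 := H.u00 x (fr x hx hxΩ)
    have hfx : f x = 0 := by
      have := hle x hx
      rw [hz, mul_zero] at this
      exact abs_nonpos_iff.1 this
    have h1 : Tendsto (fun y => B * u0 y) (𝓝[closure Ω] x) (𝓝 0) := by
      have := (H.u0c.continuousOn x hx).const_mul B (M := ℝ)
      have h2 : Tendsto (fun y => B * u0 y) (𝓝[closure Ω] x) (𝓝 (B * u0 x)) := this
      rwa [hz, mul_zero] at h2
    show Tendsto f (𝓝[closure Ω] x) (𝓝 (f x))
    rw [hfx]
    refine squeeze_zero_norm' ?_ h1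
    filter_upwards [self_mem_nhdsWithin] with y hy using hle y hy

lemma CS.cau (H : CS Ω lam mu M A c u0 τ U V) (hmono : ∀ x ∈ closure Ω, Monotone fun k => U k x)
    (hf : ∀ x ∈ closure Ω, Tendsto (fun k => U k x) atTop (𝓝 (f x))) : Cau Ω U := by
  have hc := H.cont hf
  have hu := Monotone.tendstoUniformlyOn_of_forall_tendsto (H.us.bd.isCompact_closure) (F := U)
    (fun k => (H.sol k).1.continuousOn) hmono hc hf
  intro ε hε
  have := hu.uniformCauchySeqOn
  rw [Metric.uniformCauchySeqOn_iff] at this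
  obtain ⟨K, hK⟩ := this ε hε
  exact ⟨K, fun k hk m hm x hx => (hK k hk m hm x (subset_closure hx)).le⟩

lemma CS.concl (hN : (1:ℝ) ≤ N) (H : CS Ω lam mu M A c u0 τ U V) (hV : Cau Ω V) (hG : CauG Ω V) {B : ℝ} (hB0 : 0 < B)
    (hB : ∀ k, ∀ x ∈ Ω, ∀ e, ‖e‖ ≤ 1 → |dd (V k) e x| ≤ B)
    (hf : ∀ x ∈ closure Ω, Tendsto (fun k => U k x) atTop (𝓝 (f x)))
    (hg : ∀ x ∈ closure Ω, Tendsto (fun k => V k x) atTop (𝓝 (g x))) :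
    ContDiffOn ℝ 2 f (closure Ω) ∧ (∀ x ∈ Ω, -lap f x = mu * exp (g x)) ∧ ∀ x ∈ frontier Ω, f x = 0 := by
  have hW := H.ws hV hG hB0 hB
  have ha : ∀ x ∈ closure Ω, Tendsto (fun k => aa τ U k x) atTop (𝓝 (f x)) := by
    intro x hx
    have := (H.τ3.inv₀ one_ne_zero).mul (hf x hx)
    simpa [aa] using this
  obtain ⟨h1, h2⟩ := L_final hN H.us H.u0c H.u00 H.a2 H.a0 hW ha
  refine ⟨h1, fun x hx => ?_, fun x hx => ?_⟩
  · have h3 := h2 x hx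
    simp only [H.lapa _ hx] at h3
    have h4 : Tendsto (fun k => -(mu * exp (V k x))) atTop (𝓝 (-(mu * exp (g x)))) :=
      (((Real.continuous_exp.tendsto _).comp (hg x (subset_closure hx))).const_mul mu).neg
    rw [tendsto_nhds_unique h3 h4]; ring
  · refine tendsto_nhds_unique (hf x (frontier_subset_closure hx)) ?_
    simp only [fun k => (H.sol k).2.2.2.2.1 x hx]
    exact tendsto_const_nhds
end asm6

section asm7
variable {N : ℕ}

lemma gel_swap {Ω : Set (Eu N)} {lam mu : ℝ} {u v : Eu N → ℝ} (h : IsGelfandSolution Ω lam mu u v) :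
    IsGelfandSolution Ω mu lam v u :=
  ⟨h.2.1, h.1, h.2.2.2.1, h.2.2.1, h.2.2.2.2.2, h.2.2.2.2.1⟩

theorem main_ext (hN1 : 1 ≤ N) (hN9 : N ≤ 9)
    (Ω : Set (Eu N)) (hΩ : IsBoundedDomain Ω)
    (lamStar muStar : ℝ) (hlam : 0 < lamStar) (hmu : 0 < muStar)
    (u v : ℕ → Eu N → ℝ) (uStar vStar : Eu N → ℝ)
    (hsol : ∀ n : ℕ, 1 ≤ n →
      IsStableGelfandSolution Ω ((1 - 1 / (n : ℝ)) * lamStar) ((1 - 1 / (n : ℝ)) * muStar)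
        (u n) (v n))
    (hu_mono : ∀ x ∈ closure Ω, Monotone fun n => u n x)
    (hv_mono : ∀ x ∈ closure Ω, Monotone fun n => v n x)
    (hu_lim : ∀ x ∈ closure Ω, Tendsto (fun n => u n x) atTop (𝓝 (uStar x)))
    (hv_lim : ∀ x ∈ closure Ω, Tendsto (fun n => v n x) atTop (𝓝 (vStar x))) :
    (∃ M : ℝ, ∀ x ∈ Ω, |uStar x| ≤ M ∧ |vStar x| ≤ M) ∧
    ContDiffOn ℝ ∞ uStar Ω ∧ ContDiffOn ℝ ∞ vStar Ω ∧
    IsGelfandSolution Ω lamStar muStar uStar vStar := by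
  obtain ⟨hO, -, hb⟩ := hΩ
  set τ : ℕ → ℝ := fun k => 1 - 1 / ((k + 2 : ℕ) : ℝ) with hτ
  have τ1 : ∀ k, 1 / 2 ≤ τ k := by
    intro k
    have : 1 / ((k + 2 : ℕ) : ℝ) ≤ 1 / 2 := by
      apply one_div_le_one_div_of_le (by norm_num)
      push_cast
      have : (0:ℝ) ≤ k := by positivity
      linarith
    simp only [hτ]; linarith
  have τ2 : ∀ k, τ k ≤ 1 := by
    intro k
    have : 0 ≤ 1 / ((k + 2 : ℕ) : ℝ) := by positivity
    simp only [hτ]; linarith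
  have τ3 : Tendsto τ atTop (𝓝 1) := by
    have h1 : Tendsto (fun k : ℕ => 1 / ((k + 2 : ℕ) : ℝ)) atTop (𝓝 0) :=
      (tendsto_add_atTop_iff_nat (f := fun k : ℕ => 1 / (k : ℝ)) 2).2 tendsto_one_div_atTop_nhds_zero_nat
    simpa [hτ] using h1.const_sub 1
  have hst : ∀ k, IsStableGelfandSolution Ω (τ k * lamStar) (τ k * muStar) (u (k + 2)) (v (k + 2)) :=
    fun k => hsol (k + 2) (by omega)
  have hul : ∀ x ∈ closure Ω, Tendsto (fun k => u (k + 2) x) atTop (𝓝 (uStar x)) := fun x hx =>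
    (tendsto_add_atTop_iff_nat (f := fun n => u n x) 2).2 (hu_lim x hx)
  have hvl : ∀ x ∈ closure Ω, Tendsto (fun k => v (k + 2) x) atTop (𝓝 (vStar x)) := fun x hx =>
    (tendsto_add_atTop_iff_nat (f := fun n => v n x) 2).2 (hv_lim x hx)
  have hum : ∀ x ∈ closure Ω, Monotone fun k => u (k + 2) x := fun x hx i j hij =>
    hu_mono x hx (by omega)
  have hvm : ∀ x ∈ closure Ω, Monotone fun k => v (k + 2) x := fun x hx i j hij =>
    hv_mono x hx (by omega)
  set Λ : ℝ := 1 + lamStar + muStar + 2 / lamStar + 2 / muStar with hΛ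
  have p1 : 0 < 2 / lamStar := by positivity
  have p2 : 0 < 2 / muStar := by positivity
  have hΛ1 : 1 ≤ Λ := by linarith
  have hlow : ∀ k, ∀ s, 0 < s → 2 / s ≤ Λ → 1 / Λ ≤ τ k * s := by
    intro k s hs h
    have h1 : s / 2 ≤ τ k * s := by nlinarith [τ1 k]
    refine le_trans ?_ h1
    rw [div_le_div_iff₀ (by linarith) (by norm_num)]
    rw [div_le_iff₀ hs] at h
    linarith
  have hupp : ∀ k, ∀ s, 0 < s → s ≤ Λ → τ k * s ≤ Λ := by
    intro k s hs h
    nlinarith [τ2 k]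
  obtain ⟨M, hM⟩ := linfBound (Ω := Ω) hN9 hb Λ hΛ1
  have hbd : ∀ k, ∀ x ∈ Ω, (0 ≤ u (k + 2) x ∧ u (k + 2) x ≤ M) ∧ 0 ≤ v (k + 2) x ∧ v (k + 2) x ≤ M := by
    intro k x hx
    have ht : 0 < τ k := by linarith [τ1 k]
    obtain ⟨r, t, h⟩ := SS_of hO hb (mul_pos ht hlam) (mul_pos ht hmu) (hst k)
    have l1 := hlow k lamStar hlam (by linarith)
    have l2 := hlow k muStar hmu (by linarith)
    have l3 := hupp k lamStar hlam (by linarith)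
    have l4 := hupp k muStar hmu (by linarith)
    have a1 := hM _ _ _ _ _ _ h l1 l3 l2 l4 x
    have a2 := hM _ _ _ _ _ _ h.symm l2 l4 l1 l3 x
    have a3 := h.nonneg x
    have a4 := h.symm.nonneg x
    rw [indicator_of_mem hx] at a1 a2 a3 a4
    exact ⟨⟨a3, a1⟩, a4, a2⟩
  have ht0 : 0 < τ 0 := lt_of_lt_of_le (by norm_num) (τ1 0)
  obtain ⟨A, hA⟩ := US_of hO hb (mul_pos ht0 hmu) (hst 0).1 (fun x hx => (hbd 0 x hx).1.1)
    (fun x hx => (hbd 0 x hx).2.1)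
  obtain ⟨A', hA'⟩ := US_of hO hb (mul_pos ht0 hlam) (gel_swap (hst 0).1) (fun x hx => (hbd 0 x hx).2.1)
    (fun x hx => (hbd 0 x hx).1.1)
  have H1 : CS Ω lamStar muStar M A (τ 0 * muStar) (u (0 + 2)) τ (fun k => u (k + 2)) (fun k => v (k + 2)) :=
    ⟨hA, (hst 0).1.1, (hst 0).1.2.2.2.2.1, τ1, τ2, τ3, hmu, fun k => (hst k).1, fun k x hx => (hbd k x hx).2.2⟩
  have H2 : CS Ω muStar lamStar M A' (τ 0 * lamStar) (v (0 + 2)) τ (fun k => v (k + 2)) (fun k => u (k + 2)) :=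
    ⟨hA', (hst 0).1.2.1, (hst 0).1.2.2.2.2.2, τ1, τ2, τ3, hlam, fun k => gel_swap (hst k).1,
      fun k x hx => (hbd k x hx).1.2⟩
  have cu := H1.cau hum hul
  have cv := H2.cau hvm hvl
  have gu := H1.cauG cv
  have gv := H2.cauG cu
  obtain ⟨B1, b1, hB1⟩ := H1.gU
  obtain ⟨B2, b2, hB2⟩ := H2.gU
  have hN : (1:ℝ) ≤ N := by exact_mod_cast hN1
  obtain ⟨c1, c2, c3⟩ := H1.concl hN cv gv b2 hB2 hul hvl
  obtain ⟨d1, d2, d3⟩ := H2.concl hN cu gu b1 hB1 hvl hul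
  obtain ⟨s1, s2⟩ := sys_smooth hO (c1.mono subset_closure) (d1.mono subset_closure) c2 d2
  refine ⟨⟨M, fun x hx => ?_⟩, s1, s2, c1, d1, c2, d2, c3, d3⟩
  have hx' := subset_closure hx
  have e1 := ge_of_tendsto' (hul x hx') fun k => (hbd k x hx).1.1
  have e2 := le_of_tendsto' (hul x hx') fun k => (hbd k x hx).1.2
  have e3 := ge_of_tendsto' (hvl x hx') fun k => (hbd k x hx).2.1
  have e4 := le_of_tendsto' (hvl x hx') fun k => (hbd k x hx).2.2
  rw [abs_of_nonneg e1, abs_of_nonneg e3]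
  exact ⟨e2, e4⟩
end asm7

end mainProof

/-- For `1 ≤ N ≤ 9`, extremal solutions of the Gelfand system,
i.e. increasing pointwise limits of stable classical solutions along the parameters
`(1 - 1/n)(λ*, μ*)`, are bounded and smooth classical solutions for `(λ*, μ*)`. -/
theorem extremal_solutions_smooth {N : ℕ} (hN1 : 1 ≤ N) (hN9 : N ≤ 9)
    (Ω : Set (EuclideanSpace ℝ (Fin N))) (hΩ : IsBoundedDomain Ω)
    (lamStar muStar : ℝ) (hlam : 0 < lamStar) (hmu : 0 < muStar)
    (u v : ℕ → EuclideanSpace ℝ (Fin N) → ℝ)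
    (uStar vStar : EuclideanSpace ℝ (Fin N) → ℝ)
    (hsol : ∀ n : ℕ, 1 ≤ n →
      IsStableGelfandSolution Ω ((1 - 1 / (n : ℝ)) * lamStar) ((1 - 1 / (n : ℝ)) * muStar)
        (u n) (v n))
    (hu_mono : ∀ x ∈ closure Ω, Monotone fun n => u n x)
    (hv_mono : ∀ x ∈ closure Ω, Monotone fun n => v n x)
    (hu_lim : ∀ x ∈ closure Ω,
      Filter.Tendsto (fun n => u n x) Filter.atTop (nhds (uStar x)))
    (hv_lim : ∀ x ∈ closure Ω,
      Filter.Tendsto (fun n => v n x) Filter.atTop (nhds (vStar x))) :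
    (∃ M : ℝ, ∀ x ∈ Ω, |uStar x| ≤ M ∧ |vStar x| ≤ M) ∧
    ContDiffOn ℝ (⊤ : ℕ∞) uStar Ω ∧ ContDiffOn ℝ (⊤ : ℕ∞) vStar Ω ∧
    IsGelfandSolution Ω lamStar muStar uStar vStar := by
  exact main_ext hN1 hN9 Ω hΩ lamStar muStar hlam hmu u v uStar vStar hsol hu_mono hv_mono hu_lim hv_lim
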